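/- Let m ≥ 1 and let A = (A_{αβ}) be bounded measurable t-independent coefficients of order m on ℝ^{n+1} with ‖A‖_∞ ≤ Λ satisfying the Gårding inequality with constant λ > 0. There exists ε > 0 depending only on n, m, λ, Λ with the following property. Let u have weak derivatives of order up to m in L²_loc(ℝ^{n+1}_+ ∪ ℝ^{n+1}_−) with A₂⁺(t ∇^m u) ∈ L²(ℝⁿ), suppose Ñ_*(∇^{m−1}u) ∈ L²_loc(ℝⁿ), and let ψ ∈ L²_loc(ℝⁿ) be nonnegative. Suppose that for each cube Q ⊂ ℝⁿ there is a function u_Q, with weak derivatives of order up to m in L²_loc(ℝ^{n+1}_+ ∪ ℝ^{n+1}_−), such that u − u_Q has weak derivatives of order up to m in L²(3Q × (−ℓ(Q), ℓ(Q))), L(u − u_Q) = 0 weakly in 3Q × (−ℓ(Q), ℓ(Q)), and ‖A₂⁺(t ∇^m u_Q)‖²_{L²(ℝⁿ)} + ‖Ñ_*(∇^{m−1} u_Q)‖²_{L²(ℝⁿ)} ≤ ‖ψ‖²_{L²(4Q)}. Then for every p with 2 ≤ p < 2+ε, if ψ ∈ L^p(ℝⁿ) and Ñ_*(∇^{m−1}u)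 ∈ L^p(ℝⁿ), one has ‖A₂⁺(t ∇^m u)‖_{L^p(ℝⁿ)} ≤ C_p ‖ψ‖_{L^p(ℝⁿ)} + C_p ‖Ñ_*(∇^{m−1} u)‖_{L^p(ℝⁿ)}, where C_p depends only on n, m, λ, Λ, p. -/

import Mathlib

/- STATEMENT 4: Area integral self-improvement for solutions
(second part of Lemma `lem:lusin:+` of the paper). -/

open MeasureTheory ENNReal Set Finset
noncomputable section

/-- The open axis-parallel cube in `ℝⁿ` with center `c` and side length `ℓ`. -/
def cube {n : ℕ} (c : Fin n → ℝ) (ℓ : ℝ) : Set (Fin n → ℝ) :=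
  {x | ∀ i, |x i - c i| < ℓ / 2}

/-- Euclidean distance on `ℝⁿ` (modeled as `Fin n → ℝ`). -/
def eudist {n : ℕ} (x y : Fin n → ℝ) : ℝ :=
  Real.sqrt (∑ i, (x i - y i) ^ 2)

/-- The Euclidean ball in `ℝ^{n+1} = ℝⁿ × ℝ` with center `(y, s)` and radius `r`. -/
def eball {n : ℕ} (y : Fin n → ℝ) (s r : ℝ) : Set ((Fin n → ℝ) × ℝ) :=
  {p | eudist p.1 y ^ 2 + (p.2 - s) ^ 2 < r ^ 2}

/-- Average of the squared-magnitude density `G` over a set `S`, valued in `ℝ≥0∞`. -/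
def avgE {n : ℕ} (G : (Fin n → ℝ) × ℝ → ℝ≥0∞) (S : Set ((Fin n → ℝ) × ℝ)) : ℝ≥0∞ :=
  (∫⁻ p in S, G p) / volume S

/-- Two-sided modified nontangential maximal function `Ñ⋆`, applied to the
squared-magnitude density `G`. -/
def ntMaxStar {n : ℕ} (G : (Fin n → ℝ) × ℝ → ℝ≥0∞) (x : Fin n → ℝ) : ℝ≥0∞ :=
  ⨆ (y : Fin n → ℝ) (s : ℝ) (_ : s ≠ 0 ∧ eudist x y < |s|),
    (avgE G (eball y s (|s| / 2))) ^ (1/2 : ℝ)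

/-- The Lusin area integral `A₂⁺(tu)` applied to the squared-magnitude density `G = ‖u‖²`. -/
def lusin {n : ℕ} (G : (Fin n → ℝ) × ℝ → ℝ≥0∞) (x : Fin n → ℝ) : ℝ≥0∞ :=
  (∫⁻ p in {p : (Fin n → ℝ) × ℝ | 0 < p.2 ∧ eudist x p.1 < p.2},
      G p * ENNReal.ofReal (p.2 ^ ((1 : ℝ) - n))) ^ (1/2 : ℝ)

/-- `G` (a squared-magnitude density) is locally integrable on `Ω`. -/
def L2loc {n : ℕ} (Ω : Set ((Fin n → ℝ) × ℝ)) (G : (Fin n → ℝ) × ℝ → ℝ≥0∞) : Prop :=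
  ∀ K : Set ((Fin n → ℝ) × ℝ), K ⊆ Ω → IsCompact K → (∫⁻ p in K, G p) < ⊤

/-- Directional derivative operator on `ℝ^{n+1} = ℝⁿ × ℝ`. -/
def pdir {n : ℕ} (v : (Fin n → ℝ) × ℝ) (f : (Fin n → ℝ) × ℝ → ℂ) :
    (Fin n → ℝ) × ℝ → ℂ :=
  fun p => fderiv ℝ f p v

/-- The `i`-th coordinate direction in `ℝ^{n+1} = ℝⁿ × ℝ`. -/
def edir (n : ℕ) (i : Fin (n + 1)) : (Fin n → ℝ) × ℝ :=
  if h : (i : ℕ) < n then (Pi.single (⟨i, h⟩ : Fin n) 1, 0) else (0, 1)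

/-- Higher partial derivative `∂^γ` on `ℝ^{n+1}` for a multiindex `γ ∈ ℕ^{n+1}`. -/
def mpd {n : ℕ} (γ : Fin (n + 1) → ℕ) (f : (Fin n → ℝ) × ℝ → ℂ) :
    (Fin n → ℝ) × ℝ → ℂ :=
  (List.finRange (n + 1)).foldr (fun i g => (pdir (edir n i))^[γ i] g) f

/-- Test functions for an open set `Ω`: smooth, compactly supported inside `Ω`. -/
def IsTest {n : ℕ} (Ω : Set ((Fin n → ℝ) × ℝ)) (φ : (Fin n → ℝ) × ℝ → ℂ) : Prop :=
  ContDiff ℝ (⊤ : ℕ∞) φ ∧ HasCompactSupport φ ∧ tsupport φ ⊆ Ω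

/-- `v` is the weak derivative `∂^γ u` on `Ω`. -/
def IsWeakDeriv {n : ℕ} (Ω : Set ((Fin n → ℝ) × ℝ)) (γ : Fin (n + 1) → ℕ)
    (u v : (Fin n → ℝ) × ℝ → ℂ) : Prop :=
  ∀ φ, IsTest Ω φ →
    ∫ p in Ω, u p * mpd γ φ p = (-1 : ℂ) ^ (∑ i, γ i) * ∫ p in Ω, v p * φ p

/-- The finset of multiindices in `ℕ^{n+1}` of length `m`. -/
def MI (n m : ℕ) : Finset (Fin (n + 1) → ℕ) := Finset.Nat.antidiagonalTuple (n + 1) m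

/-- Coefficients of a divergence form operator of order `2m` on `ℝ^{n+1}`. -/
abbrev Coef (n : ℕ) := (Fin (n + 1) → ℕ) → (Fin (n + 1) → ℕ) → (Fin n → ℝ) × ℝ → ℂ

/-- All coefficients are measurable. -/
def CoefMeasurable {n : ℕ} (A : Coef n) : Prop := ∀ α β, Measurable (A α β)

/-- The coefficients are (essentially) bounded by `Λ`. -/
def CoefBounded {n : ℕ} (m : ℕ) (A : Coef n) (Λ : ℝ) : Prop :=
  ∀ α ∈ MI n m, ∀ β ∈ MI n m, ∀ᵐ p : (Fin n → ℝ) × ℝ, ‖A α β p‖ ≤ Λ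

/-- The coefficients are `t`-independent. -/
def TIndep {n : ℕ} (A : Coef n) : Prop :=
  ∀ α β (x : Fin n → ℝ) (s t : ℝ), A α β (x, s) = A α β (x, t)

/-- The Gårding inequality with constant `lam`. -/
def Garding {n : ℕ} (m : ℕ) (A : Coef n) (lam : ℝ) : Prop :=
  ∀ φ : (Fin n → ℝ) × ℝ → ℂ, ContDiff ℝ (⊤ : ℕ∞) φ → HasCompactSupport φ →
    lam * ∑ α ∈ MI n m, ∫ p, ‖mpd α φ p‖ ^ 2 ≤
      (∑ α ∈ MI n m, ∑ β ∈ MI n m,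
        ∫ p, (starRingEnd ℂ) (mpd α φ p) * A α β p * mpd β φ p).re

/-- `du` is a family of measurable weak derivatives of `u` of all orders up to `m`
on `Ω`, with `du 0 = u`. -/
def HasWDerivs {n : ℕ} (Ω : Set ((Fin n → ℝ) × ℝ)) (m : ℕ)
    (u : (Fin n → ℝ) × ℝ → ℂ) (du : (Fin (n + 1) → ℕ) → (Fin n → ℝ) × ℝ → ℂ) : Prop :=
  du (fun _ => 0) = u ∧
    ∀ γ : Fin (n + 1) → ℕ, (∑ i, γ i) ≤ m →
      Measurable (du γ) ∧ IsWeakDeriv Ω γ u (du γ)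

/-- `Lu = 0` weakly on `Ω`, where `du` encodes the weak derivatives of `u`. -/
def WeakSolution {n : ℕ} (m : ℕ) (A : Coef n) (Ω : Set ((Fin n → ℝ) × ℝ))
    (du : (Fin (n + 1) → ℕ) → (Fin n → ℝ) × ℝ → ℂ) : Prop :=
  ∀ φ, IsTest Ω φ →
    ∑ α ∈ MI n m, ∑ β ∈ MI n m,
      ∫ p in Ω, (starRingEnd ℂ) (mpd α φ p) * A α β p * du β p = 0

/-- Squared magnitude `|∇^k u|²` of the `k`-th order gradient array encoded by `du`. -/
def gradSq {n : ℕ} (k : ℕ) (du : (Fin (n + 1) → ℕ) → (Fin n → ℝ) × ℝ → ℂ) :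
    (Fin n → ℝ) × ℝ → ℝ≥0∞ :=
  fun p => ∑ γ ∈ MI n k, (‖du γ p‖₊ : ℝ≥0∞) ^ 2

/-- Points of `ℝ^{n+1} = ℝⁿ × ℝ`. -/
abbrev Pt (n : ℕ) := (Fin n → ℝ) × ℝ

/-- Smooth complex-valued functions on `ℝ^{n+1}`. -/
abbrev Smooth {n : ℕ} (f : Pt n → ℂ) : Prop := ContDiff ℝ (⊤ : ℕ∞) f

section MultiindexCalculus

variable {n : ℕ} {f g : Pt n → ℂ} {γ : Fin (n + 1) → ℕ}

lemma Smooth.differentiable (hf : Smooth f) : Differentiable ℝ f :=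
  ContDiff.differentiable hf (by simp)

lemma Smooth.pdir (hf : Smooth f) (v : Pt n) : Smooth (pdir v f) := by
  have h : ContDiff ℝ (⊤ : ℕ∞) (fderiv ℝ f) := hf.fderiv_right (by simp)
  exact h.clm_apply contDiff_const

lemma Smooth.pdir_iterate (hf : Smooth f) (v : Pt n) (k : ℕ) :
    Smooth ((_root_.pdir v)^[k] f) := by
  induction k with
  | zero => exact hf
  | succ k ih => rw [Function.iterate_succ_apply']; exact ih.pdir v

lemma pdir_comm (hf : Smooth f) (v w : Pt n) : pdir v (pdir w f) = pdir w (pdir v f) := by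
  have key : ∀ (a b : Pt n) (p : Pt n),
      pdir a (pdir b f) p = fderiv ℝ (fderiv ℝ f) p a b := by
    intro a b p
    have h : ContDiff ℝ (⊤ : ℕ∞) (fderiv ℝ f) := hf.fderiv_right (by simp)
    have h' : DifferentiableAt ℝ (fderiv ℝ f) p := (h.differentiable (by simp)) p
    have : HasFDerivAt (fun q => fderiv ℝ f q b)
        ((fderiv ℝ (fderiv ℝ f) p).flip b) p := by
      simpa using h'.hasFDerivAt.clm_apply (hasFDerivAt_const b p)
    change fderiv ℝ (fun q => fderiv ℝ f q b) p a = _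
    rw [this.fderiv]; rfl
  funext p
  rw [key, key]
  exact second_derivative_symmetric (f := f) (f' := fderiv ℝ f)
    (fun y => (hf.differentiable y).hasFDerivAt)
    (((hf.fderiv_right (m := (⊤ : ℕ∞)) (by simp)).differentiable (by simp)) p).hasFDerivAt v w

lemma pdir_iterate_comm (hf : Smooth f) (v w : Pt n) (k : ℕ) :
    pdir v ((pdir w)^[k] f) = (pdir w)^[k] (pdir v f) := by
  induction k with
  | zero => rfl
  | succ k ih =>
    rw [Function.iterate_succ_apply', Function.iterate_succ_apply', ← ih,
      pdir_comm (hf.pdir_iterate w k)]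

lemma Smooth.foldr_pdir (hf : Smooth f) (γ : Fin (n + 1) → ℕ) (l : List (Fin (n + 1))) :
    Smooth (l.foldr (fun i g => (_root_.pdir (edir n i))^[γ i] g) f) := by
  induction l with
  | nil => exact hf
  | cons a l ih => exact ih.pdir_iterate _ _

lemma Smooth.mpd (hf : Smooth f) (γ : Fin (n + 1) → ℕ) : Smooth (mpd γ f) :=
  hf.foldr_pdir γ _

lemma mpd_zero (f : Pt n → ℂ) : mpd (0 : Fin (n + 1) → ℕ) f = f := by
  unfold mpd
  induction List.finRange (n + 1) with
  | nil => rfl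
  | cons a l ih => simp

lemma foldr_pdir_add_single_of_notMem (γ : Fin (n + 1) → ℕ) (i : Fin (n + 1))
    (l : List (Fin (n + 1))) (hl : i ∉ l) :
    l.foldr (fun j g => (pdir (edir n j))^[(γ + Pi.single i 1 : Fin (n + 1) → ℕ) j] g) f =
      l.foldr (fun j g => (pdir (edir n j))^[γ j] g) f := by
  induction l with
  | nil => rfl
  | cons a l ih =>
    simp only [List.mem_cons, not_or] at hl
    rw [List.foldr_cons, List.foldr_cons, ih hl.2]
    simp [Pi.single_eq_of_ne (Ne.symm hl.1)]

lemma foldr_pdir_add_single (hf : Smooth f) (γ : Fin (n + 1) → ℕ) (i : Fin (n + 1))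
    (l : List (Fin (n + 1))) (hl : l.Nodup) (hi : i ∈ l) :
    l.foldr (fun j g => (pdir (edir n j))^[(γ + Pi.single i 1 : Fin (n + 1) → ℕ) j] g) f =
      pdir (edir n i) (l.foldr (fun j g => (pdir (edir n j))^[γ j] g) f) := by
  induction l with
  | nil => simp at hi
  | cons a l ih =>
    rw [List.nodup_cons] at hl
    rw [List.foldr_cons, List.foldr_cons]
    by_cases h : i = a
    · subst h
      rw [foldr_pdir_add_single_of_notMem γ i l hl.1]
      simp only [Pi.add_apply, Pi.single_eq_same]
      rw [Function.iterate_succ_apply']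
    · have hil : i ∈ l := by simpa [h] using hi
      rw [ih hl.2 hil, pdir_iterate_comm (hf.foldr_pdir γ l)]
      simp [Pi.single_eq_of_ne (Ne.symm h)]

/-- Adding one to the `i`-th entry of a multiindex is one more derivative in direction `i`. -/
lemma mpd_add_single (hf : Smooth f) (γ : Fin (n + 1) → ℕ) (i : Fin (n + 1)) :
    mpd (γ + Pi.single i 1) f = pdir (edir n i) (mpd γ f) :=
  foldr_pdir_add_single hf γ i _ (List.nodup_finRange _) (List.mem_finRange _)

/-- Induction on multiindices by raising one entry at a time. -/
lemma multiindex_induction {P : (Fin (n + 1) → ℕ) → Prop} (h0 : P 0)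
    (hs : ∀ γ i, P γ → P (γ + Pi.single i 1)) (γ : Fin (n + 1) → ℕ) : P γ := by
  induction hk : ∑ i, γ i generalizing γ with
  | zero =>
    have : γ = 0 := by
      funext i
      simpa using (Finset.sum_eq_zero_iff.1 hk) i (Finset.mem_univ i)
    rwa [this]
  | succ k ih =>
    obtain ⟨i, hi⟩ : ∃ i, γ i ≠ 0 := by
      by_contra! h
      simp [h] at hk
    have e : γ = (γ - Pi.single i 1) + Pi.single i 1 := by
      funext j
      by_cases hj : j = i
      · subst hj; simp; omega
      · simp [Pi.single_eq_of_ne hj]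
    rw [e]
    apply hs
    apply ih
    rw [e] at hk
    simp only [Pi.add_apply, Finset.sum_add_distrib, Finset.sum_pi_single', Finset.mem_univ,
      if_true] at hk
    simpa using hk

lemma sum_add_single (γ : Fin (n + 1) → ℕ) (i : Fin (n + 1)) :
    ∑ j, (γ + Pi.single i 1 : Fin (n + 1) → ℕ) j = ∑ j, γ j + 1 := by
  simp [Finset.sum_add_distrib]

lemma mem_MI {k : ℕ} : γ ∈ MI n k ↔ ∑ i, γ i = k := by
  simp [MI, Finset.Nat.mem_antidiagonalTuple]

lemma pdir_add (hf : Smooth f) (hg : Smooth g) (v : Pt n) :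
    pdir v (fun p => f p + g p) = fun p => pdir v f p + pdir v g p := by
  funext p
  simp only [pdir]
  rw [fderiv_fun_add (hf.differentiable p) (hg.differentiable p)]; rfl

lemma pdir_sub (hf : Smooth f) (hg : Smooth g) (v : Pt n) :
    pdir v (fun p => f p - g p) = fun p => pdir v f p - pdir v g p := by
  funext p
  simp only [pdir]
  rw [fderiv_fun_sub (hf.differentiable p) (hg.differentiable p)]; rfl

lemma pdir_mul (hf : Smooth f) (hg : Smooth g) (v : Pt n) :
    pdir v (fun p => f p * g p) = fun p => pdir v f p * g p + f p * pdir v g p := by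
  funext p
  simp only [pdir]
  rw [fderiv_fun_mul (hf.differentiable p) (hg.differentiable p)]
  simp; ring

lemma pdir_const_mul (hf : Smooth f) (c : ℂ) (v : Pt n) :
    pdir v (fun p => c * f p) = fun p => c * pdir v f p := by
  funext p
  simp only [pdir]
  rw [fderiv_const_mul (hf.differentiable p)]; rfl

lemma pdir_zero_fun (v : Pt n) : pdir v (fun _ => (0 : ℂ)) = fun _ => 0 := by
  funext p; simp [pdir]

lemma mpd_add (hf : Smooth f) (hg : Smooth g) (γ : Fin (n + 1) → ℕ) :
    mpd γ (fun p => f p + g p) = fun p => mpd γ f p + mpd γ g p := by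
  induction γ using multiindex_induction with
  | h0 => simp [mpd_zero]
  | hs γ i ih =>
    rw [mpd_add_single (ContDiff.add hf hg), ih, pdir_add (hf.mpd γ) (hg.mpd γ),
      mpd_add_single hf, mpd_add_single hg]

lemma mpd_sub (hf : Smooth f) (hg : Smooth g) (γ : Fin (n + 1) → ℕ) :
    mpd γ (fun p => f p - g p) = fun p => mpd γ f p - mpd γ g p := by
  induction γ using multiindex_induction with
  | h0 => simp [mpd_zero]
  | hs γ i ih =>
    rw [mpd_add_single (ContDiff.sub hf hg), ih, pdir_sub (hf.mpd γ) (hg.mpd γ),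
      mpd_add_single hf, mpd_add_single hg]

lemma mpd_const_mul (hf : Smooth f) (c : ℂ) (γ : Fin (n + 1) → ℕ) :
    mpd γ (fun p => c * f p) = fun p => c * mpd γ f p := by
  induction γ using multiindex_induction with
  | h0 => simp [mpd_zero]
  | hs γ i ih =>
    rw [mpd_add_single (contDiff_const.mul hf), ih, pdir_const_mul (hf.mpd γ),
      mpd_add_single hf]

lemma mpd_zero_fun (γ : Fin (n + 1) → ℕ) : mpd γ (fun _ : Pt n => (0 : ℂ)) = fun _ => 0 := by
  induction γ using multiindex_induction with
  | h0 => simp [mpd_zero]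
  | hs γ i ih => rw [mpd_add_single contDiff_const, ih, pdir_zero_fun]

lemma mpd_sum {ι : Type*} (s : Finset ι) (F : ι → Pt n → ℂ) (hF : ∀ i ∈ s, Smooth (F i))
    (γ : Fin (n + 1) → ℕ) :
    mpd γ (fun p => ∑ i ∈ s, F i p) = fun p => ∑ i ∈ s, mpd γ (F i) p := by
  classical
  induction s using Finset.induction_on with
  | empty => simpa using mpd_zero_fun γ
  | insert a s ha ih =>
    have h1 : Smooth (F a) := hF a (Finset.mem_insert_self a s)
    have h2 : ∀ i ∈ s, Smooth (F i) := fun i hi => hF i (Finset.mem_insert_of_mem hi)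
    simp only [Finset.sum_insert ha]
    rw [mpd_add h1 (ContDiff.sum h2), ih h2]

lemma mpd_comp_affine (hf : Smooth f) (a : Pt n) (s : ℝ) (γ : Fin (n + 1) → ℕ) :
    mpd γ (fun q => f (a + s • q)) = fun q => (s : ℂ) ^ (∑ i, γ i) * mpd γ f (a + s • q) := by
  have haff : ∀ {h : Pt n → ℂ}, Smooth h → Smooth (fun q => h (a + s • q)) := fun hh =>
    ContDiff.comp hh (by fun_prop)
  induction γ using multiindex_induction with
  | h0 => simp [mpd_zero]
  | hs γ i ih =>
    rw [mpd_add_single (haff hf), ih, pdir_const_mul (haff (hf.mpd γ)), mpd_add_single hf,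
      sum_add_single]
    funext q
    have h1 : HasFDerivAt (fun q : Pt n => a + s • q) (s • ContinuousLinearMap.id ℝ (Pt n)) q :=
      ((hasFDerivAt_id q).const_smul s).const_add a
    have h2 := ((hf.mpd γ).differentiable (a + s • q)).hasFDerivAt.comp q h1
    have h3 : pdir (edir n i) (fun q => mpd γ f (a + s • q)) q =
        s * pdir (edir n i) (mpd γ f) (a + s • q) := by
      simp only [pdir]
      have h4 := h2.fderiv
      simp only [Function.comp_def] at h4
      rw [h4]; simp
    rw [h3, pow_succ]; ring

lemma tsupport_pdir_subset (f : Pt n → ℂ) (v : Pt n) : tsupport (pdir v f) ⊆ tsupport f :=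
  tsupport_fderiv_apply_subset ℝ v

lemma tsupport_mpd_subset (hf : Smooth f) (γ : Fin (n + 1) → ℕ) :
    tsupport (mpd γ f) ⊆ tsupport f := by
  induction γ using multiindex_induction with
  | h0 => simp [mpd_zero]
  | hs γ i ih =>
    rw [mpd_add_single hf]
    exact (tsupport_pdir_subset _ _).trans ih

lemma HasCompactSupport.mpd (hc : HasCompactSupport f) (hf : Smooth f) (γ : Fin (n + 1) → ℕ) :
    HasCompactSupport (mpd γ f) :=
  hc.of_isClosed_subset (isClosed_tsupport _) (tsupport_mpd_subset hf γ)

/-- Leibniz rule: the terms other than `θ ∂^γ f` put at least one derivative on `θ`. -/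
lemma exists_leibniz (γ : Fin (n + 1) → ℕ) :
    ∃ l : List ((Fin (n + 1) → ℕ) × (Fin (n + 1) → ℕ)),
      (∀ a ∈ l, a.1 + a.2 = γ ∧ a.1 ≠ 0) ∧
      ∀ θ f : Pt n → ℂ, Smooth θ → Smooth f → ∀ p,
        mpd γ (fun q => θ q * f q) p =
          θ p * mpd γ f p + (l.map fun a => mpd a.1 θ p * mpd a.2 f p).sum := by
  induction γ using multiindex_induction with
  | h0 => exact ⟨[], by simp, by simp [mpd_zero]⟩
  | hs γ i ih =>
    obtain ⟨l, hl, h⟩ := ih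
    refine ⟨(Pi.single i 1, γ) :: (l.map (fun a => (a.1 + Pi.single i 1, a.2)) ++
      l.map (fun a => (a.1, a.2 + Pi.single i 1))), ?_, ?_⟩
    · intro a ha
      simp only [List.mem_cons, List.mem_append, List.mem_map] at ha
      rcases ha with rfl | ⟨b, hb, rfl⟩ | ⟨b, hb, rfl⟩
      · refine ⟨add_comm _ _, fun h => ?_⟩
        simpa using congrFun h i
      · refine ⟨by rw [← (hl b hb).1]; simp only; abel, fun h => ?_⟩
        simpa using congrFun h i
      · exact ⟨by rw [← (hl b hb).1]; simp only; abel, (hl b hb).2⟩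
    · intro θ f hθ hf p
      have hsum : ∀ l : List ((Fin (n + 1) → ℕ) × (Fin (n + 1) → ℕ)),
          Smooth (fun p => (l.map fun a => mpd a.1 θ p * mpd a.2 f p).sum) ∧
          ∀ p, pdir (edir n i) (fun p => (l.map fun a => mpd a.1 θ p * mpd a.2 f p).sum) p =
            (l.map fun a => mpd (a.1 + Pi.single i 1) θ p * mpd a.2 f p).sum +
            (l.map fun a => mpd a.1 θ p * mpd (a.2 + Pi.single i 1) f p).sum := by
        intro l
        induction l with
        | nil => exact ⟨contDiff_const, fun p => by simp [pdir_zero_fun]⟩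
        | cons a l ih =>
          have ha : Smooth (fun p => mpd a.1 θ p * mpd a.2 f p) :=
            ContDiff.mul (hθ.mpd _) (hf.mpd _)
          refine ⟨ContDiff.add ha ih.1, fun p => ?_⟩
          simp only [List.map_cons, List.sum_cons]
          rw [pdir_add ha ih.1]
          simp only
          rw [ih.2, pdir_mul (hθ.mpd _) (hf.mpd _), mpd_add_single hθ, mpd_add_single hf]
          ring
      rw [mpd_add_single (ContDiff.mul hθ hf), show mpd γ (fun q => θ q * f q) = _ from
        funext (h θ f hθ hf), pdir_add (ContDiff.mul hθ (hf.mpd γ)) (hsum l).1]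
      simp only
      rw [(hsum l).2, pdir_mul hθ (hf.mpd γ), mpd_add_single hf]
      simp only [List.map_cons, List.map_append, List.map_map, List.sum_cons, List.sum_append,
        Function.comp_def]
      have e : mpd (Pi.single i 1) θ = pdir (edir n i) θ := by
        have := mpd_add_single hθ 0 i
        rwa [zero_add, mpd_zero] at this
      rw [e]; ring

end MultiindexCalculus

section Polynomials

variable {n : ℕ} {f g : Pt n → ℂ}

/-- The `i`-th coordinate of a point of `ℝ^{n+1} = ℝⁿ × ℝ`. -/
def coord (i : Fin (n + 1)) (p : Pt n) : ℝ :=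
  if h : (i : ℕ) < n then p.1 ⟨i, h⟩ else p.2

lemma contDiff_coord (i : Fin (n + 1)) : ContDiff ℝ (⊤ : ℕ∞) (coord (n := n) i) := by
  unfold coord
  split_ifs with h
  · exact (contDiff_apply ℝ ℝ (⟨i, h⟩ : Fin n)).comp contDiff_fst
  · exact contDiff_snd

lemma coord_add_smul (i : Fin (n + 1)) (p v : Pt n) (s : ℝ) :
    coord i (p + s • v) = coord i p + s * coord i v := by
  unfold coord; split_ifs <;> simp

lemma coord_edir (i j : Fin (n + 1)) : coord i (edir n j) = if i = j then 1 else 0 := by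
  unfold coord edir
  split_ifs with h1 h2 h3 h4 h5 <;> simp_all [Fin.ext_iff] <;> omega

lemma sum_coord_smul_edir (p : Pt n) : ∑ i, coord i p • edir n i = p := by
  rw [Fin.sum_univ_castSucc]
  have h : ∀ i : Fin n, coord i.castSucc p • edir n i.castSucc = (Pi.single i (p.1 i), 0) := by
    intro i
    simp [coord, edir, ← Pi.single_smul]
  simp only [h]
  ext i
  · simp [coord, edir, Prod.fst_sum, Finset.sum_apply, Pi.single_apply]
  · simp [coord, edir, Prod.snd_sum]

lemma abs_coord_le (i : Fin (n + 1)) (p : Pt n) : |coord i p| ≤ ‖p‖ := by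
  unfold coord
  split_ifs with h
  · exact (norm_le_pi_norm p.1 _).trans (norm_fst_le p)
  · exact norm_snd_le p

/-- The normalized monomial `x^γ / γ!`. -/
def mono (γ : Fin (n + 1) → ℕ) (p : Pt n) : ℂ :=
  ∏ i, ((coord i p : ℂ) ^ γ i / ((γ i).factorial : ℂ))

lemma smooth_mono (γ : Fin (n + 1) → ℕ) : Smooth (mono γ : Pt n → ℂ) := by
  unfold mono
  refine contDiff_prod fun i _ => ?_
  refine ContDiff.div_const (ContDiff.pow ?_ _) _
  exact Complex.ofRealCLM.contDiff.comp (contDiff_coord i)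

lemma mono_zero (p : Pt n) : mono 0 p = 1 := by simp [mono]

lemma pdir_mono (γ : Fin (n + 1) → ℕ) (j : Fin (n + 1)) :
    pdir (edir n j) (mono γ) =
      if γ j = 0 then fun _ => 0 else mono (γ - Pi.single j 1) := by
  classical
  funext p
  have hd := (smooth_mono γ).differentiable p
  rw [pdir, ← hd.lineDeriv_eq_fderiv, lineDeriv]
  have e : ∀ s : ℝ, mono γ (p + s • edir n j) =
      ((coord j p + s : ℝ) : ℂ) ^ γ j / ((γ j).factorial : ℂ) *
        ∏ i ∈ univ.erase j, ((coord i p : ℂ) ^ γ i / ((γ i).factorial : ℂ)) := by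
    intro s
    rw [mono, ← Finset.mul_prod_erase univ _ (Finset.mem_univ j)]
    congr 1
    · rw [coord_add_smul, coord_edir, if_pos rfl, mul_one]
    · refine Finset.prod_congr rfl fun i hi => ?_
      rw [coord_add_smul, coord_edir, if_neg (Finset.ne_of_mem_erase hi), mul_zero, add_zero]
  simp only [e]
  split_ifs with h
  · simp [h]
  · obtain ⟨k, hk⟩ := Nat.exists_eq_succ_of_ne_zero h
    have h1 : HasDerivAt (fun s : ℝ => ((coord j p + s : ℝ) : ℂ)) 1 0 := by
      simpa using ((hasDerivAt_id (0 : ℝ)).const_add (coord j p)).ofReal_comp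
    have h2 := ((h1.pow (γ j)).div_const ((γ j).factorial : ℂ)).mul_const
      (∏ i ∈ univ.erase j, ((coord i p : ℂ) ^ γ i / ((γ i).factorial : ℂ)))
    rw [show (fun s : ℝ => ((coord j p + s : ℝ) : ℂ) ^ γ j / ((γ j).factorial : ℂ) *
        ∏ i ∈ univ.erase j, ((coord i p : ℂ) ^ γ i / ((γ i).factorial : ℂ))) = _ from rfl]
    refine h2.deriv.trans ?_
    rw [mono, ← Finset.mul_prod_erase univ _ (Finset.mem_univ j)]
    congr 1
    · have hf : ((k.factorial : ℕ) : ℂ) ≠ 0 := by exact_mod_cast k.factorial_ne_zero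
      have hk1 : ((k : ℂ) + 1) ≠ 0 := by exact_mod_cast k.succ_ne_zero
      simp only [hk, Pi.sub_apply, Pi.single_eq_same, Nat.succ_eq_add_one, Nat.add_sub_cancel,
        Nat.factorial_succ, add_zero]
      push_cast
      field_simp
    · refine Finset.prod_congr rfl fun i hi => ?_
      simp [Pi.single_eq_of_ne (Finset.ne_of_mem_erase hi)]

open Classical in
lemma mpd_mono (β γ : Fin (n + 1) → ℕ) :
    mpd β (mono γ : Pt n → ℂ) = if β ≤ γ then mono (γ - β) else fun _ => 0 := by
  induction β using multiindex_induction with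
  | h0 => simp [mpd_zero]
  | hs β i ih =>
    rw [mpd_add_single (smooth_mono γ), ih]
    by_cases h : β ≤ γ
    · rw [if_pos h, pdir_mono]
      by_cases h' : (γ - β) i = 0
      · rw [if_pos h', if_neg]
        intro hle
        have := hle i
        simp at this h'
        omega
      · rw [if_neg h', if_pos]
        · congr 1; funext j; simp [Nat.sub_sub]
        · intro j
          by_cases hj : j = i
          · subst hj; simp at h' ⊢; omega
          · simpa [Pi.single_eq_of_ne hj] using h j
    · rw [if_neg h, if_neg, pdir_zero_fun]
      exact fun hle => h fun j => le_trans (by simp) (hle j)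

lemma mpd_mono_of_sum_le (β γ : Fin (n + 1) → ℕ) (h : ∑ i, γ i ≤ ∑ i, β i) :
    mpd β (mono γ : Pt n → ℂ) = fun _ => if β = γ then 1 else 0 := by
  rw [mpd_mono]
  by_cases hβ : β = γ
  · subst hβ
    rw [if_pos le_rfl, if_pos rfl, tsub_self]
    exact funext mono_zero
  · rw [if_neg, if_neg hβ]
    intro hle
    refine hβ (funext fun i => ?_)
    have hs : ∑ i, β i = ∑ i, γ i := le_antisymm (Finset.sum_le_sum fun i _ => hle i) h
    exact (Finset.sum_eq_sum_iff_of_le fun i _ => hle i).1 hs i (Finset.mem_univ i)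

/-- Subtracting a polynomial of degree less than `k` one can make the averages over a set of
finite positive measure of all derivatives of order less than `k` vanish. -/
lemma exists_polynomial_mean_zero {B : Set (Pt n)} (hB0 : volume B ≠ 0)
    (hBb : Bornology.IsBounded B) (k : ℕ) (f : Pt n → ℂ) (hf : Smooth f) :
    ∃ P : Pt n → ℂ, Smooth P ∧ (∀ γ : Fin (n + 1) → ℕ, k ≤ ∑ i, γ i → ∀ p, mpd γ P p = 0) ∧
      ∀ γ : Fin (n + 1) → ℕ, ∑ i, γ i < k → ∫ p in B, mpd γ (fun q => f q - P q) p = 0 := by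
  have hBt : volume B ≠ ⊤ := hBb.measure_lt_top.ne
  have hInt : ∀ g : Pt n → ℂ, Smooth g → IntegrableOn g B := fun g hg =>
    (hg.continuous.continuousOn.integrableOn_compact hBb.isCompact_closure).mono_set
      subset_closure
  induction k generalizing f with
  | zero => exact ⟨fun _ => 0, contDiff_const, fun γ _ p => by rw [mpd_zero_fun], by simp⟩
  | succ k ih =>
    let a : (Fin (n + 1) → ℕ) → ℂ := fun γ => (∫ p in B, mpd γ f p) / (volume.real B : ℂ)
    let Q : Pt n → ℂ := fun p => ∑ γ ∈ MI n k, a γ * mono γ p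
    have hterm : ∀ γ ∈ MI n k, Smooth (fun p => a γ * mono γ p) :=
      fun γ _ => contDiff_const.mul (smooth_mono γ)
    have hQ : Smooth Q := ContDiff.sum hterm
    have hQd : ∀ β : Fin (n + 1) → ℕ, k ≤ ∑ i, β i → ∀ p,
        mpd β Q p = if ∑ i, β i = k then a β else 0 := by
      intro β hβ p
      simp only [Q]
      rw [mpd_sum _ _ hterm]
      simp only
      have : ∀ γ ∈ MI n k, mpd β (fun p => a γ * mono γ p) p = if β = γ then a γ else 0 := by
        intro γ hγ
        rw [mpd_const_mul (smooth_mono γ), mpd_mono_of_sum_le β γ (by rw [mem_MI.1 hγ]; exact hβ)]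
        simp
      rw [Finset.sum_congr rfl this, Finset.sum_ite_eq]
      simp [mem_MI]
    obtain ⟨P, hP, hP0, hPm⟩ := ih (fun q => f q - Q q) (ContDiff.sub hf hQ)
    have hPQ : Smooth (fun q => Q q + P q) := ContDiff.add hQ hP
    refine ⟨fun q => Q q + P q, hPQ, ?_, ?_⟩
    · intro γ hγ p
      rw [mpd_add hQ hP]
      simp only
      rw [hQd γ (by omega), hP0 γ (by omega), if_neg (by omega), add_zero]
    · intro γ hγ
      rcases Nat.lt_succ_iff_lt_or_eq.1 hγ with h | h
      · have := hPm γ h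
        simpa only [sub_sub] using this
      · have e : ∀ p, mpd γ (fun q => f q - (Q q + P q)) p = mpd γ f p - a γ := by
          intro p
          rw [mpd_sub hf hPQ, mpd_add hQ hP]
          simp only
          rw [hQd γ h.ge, hP0 γ h.ge, if_pos h, add_zero]
        simp only [e]
        rw [integral_sub (hInt _ (hf.mpd γ)) (integrableOn_const hBt)]
        simp only [integral_const, measureReal_restrict_apply_univ, a]
        have hv : (volume.real B : ℂ) ≠ 0 := by
          exact_mod_cast (ENNReal.toReal_pos hB0 hBt).ne'
        rw [Complex.real_smul, mul_div_cancel₀ _ hv, sub_self]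

end Polynomials

section Poincare

/-- Cauchy–Schwarz for the lower Lebesgue integral. -/
lemma sq_lintegral_mul_le {α : Type*} [MeasurableSpace α] {μ : Measure α} {f g : α → ℝ≥0∞}
    (hf : AEMeasurable f μ) (hg : AEMeasurable g μ) :
    (∫⁻ a, f a * g a ∂μ) ^ 2 ≤ (∫⁻ a, f a ^ 2 ∂μ) * ∫⁻ a, g a ^ 2 ∂μ := by
  have h := ENNReal.lintegral_mul_le_Lp_mul_Lq μ Real.HolderConjugate.two_two hf hg
  calc (∫⁻ a, f a * g a ∂μ) ^ 2
      ≤ ((∫⁻ a, f a ^ (2 : ℝ) ∂μ) ^ (1 / (2 : ℝ)) * (∫⁻ a, g a ^ (2 : ℝ) ∂μ) ^ (1 / (2 : ℝ))) ^ 2 := by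
        gcongr; exact h
    _ = _ := by
        rw [mul_pow]
        simp only [← ENNReal.rpow_natCast, ← ENNReal.rpow_mul]
        norm_num

lemma sq_lintegral_le {α : Type*} [MeasurableSpace α] {μ : Measure α} {f : α → ℝ≥0∞}
    (hf : AEMeasurable f μ) : (∫⁻ a, f a ∂μ) ^ 2 ≤ μ univ * ∫⁻ a, f a ^ 2 ∂μ := by
  have h := sq_lintegral_mul_le (μ := μ) (f := fun _ => 1) (g := f) aemeasurable_const hf
  simpa using h

variable {n : ℕ}

instance : (volume : Measure (Pt n)).IsAddHaarMeasure :=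
  inferInstanceAs (((volume : Measure (Fin n → ℝ)).prod (volume : Measure ℝ)).IsAddHaarMeasure)

lemma lintegral_comp_affine (F : Pt n → ℝ≥0∞) (hF : Measurable F) (a : Pt n) {s : ℝ}
    (hs : s ≠ 0) :
    ∫⁻ x, F (a + s • x) = ENNReal.ofReal (|s ^ (n + 1)|⁻¹) * ∫⁻ x, F x := by
  have h1 : ∫⁻ x, F (a + s • x) = ∫⁻ y, F (a + y) ∂(Measure.map (fun x : Pt n => s • x) volume) := by
    rw [lintegral_map (by fun_prop) (by fun_prop)]
  rw [h1, Measure.map_addHaar_smul volume hs, lintegral_smul_measure, lintegral_add_left_eq_self]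
  simp [Module.finrank_prod, abs_inv]

lemma setLIntegral_comp_affine_le {B : Set (Pt n)} (hB : MeasurableSet B) (F : Pt n → ℝ≥0∞)
    (hF : Measurable F) (a : Pt n) {s : ℝ} (hs : 1 / 2 ≤ s) (hab : ∀ x ∈ B, a + s • x ∈ B) :
    ∫⁻ x in B, F (a + s • x) ≤ 2 ^ (n + 1) * ∫⁻ x in B, F x := by
  have hs0 : 0 < s := by linarith
  calc ∫⁻ x in B, F (a + s • x) = ∫⁻ x in B, B.indicator F (a + s • x) :=
        setLIntegral_congr_fun hB fun x hx => by simp [Set.indicator_of_mem (hab x hx)]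
    _ ≤ ∫⁻ x, B.indicator F (a + s • x) := setLIntegral_le_lintegral _ _
    _ = ENNReal.ofReal (|s ^ (n + 1)|⁻¹) * ∫⁻ x in B, F x := by
        rw [lintegral_comp_affine _ (hF.indicator hB) a hs0.ne', lintegral_indicator hB]
    _ ≤ _ := by
        gcongr
        rw [abs_of_pos (by positivity), ← inv_pow,
          ENNReal.ofReal_pow (by positivity)]
        gcongr
        rw [show (2 : ℝ≥0∞) = ENNReal.ofReal 2 by simp]
        apply ENNReal.ofReal_le_ofReal
        rw [inv_le_comm₀ hs0 (by norm_num)]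
        linarith

lemma lintegral_segment_le {z : Pt n} {r : ℝ} (F : Pt n → ℝ≥0∞) (hF : Measurable F) {s : ℝ}
    (hs : s ∈ Icc (0 : ℝ) 1) :
    ∫⁻ x in Metric.ball z r, ∫⁻ y in Metric.ball z r, F (y + s • (x - y)) ≤
      2 ^ (n + 1) * volume (Metric.ball z r) * ∫⁻ x in Metric.ball z r, F x := by
  have hconv := convex_ball z r
  rcases le_total (1 / 2) s with h | h
  · rw [lintegral_lintegral_swap]
    · calc _ ≤ ∫⁻ y in Metric.ball z r, 2 ^ (n + 1) * ∫⁻ x in Metric.ball z r, F x := by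
            refine setLIntegral_mono' measurableSet_ball fun y hy => ?_
            have := setLIntegral_comp_affine_le (B := Metric.ball z r) measurableSet_ball F hF
              ((1 - s) • y) h
              (fun x hx => hconv hy hx (by linarith [hs.2]) hs.1 (by ring))
            refine le_trans (le_of_eq ?_) this
            congr 1; funext x; congr 1; module
        _ = _ := by simp; ring
    · apply Measurable.aemeasurable
      apply hF.comp; fun_prop
  · calc _ ≤ ∫⁻ x in Metric.ball z r, 2 ^ (n + 1) * ∫⁻ x in Metric.ball z r, F x := by
            refine setLIntegral_mono' measurableSet_ball fun x hx => ?_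
            have := setLIntegral_comp_affine_le (B := Metric.ball z r) measurableSet_ball F hF
              (s • x) (s := 1 - s) (by linarith)
              (fun y hy => hconv hx hy hs.1 (by linarith [hs.2]) (by ring))
            refine le_trans (le_of_eq ?_) this
            congr 1; funext x; congr 1; module
        _ = _ := by simp; ring

variable {g : Pt n → ℂ}

lemma fderiv_apply_eq_sum (g : Pt n → ℂ) (p v : Pt n) :
    fderiv ℝ g p v = ∑ i, coord i v • pdir (edir n i) g p := by
  conv_lhs => rw [← sum_coord_smul_edir v]
  simp [map_sum, pdir]

lemma norm_fderiv_apply_sq_le (g : Pt n → ℂ) (p v : Pt n) :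
    ‖fderiv ℝ g p v‖ ^ 2 ≤ ‖v‖ ^ 2 * ((n + 1 : ℕ) * ∑ i, ‖pdir (edir n i) g p‖ ^ 2) := by
  have h1 : ‖fderiv ℝ g p v‖ ≤ ‖v‖ * ∑ i, ‖pdir (edir n i) g p‖ := by
    rw [fderiv_apply_eq_sum, Finset.mul_sum]
    refine (norm_sum_le _ _).trans (Finset.sum_le_sum fun i _ => ?_)
    rw [norm_smul]
    gcongr
    exact abs_coord_le i v
  calc _ ≤ (‖v‖ * ∑ i, ‖pdir (edir n i) g p‖) ^ 2 := by gcongr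
    _ = ‖v‖ ^ 2 * (∑ i, ‖pdir (edir n i) g p‖) ^ 2 := by ring
    _ ≤ _ := by
      gcongr
      simpa using sq_sum_le_card_mul_sum_sq (s := (univ : Finset (Fin (n + 1))))
        (f := fun i => ‖pdir (edir n i) g p‖)

lemma enorm_sq_eq_ofReal (z : ℂ) : ‖z‖ₑ ^ 2 = ENNReal.ofReal (‖z‖ ^ 2) := by
  rw [ENNReal.ofReal_pow (norm_nonneg _), ofReal_norm]

lemma enorm_sub_sq_le (hg : Smooth g) (x y : Pt n) :
    ‖g x - g y‖ₑ ^ 2 ≤ ∫⁻ s in Icc (0 : ℝ) 1, ENNReal.ofReal (‖x - y‖ ^ 2 *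
      ((n + 1 : ℕ) * ∑ i, ‖pdir (edir n i) g (y + s • (x - y))‖ ^ 2)) := by
  have hd : ∀ s : ℝ, HasDerivAt (fun s : ℝ => g (y + s • (x - y)))
      (fderiv ℝ g (y + s • (x - y)) (x - y)) s := by
    intro s
    have h1 : HasDerivAt (fun s : ℝ => y + s • (x - y)) (x - y) s := by
      simpa using ((hasDerivAt_id s).smul_const (x - y)).const_add y
    exact (hg.differentiable _).hasFDerivAt.comp_hasDerivAt s h1
  have hc : Continuous fun s : ℝ => fderiv ℝ g (y + s • (x - y)) (x - y) := by
    have h := (hg.pdir (x - y)).continuous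
    exact h.comp (by fun_prop : Continuous fun s : ℝ => y + s • (x - y))
  have hftc := intervalIntegral.integral_eq_sub_of_hasDerivAt (a := 0) (b := 1)
    (fun s _ => hd s) (hc.intervalIntegrable 0 1)
  have e : g x - g y = ∫ s in Icc (0 : ℝ) 1, fderiv ℝ g (y + s • (x - y)) (x - y) := by
    rw [integral_Icc_eq_integral_Ioc, ← intervalIntegral.integral_of_le zero_le_one, hftc]
    simp
  calc ‖g x - g y‖ₑ ^ 2
      ≤ (∫⁻ s in Icc (0 : ℝ) 1, ‖fderiv ℝ g (y + s • (x - y)) (x - y)‖ₑ) ^ 2 := by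
        rw [e]; gcongr; exact enorm_integral_le_lintegral_enorm _
    _ ≤ ∫⁻ s in Icc (0 : ℝ) 1, ‖fderiv ℝ g (y + s • (x - y)) (x - y)‖ₑ ^ 2 := by
        refine (sq_lintegral_le hc.enorm.measurable.aemeasurable).trans ?_
        simp
    _ ≤ _ := by
        refine lintegral_mono fun s => ?_
        rw [enorm_sq_eq_ofReal]
        exact ENNReal.ofReal_le_ofReal (norm_fderiv_apply_sq_le g _ _)

/-- The Poincaré inequality on sup-norm balls for smooth functions of mean zero. -/
lemma poincare_lintegral (hg : Smooth g) {z : Pt n} {r : ℝ} (hr : 0 < r)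
    (h0 : ∫ p in Metric.ball z r, g p = 0) :
    ∫⁻ x in Metric.ball z r, ‖g x‖ₑ ^ 2 ≤
      ∫⁻ x in Metric.ball z r, ENNReal.ofReal (2 ^ (n + 3) * (n + 1 : ℕ) * r ^ 2 *
        ∑ i, ‖pdir (edir n i) g x‖ ^ 2) := by
  set B := Metric.ball z r with hB
  have hBm : MeasurableSet B := measurableSet_ball
  have hV0 : volume B ≠ 0 := (Metric.measure_ball_pos volume z hr).ne'
  have hVt : volume B ≠ ⊤ := Metric.isBounded_ball.measure_lt_top.ne
  have hgc := hg.continuous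
  have hgi : IntegrableOn g B :=
    (hgc.continuousOn.integrableOn_compact (isCompact_closedBall z r)).mono_set
      Metric.ball_subset_closedBall
  have hpc : ∀ i, Continuous (pdir (edir n i) g) := fun i => (hg.pdir _).continuous
  let F : Pt n → ℝ≥0∞ := fun p => ENNReal.ofReal ((2 * r) ^ 2 *
      ((n + 1 : ℕ) * ∑ i, ‖pdir (edir n i) g p‖ ^ 2))
  have hF : Measurable F := by
    refine Continuous.measurable ?_
    exact ENNReal.continuous_ofReal.comp (by fun_prop)
  have hmean : ∀ x, volume B * ‖g x‖ₑ ^ 2 ≤ ∫⁻ y in B, ‖g x - g y‖ₑ ^ 2 := by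
    intro x
    have e : (volume.real B : ℂ) * g x = ∫ y in B, (g x - g y) := by
      have hc : IntegrableOn (fun _ : Pt n => g x) B := integrableOn_const hVt
      rw [integral_sub hc hgi, h0]
      simp
    have h1 : volume B * ‖g x‖ₑ ≤ ∫⁻ y in B, ‖g x - g y‖ₑ := by
      refine le_trans (le_of_eq ?_) (enorm_integral_le_lintegral_enorm _)
      rw [← e, enorm_mul]
      congr 1
      rw [← ofReal_norm, Complex.norm_real, Real.norm_of_nonneg measureReal_nonneg,
        Measure.real, ENNReal.ofReal_toReal hVt]
    have h2 : (volume B * ‖g x‖ₑ) ^ 2 ≤ volume B * ∫⁻ y in B, ‖g x - g y‖ₑ ^ 2 := by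
      refine (pow_le_pow_left' h1 2).trans ?_
      refine (sq_lintegral_le (by fun_prop)).trans ?_
      simp
    rw [mul_pow, sq, mul_assoc] at h2
    exact (ENNReal.mul_le_mul_iff_right hV0 hVt).1 h2
  have hpt : ∀ x ∈ B, ∀ y ∈ B, ‖g x - g y‖ₑ ^ 2 ≤
      ∫⁻ s in Icc (0 : ℝ) 1, F (y + s • (x - y)) := by
    intro x hx y hy
    refine (enorm_sub_sq_le hg x y).trans (lintegral_mono fun s => ?_)
    apply ENNReal.ofReal_le_ofReal
    have : ‖x - y‖ ≤ 2 * r := by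
      rw [← dist_eq_norm]
      have h1 := Metric.mem_ball.1 hx
      have h2 := Metric.mem_ball'.1 hy
      linarith [dist_triangle x z y]
    gcongr
  have main : volume B * ∫⁻ x in B, ‖g x‖ₑ ^ 2 ≤
      volume B * (2 ^ (n + 1) * ∫⁻ x in B, F x) := by
    rw [← lintegral_const_mul _ (by fun_prop)]
    calc ∫⁻ x in B, volume B * ‖g x‖ₑ ^ 2
        ≤ ∫⁻ x in B, ∫⁻ y in B, ∫⁻ s in Icc (0 : ℝ) 1, F (y + s • (x - y)) := by
          refine setLIntegral_mono' hBm fun x hx => (hmean x).trans ?_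
          exact setLIntegral_mono' hBm fun y hy => hpt x hx y hy
      _ = ∫⁻ x in B, ∫⁻ s in Icc (0 : ℝ) 1, ∫⁻ y in B, F (y + s • (x - y)) := by
          refine lintegral_congr fun x => ?_
          rw [lintegral_lintegral_swap]
          exact (hF.comp (by fun_prop)).aemeasurable
      _ = ∫⁻ s in Icc (0 : ℝ) 1, ∫⁻ x in B, ∫⁻ y in B, F (y + s • (x - y)) := by
          rw [lintegral_lintegral_swap]
          apply Measurable.aemeasurable
          have : Measurable fun q : (Pt n × ℝ) × Pt n => F (q.2 + q.1.2 • (q.1.1 - q.2)) :=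
            hF.comp (by fun_prop)
          exact this.lintegral_prod_right'
      _ ≤ ∫⁻ s in Icc (0 : ℝ) 1, 2 ^ (n + 1) * volume B * ∫⁻ x in B, F x :=
          setLIntegral_mono' measurableSet_Icc fun s hs => lintegral_segment_le F hF hs
      _ = _ := by simp; ring
  have h3 := (ENNReal.mul_le_mul_iff_right hV0 hVt).1 main
  refine h3.trans (le_of_eq ?_)
  rw [← lintegral_const_mul _ hF]
  refine lintegral_congr fun x => ?_
  simp only [F]
  rw [show (2 : ℝ≥0∞) ^ (n + 1) = ENNReal.ofReal (2 ^ (n + 1)) by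
    rw [ENNReal.ofReal_pow (by norm_num)]; simp, ← ENNReal.ofReal_mul (by positivity)]
  congr 1
  ring

lemma Smooth.integrableOn_norm_sq_ball (hg : Smooth g) (z : Pt n) (r : ℝ) :
    IntegrableOn (fun p => ‖g p‖ ^ 2) (Metric.ball z r) :=
  ((hg.continuous.norm.pow 2).continuousOn.integrableOn_compact
    (isCompact_closedBall z r)).mono_set Metric.ball_subset_closedBall

lemma poincare (hg : Smooth g) {z : Pt n} {r : ℝ} (hr : 0 < r)
    (h0 : ∫ p in Metric.ball z r, g p = 0) :
    ∫ x in Metric.ball z r, ‖g x‖ ^ 2 ≤ 2 ^ (n + 3) * (n + 1 : ℕ) * r ^ 2 *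
      ∑ i, ∫ x in Metric.ball z r, ‖pdir (edir n i) g x‖ ^ 2 := by
  have h := poincare_lintegral hg hr h0
  have hi : ∀ i, IntegrableOn (fun x => ‖pdir (edir n i) g x‖ ^ 2) (Metric.ball z r) :=
    fun i => (hg.pdir _).integrableOn_norm_sq_ball z r
  have hs : IntegrableOn (fun x => ∑ i, ‖pdir (edir n i) g x‖ ^ 2) (Metric.ball z r) :=
    integrable_finsetSum _ fun i _ => hi i
  simp only [enorm_sq_eq_ofReal] at h
  rw [← ofReal_integral_eq_lintegral_ofReal (hg.integrableOn_norm_sq_ball z r)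
      (Filter.Eventually.of_forall fun x => by positivity),
    ← ofReal_integral_eq_lintegral_ofReal (hs.const_mul _)
      (Filter.Eventually.of_forall fun x => by positivity)] at h
  rw [ENNReal.ofReal_le_ofReal_iff (integral_nonneg fun x => by positivity)] at h
  rwa [integral_const_mul, integral_finsetSum _ fun i _ => hi i] at h

end Poincare

section LowerOrder

variable {n : ℕ} {f g : Pt n → ℂ}

/-- The squared `L²(B)` norm of the array of derivatives of order `k`. -/
def gradInt (k : ℕ) (f : Pt n → ℂ) (B : Set (Pt n)) : ℝ :=
  ∑ γ ∈ MI n k, ∫ p in B, ‖mpd γ f p‖ ^ 2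

lemma gradInt_nonneg (k : ℕ) (f : Pt n → ℂ) (B : Set (Pt n)) : 0 ≤ gradInt k f B :=
  Finset.sum_nonneg fun _ _ => integral_nonneg fun _ => by positivity

lemma gradInt_le_succ (hg : Smooth g) {z : Pt n} {r : ℝ} (hr : 0 < r) (j : ℕ)
    (h0 : ∀ γ ∈ MI n j, ∫ p in Metric.ball z r, mpd γ g p = 0) :
    gradInt j g (Metric.ball z r) ≤
      2 ^ (n + 3) * (n + 1 : ℕ) ^ 2 * r ^ 2 * gradInt (j + 1) g (Metric.ball z r) := by
  have h1 : ∀ γ ∈ MI n j, ∫ x in Metric.ball z r, ‖mpd γ g x‖ ^ 2 ≤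
      2 ^ (n + 3) * (n + 1 : ℕ) * r ^ 2 *
        ∑ i, ∫ x in Metric.ball z r, ‖mpd (γ + Pi.single i 1) g x‖ ^ 2 := by
    intro γ hγ
    simp only [mpd_add_single hg]
    exact poincare (hg.mpd γ) hr (h0 γ hγ)
  have h2 : ∀ i : Fin (n + 1),
      ∑ γ ∈ MI n j, ∫ x in Metric.ball z r, ‖mpd (γ + Pi.single i 1) g x‖ ^ 2 ≤
        gradInt (j + 1) g (Metric.ball z r) := by
    intro i
    have hinj : Function.Injective fun γ : Fin (n + 1) → ℕ => γ + Pi.single i 1 :=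
      add_left_injective _
    refine le_trans (le_of_eq (Finset.sum_map (MI n j) ⟨_, hinj⟩
      (fun γ => ∫ x in Metric.ball z r, ‖mpd γ g x‖ ^ 2)).symm) ?_
    refine Finset.sum_le_sum_of_subset_of_nonneg ?_
      fun _ _ _ => integral_nonneg fun _ => by positivity
    intro β hβ
    obtain ⟨γ, hγ, rfl⟩ := Finset.mem_map.1 hβ
    exact mem_MI.2 ((sum_add_single γ i).trans (by rw [mem_MI.1 hγ]))
  calc gradInt j g (Metric.ball z r) ≤ ∑ γ ∈ MI n j, 2 ^ (n + 3) * (n + 1 : ℕ) * r ^ 2 *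
        ∑ i, ∫ x in Metric.ball z r, ‖mpd (γ + Pi.single i 1) g x‖ ^ 2 := Finset.sum_le_sum h1
    _ = 2 ^ (n + 3) * (n + 1 : ℕ) * r ^ 2 *
        ∑ i, ∑ γ ∈ MI n j, ∫ x in Metric.ball z r, ‖mpd (γ + Pi.single i 1) g x‖ ^ 2 := by
      rw [← Finset.mul_sum, Finset.sum_comm]
    _ ≤ 2 ^ (n + 3) * (n + 1 : ℕ) * r ^ 2 *
        ∑ _i : Fin (n + 1), gradInt (j + 1) g (Metric.ball z r) := by
      gcongr with i _; exact h2 i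
    _ = _ := by simp; ring

lemma gradInt_le_top_order (hg : Smooth g) {z : Pt n} {r : ℝ} (hr : 0 < r) (N : ℕ)
    (h0 : ∀ γ : Fin (n + 1) → ℕ, ∑ i, γ i < N → ∫ p in Metric.ball z r, mpd γ g p = 0)
    (k j : ℕ) (hkj : j + k = N) :
    gradInt j g (Metric.ball z r) ≤
      (2 ^ (n + 3) * (n + 1 : ℕ) ^ 2 * r ^ 2) ^ k * gradInt N g (Metric.ball z r) := by
  induction k generalizing j with
  | zero => simp [← hkj]
  | succ k ih =>
    have h1 := gradInt_le_succ hg hr j fun γ hγ => h0 γ (by rw [mem_MI.1 hγ]; omega)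
    refine h1.trans ?_
    calc _ ≤ (2 ^ (n + 3) * (n + 1 : ℕ) ^ 2 * r ^ 2) *
          ((2 ^ (n + 3) * (n + 1 : ℕ) ^ 2 * r ^ 2) ^ k * gradInt N g (Metric.ball z r)) := by
          gcongr; exact ih (j + 1) (by omega)
      _ = _ := by ring

end LowerOrder

section Cutoff

variable {n : ℕ}

lemma exists_mpd_pow_eq (ζ : Pt n → ℂ) (hζ : Smooth ζ) (hc : HasCompactSupport ζ)
    (μ : Fin (n + 1) → ℕ) (k : ℕ) :
    ∃ V : Pt n → ℂ, Smooth V ∧ HasCompactSupport V ∧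
      ∀ p, mpd μ (fun q => ζ q ^ (k + 1 + ∑ i, μ i)) p = ζ p ^ k * V p := by
  induction μ using multiindex_induction generalizing k with
  | h0 => exact ⟨ζ, hζ, hc, fun p => by simp [mpd_zero, pow_succ]⟩
  | hs μ i ih =>
    obtain ⟨V, hV, hVc, h⟩ := ih (k + 1)
    refine ⟨fun p => ((k + 1 : ℕ) : ℂ) * (pdir (edir n i) ζ p * V p) + ζ p * pdir (edir n i) V p,
      ?_, ?_, fun p => ?_⟩
    · exact (contDiff_const.mul (ContDiff.mul (hζ.pdir _) hV)).add (ContDiff.mul hζ (hV.pdir _))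
    · refine HasCompactSupport.add ?_ hc.mul_right
      exact (hVc.mul_left (f := pdir (edir n i) ζ)).mul_left (f := fun _ => ((k + 1 : ℕ) : ℂ))
    · rw [sum_add_single, show k + 1 + (∑ j, μ j + 1) = k + 1 + 1 + ∑ j, μ j by ring,
        mpd_add_single (ContDiff.pow hζ _), show mpd μ (fun q => ζ q ^ (k + 1 + 1 + ∑ i, μ i)) =
          fun p => ζ p ^ (k + 1) * V p from funext h, pdir_mul (ContDiff.pow hζ _) hV]
      have e : pdir (edir n i) (fun p => ζ p ^ (k + 1)) p =
          ((k + 1 : ℕ) : ℂ) * ζ p ^ k * pdir (edir n i) ζ p := by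
        simp only [pdir]
        rw [fderiv_fun_pow _ (hζ.differentiable p)]
        simp
      simp only [e]
      ring

/-- Cutoff functions adapted to concentric balls, such that the derivatives of the square are
controlled by the function itself. -/
lemma exists_cutoff (n m : ℕ) :
    ∃ K : ℝ, 0 ≤ K ∧ ∀ (z : Pt n) (r : ℝ), 0 < r → ∃ η : Pt n → ℂ,
      Smooth η ∧ HasCompactSupport η ∧ tsupport η ⊆ Metric.ball z r ∧
      (∀ p, (starRingEnd ℂ) (η p) = η p) ∧ (∀ p, ‖η p‖ ≤ 1) ∧
      (∀ p ∈ Metric.ball z (r / 2), η p = 1) ∧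
      (∀ μ : Fin (n + 1) → ℕ, ∑ i, μ i ≤ m → ∀ p, ‖mpd μ η p‖ ≤ K * r⁻¹ ^ (∑ i, μ i)) ∧
      (∀ μ : Fin (n + 1) → ℕ, ∑ i, μ i ≤ m → ∀ p,
        ‖mpd μ (fun q => η q * η q) p‖ ≤ K * r⁻¹ ^ (∑ i, μ i) * ‖η p‖) := by
  let b : ContDiffBump (0 : Pt n) := ⟨1 / 2, 3 / 4, by norm_num, by norm_num⟩
  let ζ : Pt n → ℂ := fun p => (b p : ℂ)
  have hζ : Smooth ζ := Complex.ofRealCLM.contDiff.comp b.contDiff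
  have hζc : HasCompactSupport ζ := b.hasCompactSupport.comp_left (g := fun x : ℝ => (x : ℂ)) rfl
  have hζ1 : ∀ p, ‖ζ p‖ ≤ 1 := fun p => by
    simp only [ζ, Complex.norm_real, Real.norm_of_nonneg b.nonneg]; exact b.le_one
  let η₀ : Pt n → ℂ := fun p => ζ p ^ (m + 1)
  have hη₀ : Smooth η₀ := ContDiff.pow hζ _
  have hη₀2 : Smooth fun p => η₀ p * η₀ p := ContDiff.mul hη₀ hη₀
  have hη₀c : HasCompactSupport η₀ :=
    hζc.comp_left (g := fun x : ℂ => x ^ (m + 1)) (by simp)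
  have hη₀ball : tsupport η₀ ⊆ Metric.closedBall 0 (3 / 4) := by
    rw [tsupport, Metric.isClosed_closedBall.closure_subset_iff]
    intro p hp
    have : p ∈ Function.support b := by
      intro h0
      exact hp (by simp [η₀, ζ, h0])
    rw [b.support_eq] at this
    exact Metric.ball_subset_closedBall this
  have hbound : ∀ μ : Fin (n + 1) → ℕ, ∃ K : ℝ, 0 ≤ K ∧ (∀ p, ‖mpd μ η₀ p‖ ≤ K) ∧
      (∑ i, μ i ≤ m → ∀ p, ‖mpd μ (fun q => η₀ q * η₀ q) p‖ ≤ K * ‖η₀ p‖) := by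
    intro μ
    obtain ⟨K₁, hK₁⟩ := (hη₀.mpd μ).continuous.bounded_above_of_compact_support (hη₀c.mpd hη₀ μ)
    by_cases hμ : ∑ i, μ i ≤ m
    · obtain ⟨V, hV, hVc, h⟩ := exists_mpd_pow_eq ζ hζ hζc μ (2 * m + 1 - ∑ i, μ i)
      obtain ⟨K₂, hK₂⟩ := hV.continuous.bounded_above_of_compact_support hVc
      have h20 : 0 ≤ K₂ := (norm_nonneg _).trans (hK₂ 0)
      refine ⟨max K₁ K₂, le_max_of_le_right h20, fun p => (hK₁ p).trans (le_max_left _ _),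
        fun _ p => ?_⟩
      have e : (fun q => η₀ q * η₀ q) = fun q => ζ q ^ (2 * m + 1 - ∑ i, μ i + 1 + ∑ i, μ i) := by
        funext q
        simp only [η₀]
        rw [← pow_add]; congr 1; omega
      rw [e, h, show 2 * m + 1 - ∑ i, μ i = (m - ∑ i, μ i) + (m + 1) by omega, pow_add,
        norm_mul, norm_mul, norm_pow]
      calc ‖ζ p‖ ^ (m - ∑ i, μ i) * ‖ζ p ^ (m + 1)‖ * ‖V p‖
          ≤ 1 * ‖ζ p ^ (m + 1)‖ * K₂ := by
            gcongr
            · exact pow_le_one₀ (norm_nonneg _) (hζ1 p)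
            · exact hK₂ p
        _ = K₂ * ‖η₀ p‖ := by simp only [η₀]; ring
        _ ≤ _ := by gcongr; exact le_max_right _ _
    · exact ⟨K₁, (norm_nonneg _).trans (hK₁ 0), hK₁, fun h => absurd h hμ⟩
  choose K hK0 hK1 hK2 using hbound
  let S : Finset (Fin (n + 1) → ℕ) := (Finset.range (m + 1)).biUnion fun k => MI n k
  have hS : ∀ μ : Fin (n + 1) → ℕ, ∑ i, μ i ≤ m → K μ ≤ ∑ μ ∈ S, K μ := by
    intro μ hμ
    refine Finset.single_le_sum (f := K) (fun μ _ => hK0 μ) ?_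
    simp only [S, Finset.mem_biUnion, Finset.mem_range]
    exact ⟨_, Nat.lt_succ_of_le hμ, mem_MI.2 rfl⟩
  refine ⟨∑ μ ∈ S, K μ, Finset.sum_nonneg fun μ _ => hK0 μ, fun z r hr => ?_⟩
  have hr0 := hr.ne'
  let T : Pt n → Pt n := fun q => -(r⁻¹ • z) + r⁻¹ • q
  have hT : ∀ q, T q = r⁻¹ • (q - z) := fun q => by simp only [T]; module
  have hTn : ∀ q, ‖T q‖ = r⁻¹ * dist q z := fun q => by
    rw [hT, norm_smul, Real.norm_of_nonneg (by positivity), dist_eq_norm]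
  have hTc : Continuous T := by fun_prop
  have hTd : ContDiff ℝ (⊤ : ℕ∞) T := by fun_prop
  have hsupp : tsupport (η₀ ∘ T) ⊆ Metric.closedBall z (3 / 4 * r) := by
    refine (tsupport_comp_subset_preimage η₀ hTc).trans fun q hq => ?_
    have := hη₀ball hq
    rw [mem_closedBall_zero_iff, hTn, inv_mul_le_iff₀ hr] at this
    rw [Metric.mem_closedBall]; linarith
  refine ⟨η₀ ∘ T, ContDiff.comp hη₀ hTd, ?_, ?_, ?_, ?_, ?_, ?_, ?_⟩
  · exact HasCompactSupport.of_support_subset_isCompact (isCompact_closedBall z (3 / 4 * r))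
      ((subset_tsupport _).trans hsupp)
  · exact hsupp.trans (Metric.closedBall_subset_ball (by linarith))
  · intro p; simp [η₀, ζ]
  · intro p
    simp only [η₀, Function.comp, norm_pow]
    exact pow_le_one₀ (norm_nonneg _) (hζ1 _)
  · intro p hp
    have : T p ∈ Metric.closedBall (0 : Pt n) b.rIn := by
      rw [mem_closedBall_zero_iff, hTn, inv_mul_le_iff₀ hr]
      have := Metric.mem_ball.1 hp
      simp only [b]; linarith
    simp [η₀, ζ, b.one_of_mem_closedBall this]
  · intro μ hμ p
    have e := congrFun (mpd_comp_affine hη₀ (-(r⁻¹ • z)) r⁻¹ μ) p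
    simp only [Function.comp_def, T]
    rw [e, norm_mul, norm_pow, Complex.norm_real, Real.norm_of_nonneg (by positivity), mul_comm]
    gcongr
    exact (hK1 μ _).trans (hS μ hμ)
  · intro μ hμ p
    have e := congrFun (mpd_comp_affine hη₀2 (-(r⁻¹ • z)) r⁻¹ μ) p
    simp only [Function.comp_def, T]
    rw [e, norm_mul, norm_pow, Complex.norm_real, Real.norm_of_nonneg (by positivity)]
    calc _ ≤ r⁻¹ ^ (∑ i, μ i) * (K μ * ‖η₀ (-(r⁻¹ • z) + r⁻¹ • p)‖) := by
          gcongr; exact hK2 μ hμ _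
      _ ≤ r⁻¹ ^ (∑ i, μ i) * ((∑ μ ∈ S, K μ) * ‖η₀ (-(r⁻¹ • z) + r⁻¹ • p)‖) := by
          gcongr; exact hS μ hμ
      _ = _ := by ring

end Cutoff

section Caccioppoli

variable {n : ℕ}

lemma mul_mul_le_add_sq {κ : ℝ} (hκ : 0 < κ) (c x y : ℝ) :
    c * x * y ≤ κ * x ^ 2 + c ^ 2 / κ * y ^ 2 := by
  have h : κ * x ^ 2 + c ^ 2 / κ * y ^ 2 - c * x * y =
      ((κ * x - c * y / 2) ^ 2 + 3 * (c * y) ^ 2 / 4) / κ := by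
    field_simp; ring
  have : 0 ≤ ((κ * x - c * y / 2) ^ 2 + 3 * (c * y) ^ 2 / 4) / κ := by positivity
  linarith

/-- The algebraic part of the Caccioppoli inequality, for a single pair of indices. -/
lemma re_sub_le_of_approx {κ Λ : ℝ} (hκ : 0 < κ) (hΛ : 0 ≤ Λ) {L : ℝ} (hL : 0 ≤ L)
    {η : ℂ} (hη : (starRingEnd ℂ) η = η) (hη1 : ‖η‖ ≤ 1) {a H₁ H₂ G₁ G₂ T v : ℂ} (ha : ‖a‖ ≤ Λ)
    (h₁ : ‖H₁ - η * G₁‖ ≤ L) (h₂ : ‖H₂ - η * G₂‖ ≤ L) (hT : ‖T - η * η * G₁‖ ≤ L * ‖η‖) :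
    ((starRingEnd ℂ) H₁ * a * H₂ - (starRingEnd ℂ) T * a * v).re ≤
      κ * ‖H₁‖ ^ 2 + κ * ‖H₂‖ ^ 2 +
        (6 * Λ + 10 * Λ ^ 2 / κ) * (L ^ 2 + ‖G₂ - v‖ ^ 2) := by
  set R₁ := H₁ - η * G₁ with hR₁
  set R₂ := H₂ - η * G₂ with hR₂
  set S := T - η * η * G₁ with hS
  have e : (starRingEnd ℂ) H₁ * a * H₂ - (starRingEnd ℂ) T * a * v =
      a * ((starRingEnd ℂ) (η * G₁) * R₂ + (starRingEnd ℂ) R₁ * (η * G₂)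
        + (starRingEnd ℂ) R₁ * R₂ - (starRingEnd ℂ) S * G₂ + (starRingEnd ℂ) T * (G₂ - v)) := by
    simp only [hR₁, hR₂, hS, map_sub, map_mul, hη]
    ring
  have hg₁ : ‖η * G₁‖ ≤ ‖H₁‖ + L := by
    have : η * G₁ = H₁ - R₁ := by rw [hR₁]; ring
    rw [this]; exact (norm_sub_le _ _).trans (by gcongr)
  have hg₂ : ‖η * G₂‖ ≤ ‖H₂‖ + L := by
    have : η * G₂ = H₂ - R₂ := by rw [hR₂]; ring
    rw [this]; exact (norm_sub_le _ _).trans (by gcongr)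
  have hTn : ‖T‖ ≤ ‖H₁‖ + 2 * L := by
    have : T = η * (η * G₁) + S := by rw [hS]; ring
    calc ‖T‖ ≤ ‖η‖ * ‖η * G₁‖ + ‖S‖ := by
          rw [this, ← norm_mul]; exact norm_add_le _ _
      _ ≤ 1 * (‖H₁‖ + L) + L * 1 := by gcongr; exact hT.trans (by gcongr)
      _ = _ := by ring
  have hSG : ‖S‖ * ‖G₂‖ ≤ L * (‖H₂‖ + L) := by
    calc ‖S‖ * ‖G₂‖ ≤ L * ‖η‖ * ‖G₂‖ := by gcongr
      _ = L * ‖η * G₂‖ := by rw [norm_mul]; ring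
      _ ≤ _ := by gcongr
  have hX : ‖(starRingEnd ℂ) (η * G₁) * R₂ + (starRingEnd ℂ) R₁ * (η * G₂)
        + (starRingEnd ℂ) R₁ * R₂ - (starRingEnd ℂ) S * G₂ + (starRingEnd ℂ) T * (G₂ - v)‖ ≤
      (‖H₁‖ + L) * L + L * (‖H₂‖ + L) + L * L + L * (‖H₂‖ + L) +
        (‖H₁‖ + 2 * L) * ‖G₂ - v‖ := by
    refine (norm_add_le _ _).trans (add_le_add ((norm_sub_le _ _).trans (add_le_add
      ((norm_add_le _ _).trans (add_le_add ((norm_add_le _ _).trans (add_le_add ?_ ?_)) ?_)) ?_)) ?_)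
    all_goals rw [norm_mul, RCLike.norm_conj]
    · gcongr
    · gcongr
    · gcongr
    · exact hSG
    · gcongr
  set D := ‖G₂ - v‖
  have hD : 0 ≤ D := norm_nonneg _
  calc _ ≤ ‖(starRingEnd ℂ) H₁ * a * H₂ - (starRingEnd ℂ) T * a * v‖ := Complex.re_le_norm _
    _ ≤ Λ * ((‖H₁‖ + L) * L + L * (‖H₂‖ + L) + L * L + L * (‖H₂‖ + L) +
        (‖H₁‖ + 2 * L) * D) := by rw [e, norm_mul]; gcongr
    _ = Λ * ‖H₁‖ * L + (2 * Λ) * ‖H₂‖ * L + Λ * ‖H₁‖ * D + Λ * (4 * L ^ 2 + 2 * L * D) := by ring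
    _ ≤ (κ / 2 * ‖H₁‖ ^ 2 + Λ ^ 2 / (κ / 2) * L ^ 2) + (κ * ‖H₂‖ ^ 2 + (2 * Λ) ^ 2 / κ * L ^ 2) +
        (κ / 2 * ‖H₁‖ ^ 2 + Λ ^ 2 / (κ / 2) * D ^ 2) + Λ * (4 * L ^ 2 + (L ^ 2 + D ^ 2)) := by
      gcongr ?_ + ?_ + ?_ + _ * (_ + ?_)
      · exact mul_mul_le_add_sq (by positivity) _ _ _
      · exact mul_mul_le_add_sq hκ _ _ _
      · exact mul_mul_le_add_sq (by positivity) _ _ _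
      · nlinarith [sq_nonneg (L - D)]
    _ = κ * ‖H₁‖ ^ 2 + κ * ‖H₂‖ ^ 2 + (5 * Λ + 6 * (Λ ^ 2 / κ)) * L ^ 2
        + (Λ + 2 * (Λ ^ 2 / κ)) * D ^ 2 := by field_simp; ring
    _ ≤ _ := by
      have : 0 ≤ Λ ^ 2 / κ := by positivity
      have e : 10 * Λ ^ 2 / κ = 10 * (Λ ^ 2 / κ) := by ring
      rw [e, mul_add, ← add_assoc]
      gcongr <;> linarith

/-- The sum of the lower order derivatives, scaled to have the homogeneity of order `m`. -/
def lowerSum (m : ℕ) (r : ℝ) (g : Pt n → ℂ) (p : Pt n) : ℝ :=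
  ∑ j ∈ Finset.range m, ∑ ν ∈ MI n j, r⁻¹ ^ (m - j) * ‖mpd ν g p‖

lemma lowerSum_nonneg (m : ℕ) {r : ℝ} (hr : 0 < r) (g : Pt n → ℂ) (p : Pt n) :
    0 ≤ lowerSum m r g p :=
  Finset.sum_nonneg fun _ _ => Finset.sum_nonneg fun _ _ => by positivity

lemma continuous_lowerSum (m : ℕ) (r : ℝ) {g : Pt n → ℂ} (hg : Smooth g) :
    Continuous (lowerSum m r g) :=
  continuous_finsetSum _ fun _ _ => continuous_finsetSum _ fun ν _ =>
    continuous_const.mul (hg.mpd ν).continuous.norm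

lemma le_lowerSum (m : ℕ) {r : ℝ} (hr : 0 < r) (g : Pt n → ℂ) (p : Pt n)
    {ν : Fin (n + 1) → ℕ} (hν : ∑ i, ν i < m) :
    r⁻¹ ^ (m - ∑ i, ν i) * ‖mpd ν g p‖ ≤ lowerSum m r g p := by
  refine le_trans ?_ (Finset.single_le_sum (f := fun j => ∑ ν ∈ MI n j, r⁻¹ ^ (m - j) * ‖mpd ν g p‖)
    (fun j _ => Finset.sum_nonneg fun _ _ => by positivity) (Finset.mem_range.2 hν))
  exact Finset.single_le_sum (f := fun μ => r⁻¹ ^ (m - ∑ i, ν i) * ‖mpd μ g p‖)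
    (fun _ _ => by positivity) (mem_MI.2 rfl)

/-- The commutator of a derivative of order `m` with multiplication by a cutoff. -/
lemma exists_norm_mpd_mul_sub_le (n m : ℕ) :
    ∃ N : ℝ, 0 ≤ N ∧ ∀ γ ∈ MI n m, ∀ (θ g : Pt n → ℂ), Smooth θ → Smooth g →
      ∀ (p : Pt n) (K r : ℝ), 0 ≤ K → 0 < r →
      (∀ μ : Fin (n + 1) → ℕ, ∑ i, μ i ≤ m → ‖mpd μ θ p‖ ≤ K * r⁻¹ ^ (∑ i, μ i)) →
      ‖mpd γ (fun q => θ q * g q) p - θ p * mpd γ g p‖ ≤ N * K * lowerSum m r g p := by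
  choose l hl h using fun γ : Fin (n + 1) → ℕ => exists_leibniz (n := n) γ
  refine ⟨∑ γ ∈ MI n m, ((l γ).length : ℝ), by positivity, ?_⟩
  intro γ hγ θ g hθ hg p K r hK hr hb
  have hlow := lowerSum_nonneg m hr g p
  rw [h γ θ g hθ hg p, add_sub_cancel_left]
  have key : ∀ l' : List ((Fin (n + 1) → ℕ) × (Fin (n + 1) → ℕ)),
      (∀ a ∈ l', a.1 + a.2 = γ ∧ a.1 ≠ 0) →
      ‖(l'.map fun a => mpd a.1 θ p * mpd a.2 g p).sum‖ ≤
        l'.length * (K * lowerSum m r g p) := by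
    intro l' hl'
    induction l' with
    | nil => simp
    | cons a t ih =>
      obtain ⟨h1, h2⟩ := hl' a (by simp)
      have hsum : ∑ i, a.1 i + ∑ i, a.2 i = m := by
        rw [← mem_MI.1 hγ, ← h1, ← Finset.sum_add_distrib]; rfl
      have hpos : 0 < ∑ i, a.1 i := by
        rw [Nat.pos_iff_ne_zero]
        intro h0
        exact h2 (funext fun i => Finset.sum_eq_zero_iff.1 h0 i (Finset.mem_univ _))
      have e := le_lowerSum m hr g p (ν := a.2) (by omega)
      rw [List.map_cons, List.sum_cons, List.length_cons, Nat.cast_succ, add_mul, one_mul, add_comm]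
      refine (norm_add_le _ _).trans (add_le_add (ih fun b hb => hl' b (by simp [hb])) ?_)
      rw [norm_mul]
      calc ‖mpd a.1 θ p‖ * ‖mpd a.2 g p‖
          ≤ K * r⁻¹ ^ (∑ i, a.1 i) * ‖mpd a.2 g p‖ := by gcongr; exact hb a.1 (by omega)
        _ = K * (r⁻¹ ^ (m - ∑ i, a.2 i) * ‖mpd a.2 g p‖) := by
          rw [show m - ∑ i, a.2 i = ∑ i, a.1 i by omega]; ring
        _ ≤ _ := by gcongr
  refine (key _ (hl γ)).trans ?_
  rw [← mul_assoc]
  gcongr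
  exact Finset.single_le_sum (f := fun γ => ((l γ).length : ℝ)) (fun _ _ => by positivity) hγ

lemma exists_integral_lowerSum_sq_le (n m : ℕ) (hm : 1 ≤ m) :
    ∃ N : ℝ, 0 ≤ N ∧ ∀ (g : Pt n → ℂ), Smooth g → ∀ (z : Pt n) (r : ℝ), 0 < r →
      (∀ γ : Fin (n + 1) → ℕ, ∑ i, γ i < m - 1 → ∫ p in Metric.ball z r, mpd γ g p = 0) →
      ∫ p in Metric.ball z r, lowerSum m r g p ^ 2 ≤
        N * (r⁻¹ ^ 2 * gradInt (m - 1) g (Metric.ball z r)) := by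
  refine ⟨∑ j ∈ Finset.range m, (m * (MI n j).card * (2 ^ (n + 3) * (n + 1 : ℕ) ^ 2) ^ (m - 1 - j) : ℝ),
    by positivity, ?_⟩
  intro g hg z r hr h0
  have hi : ∀ ν, IntegrableOn (fun p => ‖mpd ν g p‖ ^ 2) (Metric.ball z r) :=
    fun ν => (hg.mpd ν).integrableOn_norm_sq_ball z r
  have hpt : ∀ p, lowerSum m r g p ^ 2 ≤ ∑ j ∈ Finset.range m, ∑ ν ∈ MI n j,
      (m * (MI n j).card * (r⁻¹ ^ (m - j)) ^ 2) * ‖mpd ν g p‖ ^ 2 := by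
    intro p
    refine (sq_sum_le_card_mul_sum_sq).trans ?_
    rw [Finset.mul_sum]
    refine Finset.sum_le_sum fun j _ => ?_
    rw [← Finset.mul_sum, mul_pow, Finset.card_range, ← Finset.mul_sum]
    have := sq_sum_le_card_mul_sum_sq (s := MI n j) (f := fun ν => ‖mpd ν g p‖)
    calc _ ≤ (m : ℝ) * ((r⁻¹ ^ (m - j)) ^ 2 * ((MI n j).card * ∑ ν ∈ MI n j, ‖mpd ν g p‖ ^ 2)) := by
          gcongr
      _ = _ := by ring
  calc ∫ p in Metric.ball z r, lowerSum m r g p ^ 2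
      ≤ ∫ p in Metric.ball z r, ∑ j ∈ Finset.range m, ∑ ν ∈ MI n j,
        (m * (MI n j).card * (r⁻¹ ^ (m - j)) ^ 2) * ‖mpd ν g p‖ ^ 2 := by
        refine integral_mono ?_ ?_ hpt
        · exact (((continuous_lowerSum m r hg).pow 2).continuousOn.integrableOn_compact
            (isCompact_closedBall z r)).mono_set Metric.ball_subset_closedBall
        · exact integrable_finsetSum _ fun j _ => integrable_finsetSum _ fun ν _ =>
            (hi ν).const_mul _
    _ = ∑ j ∈ Finset.range m, (m * (MI n j).card * (r⁻¹ ^ (m - j)) ^ 2) *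
          gradInt j g (Metric.ball z r) := by
        rw [integral_finsetSum _ fun j _ => integrable_finsetSum _ fun ν _ => (hi ν).const_mul _]
        refine Finset.sum_congr rfl fun j _ => ?_
        rw [integral_finsetSum _ fun ν _ => (hi ν).const_mul _, gradInt, Finset.mul_sum]
        exact Finset.sum_congr rfl fun ν _ => integral_const_mul _ _
    _ ≤ _ := by
        rw [Finset.sum_mul]
        refine Finset.sum_le_sum fun j hj => ?_
        have hj' := Finset.mem_range.1 hj
        have h1 := gradInt_le_top_order hg hr (m - 1) h0 (m - 1 - j) j (by omega)
        have e : (r⁻¹ ^ (m - j)) ^ 2 * (r ^ 2) ^ (m - 1 - j) = r⁻¹ ^ 2 := by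
          rw [show m - j = (m - 1 - j) + 1 by omega, pow_succ r⁻¹, mul_pow, ← pow_mul, ← pow_mul,
            mul_comm (m - 1 - j) 2, mul_right_comm, ← mul_pow, inv_mul_cancel₀ hr.ne', one_pow,
            one_mul]
        calc _ ≤ (m * (MI n j).card * (r⁻¹ ^ (m - j)) ^ 2) *
              ((2 ^ (n + 3) * (n + 1 : ℕ) ^ 2 * r ^ 2) ^ (m - 1 - j) *
                gradInt (m - 1) g (Metric.ball z r)) := by gcongr
          _ = (m * (MI n j).card * (2 ^ (n + 3) * (n + 1 : ℕ) ^ 2) ^ (m - 1 - j)) *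
              (((r⁻¹ ^ (m - j)) ^ 2 * (r ^ 2) ^ (m - 1 - j)) *
                gradInt (m - 1) g (Metric.ball z r)) := by
              rw [mul_pow _ (r ^ 2)]; ring
          _ = _ := by rw [e]

lemma integrableOn_conj_mul_mul {X Y a : Pt n → ℂ} (hX : Continuous X)
    (hXc : HasCompactSupport X) (ha : Measurable a) {Λ : ℝ} (haΛ : ∀ᵐ p, ‖a p‖ ≤ Λ)
    {B : Set (Pt n)} (hY : IntegrableOn Y B) :
    IntegrableOn (fun p => (starRingEnd ℂ) (X p) * a p * Y p) B := by
  obtain ⟨K, hK⟩ := hX.bounded_above_of_compact_support hXc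
  refine Integrable.bdd_mul (c := K * Λ) hY ?_ ?_
  · exact ((Complex.continuous_conj.comp hX).measurable.mul ha).aestronglyMeasurable
  · filter_upwards [ae_restrict_of_ae haΛ] with p hp
    rw [norm_mul, RCLike.norm_conj]
    exact mul_le_mul (hK p) hp (norm_nonneg _) ((norm_nonneg _).trans (hK p))

lemma caccioppoli_constant {lam M K N Γ E D X I Y : ℝ} (hM : 0 ≤ M) (hN : 0 ≤ N)
    (hΓ : 0 ≤ Γ) (hlam : 0 < lam) (hE : 0 ≤ E) (hD : 0 ≤ D)
    (hX : X ≤ 2 / lam * (Γ * (M ^ 2 * I + M * D))) (hI : I ≤ K ^ 2 * (N * E))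
    (hY : Y ≤ 2 * X + 2 * M * I) :
    Y ≤ (4 / lam * (Γ * (M ^ 2 * K ^ 2 * N + M)) + 2 * M * K ^ 2 * N) * (E + D) := by
  calc _ ≤ 2 * X + 2 * M * I := hY
    _ ≤ 2 * (2 / lam * (Γ * (M ^ 2 * I + M * D))) + 2 * M * I := by gcongr
    _ ≤ 2 * (2 / lam * (Γ * (M ^ 2 * (K ^ 2 * (N * E)) + M * D))) +
        2 * M * (K ^ 2 * (N * E)) := by gcongr
    _ = 4 / lam * (Γ * (M ^ 2 * K ^ 2 * N * E + M * D)) + 2 * M * K ^ 2 * N * E := by ring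
    _ ≤ 4 / lam * (Γ * (M ^ 2 * K ^ 2 * N * (E + D) + M * (E + D))) +
        2 * M * K ^ 2 * N * (E + D) := by
      gcongr <;> linarith
    _ = _ := by ring

set_option maxHeartbeats 800000 in
/-- Caccioppoli inequality for a smooth function whose top order derivatives are close to an
array `v` annihilated by the operator. -/
lemma exists_caccioppoli_smooth (n m : ℕ) (hm : 1 ≤ m) (lam Λ : ℝ) (hlam : 0 < lam) :
    ∃ C : ℝ, 0 ≤ C ∧ ∀ A : Coef n, CoefMeasurable A → CoefBounded m A Λ → Garding m A lam →
      ∀ (z : Pt n) (r : ℝ), 0 < r → ∀ (f : Pt n → ℂ), Smooth f →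
      ∀ v : (Fin (n + 1) → ℕ) → Pt n → ℂ,
      (∀ β ∈ MI n m, MemLp (v β) 2 (volume.restrict (Metric.ball z r))) →
      (∀ φ, IsTest (Metric.ball z r) φ → ∑ α ∈ MI n m, ∑ β ∈ MI n m,
        ∫ p in Metric.ball z r, (starRingEnd ℂ) (mpd α φ p) * A α β p * v β p = 0) →
      gradInt m f (Metric.ball z (r / 2)) ≤
        C * (r⁻¹ ^ 2 * gradInt (m - 1) f (Metric.ball z r) +
          ∑ β ∈ MI n m, ∫ p in Metric.ball z r, ‖mpd β f p - v β p‖ ^ 2) := by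
  obtain ⟨K, hK, hcut⟩ := exists_cutoff n m
  obtain ⟨N₁, hN₁, hcomm⟩ := exists_norm_mpd_mul_sub_le n m
  obtain ⟨N₂, hN₂, hlow⟩ := exists_integral_lowerSum_sq_le n m hm
  set M : ℝ := ((MI n m).card : ℝ) with hM
  have hM0 : 0 ≤ M := by positivity
  set κ : ℝ := lam / (4 * (M + 1)) with hκd
  have hκ : 0 < κ := by positivity
  have hκM : 2 * κ * M ≤ lam / 2 := by
    rw [hκd, mul_comm 2, div_mul_eq_mul_div, div_mul_eq_mul_div, div_le_iff₀ (by positivity)]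
    nlinarith
  set Γ : ℝ := 6 * |Λ| + 10 * |Λ| ^ 2 / κ with hΓd
  have hΓ : 0 ≤ Γ := by positivity
  set K' : ℝ := N₁ * K with hK'
  have hK'0 : 0 ≤ K' := by positivity
  refine ⟨4 / lam * (Γ * (M ^ 2 * K' ^ 2 * N₂ + M)) + 2 * M * K' ^ 2 * N₂, by positivity, ?_⟩
  intro A hAm hAb hG z r hr f hf v hv hsol
  set B := Metric.ball z r with hB
  have hBm : MeasurableSet B := measurableSet_ball
  have hvolB : volume B ≠ 0 := (Metric.measure_ball_pos volume z hr).ne'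
  have : IsFiniteMeasure (volume.restrict B) :=
    ⟨by rw [Measure.restrict_apply_univ]; exact measure_ball_lt_top⟩
  obtain ⟨P, hP, hP0, hPm⟩ := exists_polynomial_mean_zero hvolB Metric.isBounded_ball (m - 1) f hf
  set g : Pt n → ℂ := fun q => f q - P q with hgdef
  have hg : Smooth g := ContDiff.sub hf hP
  have hgf : ∀ γ : Fin (n + 1) → ℕ, m - 1 ≤ ∑ i, γ i → mpd γ g = mpd γ f := by
    intro γ hγ
    rw [hgdef, mpd_sub hf hP]
    funext p
    rw [hP0 γ hγ, sub_zero]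
  have hgI : ∀ k, m - 1 ≤ k → ∀ S, gradInt k g S = gradInt k f S := by
    intro k hk S
    refine Finset.sum_congr rfl fun γ hγ => ?_
    rw [hgf γ (by rw [mem_MI.1 hγ]; exact hk)]
  obtain ⟨η, hη, hηc, hηs, hηr, hη1, hηb, hηd, hηd2⟩ := hcut z r hr
  have hθ : Smooth fun q => η q * η q := ContDiff.mul hη hη
  set Hf : Pt n → ℂ := fun q => η q * g q with hHf
  set Tf : Pt n → ℂ := fun q => (η q * η q) * g q with hTf
  have hH : Smooth Hf := ContDiff.mul hη hg
  have hT : Smooth Tf := ContDiff.mul hθ hg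
  have hHc : HasCompactSupport Hf := hηc.mul_right
  have hTc : HasCompactSupport Tf := HasCompactSupport.mul_right hηc.mul_right
  have hHs : tsupport Hf ⊆ B := (tsupport_mul_subset_left).trans hηs
  have hTs : tsupport Tf ⊆ B :=
    (tsupport_mul_subset_left).trans ((tsupport_mul_subset_left).trans hηs)
  set Lw : Pt n → ℝ := fun p => K' * lowerSum m r g p with hLw
  have hLw0 : ∀ p, 0 ≤ Lw p := fun p => mul_nonneg hK'0 (lowerSum_nonneg m hr g p)
  have hHG : ∀ α ∈ MI n m, ∀ p, ‖mpd α Hf p - η p * mpd α g p‖ ≤ Lw p := fun α hα p =>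
    hcomm α hα η g hη hg p K r hK hr fun μ hμ => hηd μ hμ p
  have hTG : ∀ α ∈ MI n m, ∀ p, ‖mpd α Tf p - η p * η p * mpd α g p‖ ≤ Lw p * ‖η p‖ := by
    intro α hα p
    have := hcomm α hα (fun q => η q * η q) g hθ hg p (K * ‖η p‖) r (by positivity) hr
      fun μ hμ => (hηd2 μ hμ p).trans (le_of_eq (by ring))
    exact this.trans (le_of_eq (by simp only [hLw, hK']; ring))
  -- integrability
  have hLwI : IntegrableOn (fun p => Lw p ^ 2) B :=
    ((((continuous_lowerSum m r hg).const_smul K').pow 2).continuousOn.integrableOn_compact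
      (isCompact_closedBall z r)).mono_set Metric.ball_subset_closedBall
  have hsm : ∀ h : Pt n → ℂ, Smooth h → MemLp h 2 (volume.restrict B) := fun h hh => by
    refine (memLp_two_iff_integrable_sq_norm hh.continuous.aestronglyMeasurable).2 ?_
    exact hh.integrableOn_norm_sq_ball z r
  have hDI : ∀ β ∈ MI n m, IntegrableOn (fun p => ‖mpd β g p - v β p‖ ^ 2) B := fun β hβ =>
    ((hsm _ (hg.mpd β)).sub (hv β hβ)).integrable_norm_pow (by norm_num)
  have hHI : ∀ α, IntegrableOn (fun p => ‖mpd α Hf p‖ ^ 2) B := fun α =>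
    (hH.mpd α).integrableOn_norm_sq_ball z r
  have hHHI : ∀ α ∈ MI n m, ∀ β ∈ MI n m,
      IntegrableOn (fun p => (starRingEnd ℂ) (mpd α Hf p) * A α β p * mpd β Hf p) B :=
    fun α hα β hβ => integrableOn_conj_mul_mul (hH.mpd α).continuous (hHc.mpd hH α)
      (hAm α β) (hAb α hα β hβ) ((hsm _ (hH.mpd β)).integrable (by norm_num))
  have hTvI : ∀ α ∈ MI n m, ∀ β ∈ MI n m,
      IntegrableOn (fun p => (starRingEnd ℂ) (mpd α Tf p) * A α β p * v β p) B :=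
    fun α hα β hβ => integrableOn_conj_mul_mul (hT.mpd α).continuous (hTc.mpd hT α)
      (hAm α β) (hAb α hα β hβ) ((hv β hβ).integrable (by norm_num))
  have hsub : ∀ α, Function.support (mpd α Hf) ⊆ B := fun α =>
    (subset_tsupport _).trans ((tsupport_mpd_subset hH α).trans hHs)
  -- pointwise inequality for each pair of indices, integrated
  have hpair : ∀ α ∈ MI n m, ∀ β ∈ MI n m,
      ((∫ p in B, (starRingEnd ℂ) (mpd α Hf p) * A α β p * mpd β Hf p) -
        ∫ p in B, (starRingEnd ℂ) (mpd α Tf p) * A α β p * v β p).re ≤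
      κ * (∫ p in B, ‖mpd α Hf p‖ ^ 2) + κ * (∫ p in B, ‖mpd β Hf p‖ ^ 2) +
        Γ * ((∫ p in B, Lw p ^ 2) + ∫ p in B, ‖mpd β g p - v β p‖ ^ 2) := by
    intro α hα β hβ
    have i₁ : IntegrableOn (fun p => κ * ‖mpd α Hf p‖ ^ 2 + κ * ‖mpd β Hf p‖ ^ 2) B :=
      ((hHI α).const_mul κ).add ((hHI β).const_mul κ)
    have i₂ : IntegrableOn (fun p => Γ * (Lw p ^ 2 + ‖mpd β g p - v β p‖ ^ 2)) B :=
      (hLwI.add (hDI β hβ)).const_mul Γ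
    rw [← integral_sub (hHHI α hα β hβ) (hTvI α hα β hβ), ← integral_const_mul,
      ← integral_const_mul, ← integral_add (hLwI) (hDI β hβ), ← integral_const_mul,
      ← integral_add ((hHI α).const_mul κ) ((hHI β).const_mul κ), ← integral_add i₁ i₂]
    have hInt := (hHHI α hα β hβ).sub (hTvI α hα β hβ)
    have e := (integral_re (𝕜 := ℂ) hInt)
    simp only [RCLike.re_to_complex, Pi.sub_apply] at e
    rw [← e]
    refine integral_mono_ae hInt.re (i₁.add i₂) ?_
    filter_upwards [ae_restrict_of_ae (hAb α hα β hβ)] with p hp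
    exact re_sub_le_of_approx hκ (abs_nonneg Λ) (hLw0 p) (hηr p) (hη1 p)
      (hp.trans (le_abs_self Λ)) (hHG α hα p) (hHG β hβ p) (hTG α hα p)
  set X : ℝ := ∑ α ∈ MI n m, ∫ p in B, ‖mpd α Hf p‖ ^ 2 with hX
  set D : ℝ := ∑ β ∈ MI n m, ∫ p in B, ‖mpd β g p - v β p‖ ^ 2 with hD
  set I : ℝ := ∫ p in B, Lw p ^ 2 with hI
  have hX0 : 0 ≤ X := Finset.sum_nonneg fun _ _ => integral_nonneg fun _ => by positivity
  have hD0 : 0 ≤ D := Finset.sum_nonneg fun _ _ => integral_nonneg fun _ => by positivity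
  have hI0 : 0 ≤ I := integral_nonneg fun _ => by positivity
  have hmain : lam * X ≤ lam / 2 * X + Γ * (M ^ 2 * I + M * D) := by
    have h1 := hG Hf hH hHc
    have e1 : ∀ α, ∫ p, ‖mpd α Hf p‖ ^ 2 = ∫ p in B, ‖mpd α Hf p‖ ^ 2 := fun α =>
      (setIntegral_eq_integral_of_forall_compl_eq_zero fun p hp => by
        rw [Function.notMem_support.1 fun h => hp (hsub α h)]; simp).symm
    have e2 : ∀ α β, ∫ p, (starRingEnd ℂ) (mpd α Hf p) * A α β p * mpd β Hf p =
        ∫ p in B, (starRingEnd ℂ) (mpd α Hf p) * A α β p * mpd β Hf p := fun α β =>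
      (setIntegral_eq_integral_of_forall_compl_eq_zero fun p hp => by
        rw [Function.notMem_support.1 fun h => hp (hsub α h)]; simp).symm
    simp only [e1, e2] at h1
    have h2 := hsol Tf ⟨hT, hTc, hTs⟩
    calc lam * X ≤ (∑ α ∈ MI n m, ∑ β ∈ MI n m,
          ((∫ p in B, (starRingEnd ℂ) (mpd α Hf p) * A α β p * mpd β Hf p) -
          ∫ p in B, (starRingEnd ℂ) (mpd α Tf p) * A α β p * v β p)).re := by
          simp only [Finset.sum_sub_distrib, h2, sub_zero]
          exact h1
      _ ≤ ∑ α ∈ MI n m, ∑ β ∈ MI n m,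
          (κ * (∫ p in B, ‖mpd α Hf p‖ ^ 2) + κ * (∫ p in B, ‖mpd β Hf p‖ ^ 2) +
          Γ * (I + ∫ p in B, ‖mpd β g p - v β p‖ ^ 2)) := by
          rw [Complex.re_sum]
          refine Finset.sum_le_sum fun α hα => ?_
          rw [Complex.re_sum]
          exact Finset.sum_le_sum fun β hβ => hpair α hα β hβ
      _ = 2 * κ * M * X + Γ * (M ^ 2 * I + M * D) := by
          simp only [Finset.sum_add_distrib, ← Finset.mul_sum, Finset.sum_const, nsmul_eq_mul,
            ← hM, ← hX, ← hD]
          ring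
      _ ≤ _ := by gcongr
  have hI' : I ≤ K' ^ 2 * (N₂ * (r⁻¹ ^ 2 * gradInt (m - 1) f B)) := by
    rw [← hgI (m - 1) le_rfl]
    have e : I = K' ^ 2 * ∫ p in B, lowerSum m r g p ^ 2 := by
      rw [hI, ← integral_const_mul]
      exact integral_congr_ae (Filter.Eventually.of_forall fun p => by simp only [hLw]; ring)
    rw [e]
    gcongr
    exact hlow g hg z r hr hPm
  have hD' : D = ∑ β ∈ MI n m, ∫ p in B, ‖mpd β f p - v β p‖ ^ 2 :=
    Finset.sum_congr rfl fun β hβ => by rw [hgf β (by rw [mem_MI.1 hβ]; omega)]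
  have hin : gradInt m f (Metric.ball z (r / 2)) ≤ 2 * X + 2 * M * I := by
    have hBB : Metric.ball z (r / 2) ⊆ B := Metric.ball_subset_ball (by linarith)
    rw [← hgI m (by omega), hX, Finset.mul_sum, mul_comm 2 M, mul_assoc, hM, ← nsmul_eq_mul,
      ← Finset.sum_const, ← Finset.sum_add_distrib]
    refine Finset.sum_le_sum fun α hα => ?_
    have hi : IntegrableOn (fun p => 2 * ‖mpd α Hf p‖ ^ 2 + 2 * Lw p ^ 2) B :=
      ((hHI α).const_mul 2).add (hLwI.const_mul 2)
    calc ∫ p in Metric.ball z (r / 2), ‖mpd α g p‖ ^ 2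
        ≤ ∫ p in Metric.ball z (r / 2), (2 * ‖mpd α Hf p‖ ^ 2 + 2 * Lw p ^ 2) := by
          refine setIntegral_mono_on ((hg.mpd α).integrableOn_norm_sq_ball z _)
            (hi.mono_set hBB) measurableSet_ball fun p hp => ?_
          have h1 := hHG α hα p
          rw [hηb p hp, one_mul] at h1
          have h2 : ‖mpd α g p‖ ≤ ‖mpd α Hf p‖ + Lw p := by
            have := norm_sub_norm_le (mpd α g p) (mpd α Hf p)
            rw [norm_sub_rev] at this
            linarith
          nlinarith [sq_nonneg (‖mpd α Hf p‖ - Lw p), norm_nonneg (mpd α g p)]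
      _ ≤ ∫ p in B, (2 * ‖mpd α Hf p‖ ^ 2 + 2 * Lw p ^ 2) :=
          setIntegral_mono_set hi (Filter.Eventually.of_forall fun p => by
            simp only [Pi.zero_apply]; positivity) hBB.eventuallyLE
      _ = _ := by
          rw [integral_add ((hHI α).const_mul 2) (hLwI.const_mul 2), integral_const_mul,
            integral_const_mul]
  have hX' : X ≤ 2 / lam * (Γ * (M ^ 2 * I + M * D)) := by
    rw [div_mul_eq_mul_div, le_div_iff₀ hlam]
    linarith
  rw [← hD']
  exact caccioppoli_constant hM0 hN₂ hΓ hlam (mul_nonneg (by positivity) (gradInt_nonneg _ _ _))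
    hD0 hX' hI' hin

end Caccioppoli

section Mollification

variable {n : ℕ}

/-- Convolution of complex valued functions. -/
def conv (h k : Pt n → ℂ) (p : Pt n) : ℂ := ∫ q, h q * k (p - q)

lemma smooth_conv {h k : Pt n → ℂ} (hh : LocallyIntegrable h) (hk : Smooth k)
    (hkc : HasCompactSupport k) : Smooth (conv h k) :=
  hkc.contDiff_convolution_right (ContinuousLinearMap.mul ℝ ℂ) hh hk

lemma pdir_conv {h k : Pt n → ℂ} (hh : LocallyIntegrable h) (hk : Smooth k)
    (hkc : HasCompactSupport k) (v : Pt n) : pdir v (conv h k) = conv h (pdir v k) := by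
  funext p
  have h1 := hkc.hasFDerivAt_convolution_right (ContinuousLinearMap.mul ℝ ℂ) hh
    (hk.of_le (by exact_mod_cast le_top)) p
  have h2 := convolution_precompR_apply (ContinuousLinearMap.mul ℝ ℂ) hh (hkc.fderiv (𝕜 := ℝ))
    (hk.continuous_fderiv (by simp)) p v
  calc pdir v (conv h k) p = _ := by rw [pdir]; exact congrArg (fun T => T v) h1.fderiv
    _ = _ := h2

lemma mpd_conv {h k : Pt n → ℂ} (hh : LocallyIntegrable h) (hk : Smooth k)
    (hkc : HasCompactSupport k) (γ : Fin (n + 1) → ℕ) : mpd γ (conv h k) = conv h (mpd γ k) := by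
  induction γ using multiindex_induction with
  | h0 => simp [mpd_zero]
  | hs γ i ih =>
    rw [mpd_add_single (smooth_conv hh hk hkc), mpd_add_single hk, ih,
      pdir_conv hh (hk.mpd γ) (hkc.mpd hk γ)]

lemma integrable_conv {h k : Pt n → ℂ} (hh : LocallyIntegrable h) (hk : Continuous k)
    (hkc : HasCompactSupport k) (p : Pt n) : Integrable fun q => h q * k (p - q) :=
  hkc.convolutionExists_right (ContinuousLinearMap.mul ℝ ℂ) hh hk p

/-- The mollifier attached to a bump function. -/
def mollifier (φ : ContDiffBump (0 : Pt n)) (p : Pt n) : ℂ := (φ.normed volume p : ℂ)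

variable (φ : ContDiffBump (0 : Pt n))

lemma smooth_mollifier : Smooth (mollifier φ) :=
  Complex.ofRealCLM.contDiff.comp φ.contDiff_normed

lemma hasCompactSupport_mollifier : HasCompactSupport (mollifier φ) :=
  φ.hasCompactSupport_normed.comp_left (g := fun x : ℝ => (x : ℂ)) rfl

lemma tsupport_mollifier : tsupport (mollifier φ) ⊆ Metric.closedBall 0 φ.rOut := by
  rw [← φ.tsupport_normed_eq (μ := volume)]
  exact closure_mono fun p hp h0 => hp (by simp [mollifier, h0])

lemma lintegral_enorm_mollifier : ∫⁻ q, ‖mollifier φ q‖ₑ = 1 := by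
  have : ∀ q, ‖mollifier φ q‖ₑ = ENNReal.ofReal (φ.normed volume q) := fun q => by
    rw [← ofReal_norm, mollifier, Complex.norm_real, Real.norm_of_nonneg (φ.nonneg_normed q)]
  simp only [this]
  rw [← ofReal_integral_eq_lintegral_ofReal φ.integrable_normed
    (Filter.Eventually.of_forall φ.nonneg_normed), φ.integral_normed, ENNReal.ofReal_one]

lemma lintegral_conv_mollifier_le {h : Pt n → ℂ} (hh : Measurable h) :
    ∫⁻ p, ‖conv h (mollifier φ) p‖ₑ ^ 2 ≤ ∫⁻ p, ‖h p‖ₑ ^ 2 := by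
  have hkm : Measurable (mollifier φ) := (smooth_mollifier φ).continuous.measurable
  have hsqrt : ∀ x : ℝ≥0∞, (x ^ (1 / 2 : ℝ)) ^ 2 = x := fun x => by
    rw [← ENNReal.rpow_natCast, ← ENNReal.rpow_mul]; norm_num
  have hpt : ∀ p, ‖conv h (mollifier φ) p‖ₑ ^ 2 ≤
      ∫⁻ q, ‖mollifier φ (p - q)‖ₑ * ‖h q‖ₑ ^ 2 := by
    intro p
    calc ‖conv h (mollifier φ) p‖ₑ ^ 2 ≤ (∫⁻ q, ‖h q * mollifier φ (p - q)‖ₑ) ^ 2 := by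
          gcongr; exact enorm_integral_le_lintegral_enorm _
      _ = (∫⁻ q, ‖mollifier φ (p - q)‖ₑ ^ (1 / 2 : ℝ) *
            (‖mollifier φ (p - q)‖ₑ ^ (1 / 2 : ℝ) * ‖h q‖ₑ)) ^ 2 := by
          congr 1
          refine lintegral_congr fun q => ?_
          rw [← mul_assoc, ← sq, hsqrt, enorm_mul, mul_comm]
      _ ≤ (∫⁻ q, (‖mollifier φ (p - q)‖ₑ ^ (1 / 2 : ℝ)) ^ 2) *
            ∫⁻ q, (‖mollifier φ (p - q)‖ₑ ^ (1 / 2 : ℝ) * ‖h q‖ₑ) ^ 2 :=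
          sq_lintegral_mul_le (by fun_prop) (by fun_prop)
      _ = _ := by
          simp only [hsqrt, mul_pow]
          rw [lintegral_sub_left_eq_self (fun q => ‖mollifier φ q‖ₑ) p,
            lintegral_enorm_mollifier, one_mul]
  calc ∫⁻ p, ‖conv h (mollifier φ) p‖ₑ ^ 2
      ≤ ∫⁻ p, ∫⁻ q, ‖mollifier φ (p - q)‖ₑ * ‖h q‖ₑ ^ 2 := lintegral_mono hpt
    _ = ∫⁻ q, ∫⁻ p, ‖mollifier φ (p - q)‖ₑ * ‖h q‖ₑ ^ 2 :=
        lintegral_lintegral_swap (by fun_prop)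
    _ = ∫⁻ q, ‖h q‖ₑ ^ 2 := by
        refine lintegral_congr fun q => ?_
        rw [lintegral_mul_const _ (by fun_prop),
          lintegral_sub_right_eq_self (fun q => ‖mollifier φ q‖ₑ) q,
          lintegral_enorm_mollifier, one_mul]

lemma norm_conv_mollifier_sub_le {g : Pt n → ℂ} (hg : Continuous g) {p : Pt n} {e : ℝ}
    (he : ∀ q ∈ Metric.ball p φ.rOut, dist (g q) (g p) ≤ e) :
    ‖conv g (mollifier φ) p - g p‖ ≤ e := by
  have h := φ.dist_normed_convolution_le (μ := volume) (x₀ := p) hg.aestronglyMeasurable he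
  rw [dist_eq_norm, convolution_lsmul_swap] at h
  refine le_trans (le_of_eq ?_) h
  congr 2
  refine integral_congr_ae (Filter.Eventually.of_forall fun q => ?_)
  simp [mollifier, mul_comm]

lemma enorm_add_sq_le (a b : ℂ) : ‖a + b‖ₑ ^ 2 ≤ 2 * ‖a‖ₑ ^ 2 + 2 * ‖b‖ₑ ^ 2 := by
  rw [enorm_sq_eq_ofReal, enorm_sq_eq_ofReal, enorm_sq_eq_ofReal, ← ENNReal.ofReal_ofNat 2,
    ← ENNReal.ofReal_mul (by norm_num), ← ENNReal.ofReal_mul (by norm_num),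
    ← ENNReal.ofReal_add (by positivity) (by positivity)]
  refine ENNReal.ofReal_le_ofReal ?_
  nlinarith [norm_add_le a b, norm_nonneg (a + b), sq_nonneg (‖a‖ - ‖b‖), norm_nonneg a,
    norm_nonneg b]

lemma lintegral_enorm_sq_eq {α : Type*} [MeasurableSpace α] {μ : Measure α} (f : α → ℂ) :
    ∫⁻ x, ‖f x‖ₑ ^ 2 ∂μ = eLpNorm f 2 μ ^ 2 := by
  have := eLpNorm_nnreal_pow_eq_lintegral (f := f) (μ := μ) (p := 2) (by norm_num)
  simp only [NNReal.coe_ofNat, ENNReal.rpow_ofNat] at this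
  exact this.symm

lemma memLp_two_iff {α : Type*} [MeasurableSpace α] {μ : Measure α} {f : α → ℂ}
    (hf : AEStronglyMeasurable f μ) : MemLp f 2 μ ↔ ∫⁻ x, ‖f x‖ₑ ^ 2 ∂μ < ⊤ := by
  rw [lintegral_enorm_sq_eq]
  simp [MemLp, hf]

/-- Mollifications converge in `L²` on sets of finite measure. -/
lemma exists_lintegral_conv_mollifier_sub_le {h : Pt n → ℂ} (hh : Measurable h)
    (h2 : MemLp h 2 volume) {S : Set (Pt n)} (hS : volume S ≠ ⊤) {δ : ℝ≥0∞} (hδ : 0 < δ) :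
    ∃ ε : ℝ, 0 < ε ∧ ∀ φ : ContDiffBump (0 : Pt n), φ.rOut ≤ ε →
      ∫⁻ p in S, ‖conv h (mollifier φ) p - h p‖ₑ ^ 2 ≤ δ := by
  wlog hδt : δ ≠ ⊤ generalizing δ
  · obtain ⟨ε, hε, H⟩ := this (δ := 1) one_pos one_ne_top
    exact ⟨ε, hε, fun φ hφ => (H φ hφ).trans (by simp [not_not.1 hδt])⟩
  have h10 : δ / 10 ≠ 0 := by simp [hδ.ne']
  have hrt : (δ / 10) ^ (1 / 2 : ℝ) ≠ 0 := by simp [h10]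
  obtain ⟨g, hgc, hgh, hg, hg2⟩ := h2.exists_hasCompactSupport_eLpNorm_sub_le (by simp) hrt
  have hgh2 : ∫⁻ p, ‖h p - g p‖ₑ ^ 2 ≤ δ / 10 := by
    have := lintegral_enorm_sq_eq (μ := volume) (h - g)
    simp only [Pi.sub_apply] at this
    rw [this]
    calc _ ≤ ((δ / 10) ^ (1 / 2 : ℝ)) ^ 2 := by gcongr
      _ = δ / 10 := by rw [← ENNReal.rpow_natCast, ← ENNReal.rpow_mul]; norm_num
  obtain ⟨e, he, heS⟩ : ∃ e : ℝ, 0 < e ∧ ENNReal.ofReal (e ^ 2) * volume S ≤ δ / 10 := by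
    obtain ⟨c, hc, hcS⟩ : ∃ c : ℝ, 0 < c ∧ ENNReal.ofReal c * volume S ≤ δ / 10 := by
      obtain ⟨c, hc, h⟩ := ENNReal.exists_nnreal_pos_mul_lt hS h10
      exact ⟨c, hc, by simpa using h.le⟩
    exact ⟨√c, by positivity, by rwa [Real.sq_sqrt hc.le]⟩
  have huc := hgc.uniformContinuous_of_continuous hg
  obtain ⟨ε, hε, hu⟩ := Metric.uniformContinuous_iff.1 huc e he
  refine ⟨ε, hε, fun φ hφ => ?_⟩
  have hloc : LocallyIntegrable h := h2.locallyIntegrable (by norm_num)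
  have hlocg : LocallyIntegrable g := hg.locallyIntegrable
  have hk := smooth_mollifier φ
  have hkc := hasCompactSupport_mollifier φ
  have hpt : ∀ p, ‖conv h (mollifier φ) p - h p‖ₑ ^ 2 ≤
      2 * (2 * ‖conv (fun q => h q - g q) (mollifier φ) p‖ₑ ^ 2 + 2 * ‖h p - g p‖ₑ ^ 2) +
        2 * ENNReal.ofReal (e ^ 2) := by
    intro p
    have e1 : conv (fun q => h q - g q) (mollifier φ) p =
        conv h (mollifier φ) p - conv g (mollifier φ) p := by
      simp only [conv]
      rw [← integral_sub (integrable_conv hloc hk.continuous hkc p)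
        (integrable_conv hlocg hk.continuous hkc p)]
      simp only [sub_mul]
    have e2 : ‖conv g (mollifier φ) p - g p‖ₑ ^ 2 ≤ ENNReal.ofReal (e ^ 2) := by
      rw [enorm_sq_eq_ofReal]
      gcongr
      exact norm_conv_mollifier_sub_le φ hg fun q hq => (hu (lt_of_lt_of_le hq hφ)).le
    have e3 : conv h (mollifier φ) p - h p =
        (conv (fun q => h q - g q) (mollifier φ) p + -(h p - g p)) +
          (conv g (mollifier φ) p - g p) := by rw [e1]; ring
    rw [e3]
    refine (enorm_add_sq_le _ _).trans ?_
    gcongr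
    refine (enorm_add_sq_le _ _).trans ?_
    rw [enorm_neg]
  have hm1 : Measurable fun p => ‖h p - g p‖ₑ ^ 2 := by
    have := hg.measurable
    fun_prop
  have hm2 : Measurable fun p => ‖conv (fun q => h q - g q) (mollifier φ) p‖ₑ ^ 2 :=
    ((smooth_conv (hloc.sub hlocg) hk hkc).continuous.measurable.enorm).pow_const 2
  calc ∫⁻ p in S, ‖conv h (mollifier φ) p - h p‖ₑ ^ 2
      ≤ ∫⁻ p in S, (2 * (2 * ‖conv (fun q => h q - g q) (mollifier φ) p‖ₑ ^ 2 +
          2 * ‖h p - g p‖ₑ ^ 2) + 2 * ENNReal.ofReal (e ^ 2)) := lintegral_mono hpt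
    _ = 2 * (2 * (∫⁻ p in S, ‖conv (fun q => h q - g q) (mollifier φ) p‖ₑ ^ 2) +
          2 * ∫⁻ p in S, ‖h p - g p‖ₑ ^ 2) + 2 * ENNReal.ofReal (e ^ 2) * volume S := by
        rw [lintegral_add_right _ measurable_const, lintegral_const_mul _ (by fun_prop),
          lintegral_add_right _ (by fun_prop), lintegral_const_mul _ hm2,
          lintegral_const_mul _ hm1, lintegral_const, Measure.restrict_apply_univ]
    _ ≤ 2 * (2 * (δ / 10) + 2 * (δ / 10)) + 2 * (δ / 10) := by
        rw [mul_assoc 2 (ENNReal.ofReal _)]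
        gcongr
        · refine (setLIntegral_le_lintegral _ _).trans
            ((lintegral_conv_mollifier_le φ (hh.sub hg.measurable)).trans hgh2)
        · exact (setLIntegral_le_lintegral _ _).trans hgh2
    _ = 10 * (δ / 10) := by ring
    _ = δ := ENNReal.mul_div_cancel (by norm_num) (by norm_num)

lemma setIntegral_eq_integral_indicator {Ω B : Set (Pt n)} (hΩ : MeasurableSet Ω) (hB : B ⊆ Ω)
    (a j : Pt n → ℂ) (hj : ∀ q ∉ B, j q = 0) :
    ∫ q in Ω, a q * j q = ∫ q, B.indicator a q * j q := by
  rw [← integral_indicator hΩ]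
  congr 1
  funext q
  by_cases hq : q ∈ B
  · simp [hq, hB hq]
  · by_cases hq' : q ∈ Ω <;> simp [hq, hq', hj q hq]

/-- Functions with weak derivatives in `L²` of a ball are approximated, with all derivatives, by
smooth functions in the ball of half the radius. -/
lemma exists_smooth_approx {m : ℕ} {Ω : Set (Pt n)} (hΩ : MeasurableSet Ω) {z : Pt n} {ℓ : ℝ}
    (hℓ : 0 < ℓ) (hB : Metric.ball z ℓ ⊆ Ω) {w : Pt n → ℂ} {dw : (Fin (n + 1) → ℕ) → Pt n → ℂ}
    (h0 : dw 0 = w) (hm : ∀ γ : Fin (n + 1) → ℕ, ∑ i, γ i ≤ m → Measurable (dw γ))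
    (h2 : ∀ γ : Fin (n + 1) → ℕ, ∑ i, γ i ≤ m → ∫⁻ p in Metric.ball z ℓ, ‖dw γ p‖ₑ ^ 2 < ⊤)
    (hw : ∀ γ : Fin (n + 1) → ℕ, ∑ i, γ i ≤ m → IsWeakDeriv Ω γ w (dw γ))
    {δ : ℝ≥0∞} (hδ : 0 < δ) :
    ∃ f : Pt n → ℂ, Smooth f ∧ ∀ γ : Fin (n + 1) → ℕ, ∑ i, γ i ≤ m →
      ∫⁻ p in Metric.ball z (ℓ / 2), ‖mpd γ f p - dw γ p‖ₑ ^ 2 ≤ δ := by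
  set B := Metric.ball z ℓ with hBd
  have hBm : MeasurableSet B := measurableSet_ball
  have hWm : ∀ γ : Fin (n + 1) → ℕ, ∑ i, γ i ≤ m → Measurable (B.indicator (dw γ)) :=
    fun γ hγ => (hm γ hγ).indicator hBm
  have hW2 : ∀ γ : Fin (n + 1) → ℕ, ∑ i, γ i ≤ m → MemLp (B.indicator (dw γ)) 2 volume :=
    fun γ hγ => (memLp_indicator_iff_restrict hBm).2
      ((memLp_two_iff (hm γ hγ).aestronglyMeasurable).2 (h2 γ hγ))
  have hloc : ∀ γ : Fin (n + 1) → ℕ, ∑ i, γ i ≤ m → LocallyIntegrable (B.indicator (dw γ)) :=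
    fun γ hγ => (hW2 γ hγ).locallyIntegrable (by norm_num)
  let S : Finset (Fin (n + 1) → ℕ) := (Finset.range (m + 1)).biUnion fun k => MI n k
  have hS : ∀ γ : Fin (n + 1) → ℕ, γ ∈ S ↔ ∑ i, γ i ≤ m := by
    intro γ
    simp only [S, Finset.mem_biUnion, Finset.mem_range, mem_MI]
    exact ⟨fun ⟨k, hk, h⟩ => by omega, fun h => ⟨_, by omega, rfl⟩⟩
  have hev : ∀ γ ∈ S, ∀ᶠ ε in nhdsWithin (0 : ℝ) (Ioi 0),
      ∀ φ : ContDiffBump (0 : Pt n), φ.rOut ≤ ε → ∫⁻ p in Metric.ball z (ℓ / 2),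
        ‖conv (B.indicator (dw γ)) (mollifier φ) p - B.indicator (dw γ) p‖ₑ ^ 2 ≤ δ := by
    intro γ hγ
    obtain ⟨ε, hε, H⟩ := exists_lintegral_conv_mollifier_sub_le (hWm γ ((hS γ).1 hγ))
      (hW2 γ ((hS γ).1 hγ)) (S := Metric.ball z (ℓ / 2)) measure_ball_lt_top.ne hδ
    filter_upwards [Ioc_mem_nhdsGT hε] with ε' hε' φ hφ
    exact H φ (hφ.trans hε'.2)
  obtain ⟨ε, hεS, hε⟩ := (((Filter.eventually_all_finset S).2 hev).and
    (Ioc_mem_nhdsGT (show (0 : ℝ) < ℓ / 4 by positivity))).exists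
  let φ : ContDiffBump (0 : Pt n) := ⟨ε / 2, ε, by linarith [hε.1], by linarith [hε.1]⟩
  have hk := smooth_mollifier φ
  have hkc := hasCompactSupport_mollifier φ
  have hs0 : ∑ i, (0 : Fin (n + 1) → ℕ) i ≤ m := by simp
  refine ⟨conv (B.indicator w) (mollifier φ), smooth_conv (h0 ▸ hloc 0 hs0) hk hkc,
    fun γ hγ => ?_⟩
  refine le_trans (le_of_eq ?_) (hεS γ ((hS γ).2 hγ) φ le_rfl)
  refine setLIntegral_congr_fun measurableSet_ball fun p hp => ?_
  have hpB : p ∈ B := Metric.ball_subset_ball (by linarith) hp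
  have hcb : Metric.closedBall p ε ⊆ B := by
    refine Metric.closedBall_subset_ball' ?_
    have := Metric.mem_ball.1 hp
    linarith [hε.2]
  have hz : ∀ q ∉ B, p - q ∉ Metric.closedBall (0 : Pt n) φ.rOut := by
    intro q hq h
    refine hq (hcb ?_)
    rwa [mem_closedBall_zero_iff, ← dist_eq_norm, dist_comm] at h
  have htest : IsTest Ω fun q => mollifier φ (p + (-1 : ℝ) • q) := by
    have hc : Continuous fun q : Pt n => p + (-1 : ℝ) • q := by fun_prop
    have hsub : tsupport (fun q => mollifier φ (p + (-1 : ℝ) • q)) ⊆ Metric.closedBall p ε := by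
      refine (tsupport_comp_subset_preimage (mollifier φ) hc).trans fun q hq => ?_
      have := tsupport_mollifier φ hq
      rw [mem_closedBall_zero_iff] at this
      beta_reduce at this
      rw [neg_one_smul, ← sub_eq_add_neg, ← dist_eq_norm, dist_comm] at this
      exact this
    refine ⟨ContDiff.comp (g := mollifier φ) hk (by fun_prop), ?_, hsub.trans (hcb.trans hB)⟩
    exact HasCompactSupport.of_support_subset_isCompact (isCompact_closedBall p ε)
      ((subset_tsupport _).trans hsub)
  have key := hw γ hγ _ htest
  rw [mpd_comp_affine hk p (-1) γ] at key
  have hout : ∀ q ∉ B, mpd γ (mollifier φ) (p - q) = 0 := fun q hq =>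
    image_eq_zero_of_notMem_tsupport fun h =>
      hz q hq (tsupport_mollifier φ (tsupport_mpd_subset hk γ h))
  have hout0 : ∀ q ∉ B, mollifier φ (p - q) = 0 := fun q hq =>
    image_eq_zero_of_notMem_tsupport fun h => hz q hq (tsupport_mollifier φ h)
  have key2 : ∫ q in Ω, w q * mpd γ (mollifier φ) (p - q) =
      ∫ q in Ω, dw γ q * mollifier φ (p - q) := by
    have hne : ((-1 : ℂ) ^ (∑ i, γ i)) ≠ 0 := pow_ne_zero _ (by norm_num)
    refine mul_left_cancel₀ hne ?_
    simp only [neg_one_smul, ← sub_eq_add_neg, Complex.ofReal_neg, Complex.ofReal_one] at key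
    rw [← key, ← integral_const_mul]
    exact integral_congr_ae (Filter.Eventually.of_forall fun q => by ring)
  rw [setIntegral_eq_integral_indicator hΩ hB _ _ hout,
    setIntegral_eq_integral_indicator hΩ hB _ _ hout0] at key2
  rw [mpd_conv (h0 ▸ hloc 0 hs0) hk hkc, Set.indicator_of_mem hpB]
  simp only [conv]
  rw [key2]

end Mollification

section WeakCaccioppoli

variable {n : ℕ}

lemma lintegral_gradSq (k : ℕ) {dw : (Fin (n + 1) → ℕ) → Pt n → ℂ}
    (hm : ∀ γ ∈ MI n k, Measurable (dw γ)) (S : Set (Pt n)) :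
    ∫⁻ p in S, gradSq k dw p = ∑ γ ∈ MI n k, ∫⁻ p in S, ‖dw γ p‖ₑ ^ 2 :=
  lintegral_finsetSum _ fun γ hγ => ((hm γ hγ).enorm.pow_const 2)

lemma ofReal_gradInt (k : ℕ) {f : Pt n → ℂ} (hf : Smooth f) (z : Pt n) (r : ℝ) :
    ENNReal.ofReal (gradInt k f (Metric.ball z r)) =
      ∑ γ ∈ MI n k, ∫⁻ p in Metric.ball z r, ‖mpd γ f p‖ₑ ^ 2 := by
  rw [gradInt, ENNReal.ofReal_sum_of_nonneg fun _ _ => integral_nonneg fun _ => by positivity]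
  refine Finset.sum_congr rfl fun γ _ => ?_
  rw [ofReal_integral_eq_lintegral_ofReal ((hf.mpd γ).integrableOn_norm_sq_ball z r)
    (Filter.Eventually.of_forall fun _ => by simp only [Pi.zero_apply]; positivity)]
  simp only [enorm_sq_eq_ofReal]

lemma lintegral_enorm_sq_le_add {f g : Pt n → ℂ} (hf : Measurable f) (hg : Measurable g)
    (S : Set (Pt n)) {δ : ℝ≥0∞} (h : ∫⁻ p in S, ‖f p - g p‖ₑ ^ 2 ≤ δ) :
    ∫⁻ p in S, ‖f p‖ₑ ^ 2 ≤ 2 * (∫⁻ p in S, ‖g p‖ₑ ^ 2) + 2 * δ := by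
  calc ∫⁻ p in S, ‖f p‖ₑ ^ 2 ≤ ∫⁻ p in S, (2 * ‖g p‖ₑ ^ 2 + 2 * ‖f p - g p‖ₑ ^ 2) := by
        refine lintegral_mono fun p => ?_
        have := enorm_add_sq_le (g p) (f p - g p)
        rwa [add_sub_cancel] at this
    _ = 2 * (∫⁻ p in S, ‖g p‖ₑ ^ 2) + 2 * ∫⁻ p in S, ‖f p - g p‖ₑ ^ 2 := by
        rw [lintegral_add_left (by fun_prop), lintegral_const_mul _ (by fun_prop),
          lintegral_const_mul _ (by fun_prop)]
    _ ≤ _ := by gcongr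

/-- Caccioppoli inequality of higher order, bounding the gradient of order `m` by the gradient of
order `m - 1`. -/
lemma exists_caccioppoli (n m : ℕ) (hm : 1 ≤ m) (lam Λ : ℝ) (hlam : 0 < lam) :
    ∃ C : ℝ≥0∞, C ≠ ⊤ ∧ ∀ A : Coef n, CoefMeasurable A → CoefBounded m A Λ → Garding m A lam →
      ∀ (Ω : Set (Pt n)), MeasurableSet Ω → ∀ (z : Pt n) (ℓ : ℝ), 0 < ℓ → Metric.ball z ℓ ⊆ Ω →
      ∀ (w : Pt n → ℂ) (dw : (Fin (n + 1) → ℕ) → Pt n → ℂ), dw 0 = w →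
      (∀ γ : Fin (n + 1) → ℕ, ∑ i, γ i ≤ m → Measurable (dw γ)) →
      (∀ γ : Fin (n + 1) → ℕ, ∑ i, γ i ≤ m → ∫⁻ p in Metric.ball z ℓ, ‖dw γ p‖ₑ ^ 2 < ⊤) →
      (∀ γ : Fin (n + 1) → ℕ, ∑ i, γ i ≤ m → IsWeakDeriv Ω γ w (dw γ)) →
      WeakSolution m A Ω dw →
      ∫⁻ p in Metric.ball z (ℓ / 4), gradSq m dw p ≤
        C * ENNReal.ofReal (ℓ⁻¹ ^ 2) * ∫⁻ p in Metric.ball z (ℓ / 2), gradSq (m - 1) dw p := by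
  obtain ⟨C, hC, H⟩ := exists_caccioppoli_smooth n m hm lam Λ hlam
  refine ⟨ENNReal.ofReal (16 * C), ENNReal.ofReal_ne_top, ?_⟩
  intro A hAm hAb hG Ω hΩ z ℓ hℓ hB w dw h0 hdm h2 hw hsol
  set M : ℝ≥0∞ := ((MI n m).card : ℝ≥0∞)
  set M' : ℝ≥0∞ := ((MI n (m - 1)).card : ℝ≥0∞)
  set ρ : ℝ≥0∞ := ENNReal.ofReal ((ℓ / 2)⁻¹ ^ 2) with hρ
  set D : ℝ≥0∞ := ENNReal.ofReal C
  set K : ℝ≥0∞ := 2 * (D * (ρ * (M' * 2) + M)) + M * 2 with hK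
  have hKt : K ≠ ⊤ := by
    refine ENNReal.add_ne_top.2 ⟨ENNReal.mul_ne_top (by simp) (ENNReal.mul_ne_top
      ENNReal.ofReal_ne_top (ENNReal.add_ne_top.2 ⟨ENNReal.mul_ne_top ENNReal.ofReal_ne_top
      (ENNReal.mul_ne_top (ENNReal.natCast_ne_top _) (by simp)), ENNReal.natCast_ne_top _⟩)),
      ENNReal.mul_ne_top (ENNReal.natCast_ne_top _) (by simp)⟩
  refine ENNReal.le_of_forall_pos_le_add fun ε hε _ => ?_
  obtain ⟨δ, hδ, hδK⟩ := ENNReal.exists_nnreal_pos_mul_lt hKt (b := (ε : ℝ≥0∞)) (by simpa using hε.ne')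
  obtain ⟨f, hf, hfa⟩ := exists_smooth_approx hΩ hℓ hB h0 hdm h2 hw (δ := (δ : ℝ≥0∞))
    (by simpa using hδ)
  have hlt : ∀ γ ∈ MI n m, ∑ i, γ i ≤ m := fun γ hγ => (mem_MI.1 hγ).le
  have hlt' : ∀ γ ∈ MI n (m - 1), ∑ i, γ i ≤ m := fun γ hγ => by rw [mem_MI.1 hγ]; omega
  have hfm : ∀ γ, Measurable (mpd γ f) := fun γ => (hf.mpd γ).continuous.measurable
  have hB2 : Metric.ball z (ℓ / 2) ⊆ Metric.ball z ℓ := Metric.ball_subset_ball (by linarith)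
  have hB4 : Metric.ball z (ℓ / 4) ⊆ Metric.ball z (ℓ / 2) := Metric.ball_subset_ball (by linarith)
  have hcac := H A hAm hAb hG z (ℓ / 2) (by positivity) f hf dw
    (fun β hβ => (memLp_two_iff (hdm β (hlt β hβ)).aestronglyMeasurable).2
      ((lintegral_mono_set hB2).trans_lt (h2 β (hlt β hβ)))) (by
    intro φ hφ
    have e := hsol φ ⟨hφ.1, hφ.2.1, hφ.2.2.trans (hB2.trans hB)⟩
    rw [← e]
    refine Finset.sum_congr rfl fun α _ => Finset.sum_congr rfl fun β _ => ?_
    refine (setIntegral_eq_of_subset_of_forall_sdiff_eq_zero hΩ (hB2.trans hB) fun p hp => ?_).symm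
    rw [image_eq_zero_of_notMem_tsupport fun h =>
      hp.2 (hφ.2.2 (tsupport_mpd_subset hφ.1 α h))]
    simp)
  rw [show ℓ / 2 / 2 = ℓ / 4 by ring] at hcac
  have hdiff : ∀ β ∈ MI n m, ENNReal.ofReal (∫ p in Metric.ball z (ℓ / 2),
      ‖mpd β f p - dw β p‖ ^ 2) ≤ δ := by
    intro β hβ
    refine le_trans ?_ (hfa β (hlt β hβ))
    have hdβ := hdm β (hlt β hβ)
    have hfβ := hfm β
    rw [integral_eq_lintegral_of_nonneg_ae (Filter.Eventually.of_forall fun _ => by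
      simp only [Pi.zero_apply]; positivity) (by fun_prop)]
    refine ENNReal.ofReal_toReal_le.trans (le_of_eq ?_)
    simp only [enorm_sq_eq_ofReal]
  set Y : ℝ≥0∞ := ∫⁻ p in Metric.ball z (ℓ / 2), gradSq (m - 1) dw p with hY
  have hlow : ENNReal.ofReal (gradInt (m - 1) f (Metric.ball z (ℓ / 2))) ≤
      2 * Y + M' * (2 * δ) := by
    rw [ofReal_gradInt _ hf, hY, lintegral_gradSq _ fun γ hγ => hdm γ (hlt' γ hγ), Finset.mul_sum,
      ← nsmul_eq_mul, ← Finset.sum_const, ← Finset.sum_add_distrib]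
    exact Finset.sum_le_sum fun γ hγ => lintegral_enorm_sq_le_add (hfm γ) (hdm γ (hlt' γ hγ)) _
      (hfa γ (hlt' γ hγ))
  have htop : ENNReal.ofReal (gradInt m f (Metric.ball z (ℓ / 4))) ≤
      D * (ρ * (2 * Y + M' * (2 * δ)) + M * δ) := by
    refine (ENNReal.ofReal_le_ofReal hcac).trans ?_
    rw [ENNReal.ofReal_mul hC]
    refine mul_le_mul_right (ENNReal.ofReal_add_le.trans (add_le_add ?_ ?_)) _
    · rw [ENNReal.ofReal_mul (by positivity)]
      gcongr
    · rw [ENNReal.ofReal_sum_of_nonneg fun _ _ => integral_nonneg fun _ => by positivity]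
      exact (Finset.sum_le_sum hdiff).trans (le_of_eq (by simp [M]))
  calc ∫⁻ p in Metric.ball z (ℓ / 4), gradSq m dw p
      ≤ 2 * ENNReal.ofReal (gradInt m f (Metric.ball z (ℓ / 4))) + M * (2 * δ) := by
        rw [ofReal_gradInt _ hf, lintegral_gradSq _ fun γ hγ => hdm γ (hlt γ hγ), Finset.mul_sum,
          ← nsmul_eq_mul, ← Finset.sum_const, ← Finset.sum_add_distrib]
        refine Finset.sum_le_sum fun γ hγ => lintegral_enorm_sq_le_add (hdm γ (hlt γ hγ)) (hfm γ) _ ?_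
        simp only [enorm_sub_rev (dw γ _)]
        exact (lintegral_mono_set hB4).trans (hfa γ (hlt γ hγ))
    _ ≤ 2 * (D * (ρ * (2 * Y + M' * (2 * δ)) + M * δ)) + M * (2 * δ) := by gcongr
    _ = 4 * D * ρ * Y + δ * K := by rw [hK]; ring
    _ ≤ _ := by
        refine add_le_add (le_of_eq ?_) hδK.le
        congr 1
        simp only [D, hρ]
        rw [← ENNReal.ofReal_ofNat 4, ← ENNReal.ofReal_mul (by norm_num),
          ← ENNReal.ofReal_mul (by positivity), ← ENNReal.ofReal_mul (by positivity)]
        congr 1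
        field_simp
        ring

end WeakCaccioppoli

section NontangentialEstimates

variable {n : ℕ}

lemma dist_le_eudist (x y : Fin n → ℝ) : dist x y ≤ eudist x y := by
  refine (dist_pi_le_iff (Real.sqrt_nonneg _)).2 fun i => ?_
  rw [Real.dist_eq, ← Real.sqrt_sq_eq_abs]
  exact Real.sqrt_le_sqrt (Finset.single_le_sum (f := fun j => (x j - y j) ^ 2)
    (fun j _ => sq_nonneg _) (Finset.mem_univ i))

lemma eudist_le (x y : Fin n → ℝ) : eudist x y ≤ (n + 1) * dist x y := by
  refine Real.sqrt_le_iff.2 ⟨by positivity, ?_⟩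
  have h : ∑ i, (x i - y i) ^ 2 ≤ ∑ _i : Fin n, dist x y ^ 2 :=
    Finset.sum_le_sum fun i _ => by
      rw [← sq_abs, ← Real.dist_eq]
      exact pow_le_pow_left₀ dist_nonneg (dist_le_pi_dist x y i) 2
  refine h.trans ?_
  rw [Finset.sum_const, Finset.card_univ, Fintype.card_fin, nsmul_eq_mul, mul_pow]
  gcongr
  nlinarith [(Nat.cast_nonneg n : (0 : ℝ) ≤ n)]

lemma continuous_eudist : Continuous fun q : (Fin n → ℝ) × (Fin n → ℝ) => eudist q.1 q.2 := by
  unfold eudist; fun_prop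

lemma measurable_eudist {α : Type*} [MeasurableSpace α] {f g : α → Fin n → ℝ}
    (hf : Measurable f) (hg : Measurable g) : Measurable fun a => eudist (f a) (g a) :=
  continuous_eudist.measurable.comp (hf.prodMk hg)

lemma measurableSet_euclidean_ball (y : Fin n → ℝ) (s r : ℝ) : MeasurableSet (eball y s r) :=
  measurableSet_lt (((measurable_eudist measurable_fst measurable_const).pow_const 2).add
    ((measurable_snd.sub_const s).pow_const 2)) measurable_const

lemma measurable_ntMaxStar (F : Pt n → ℝ≥0∞) : Measurable (ntMaxStar F) := by
  refine LowerSemicontinuous.measurable ?_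
  refine lowerSemicontinuous_iSup fun y => lowerSemicontinuous_iSup fun s => ?_
  have ho : IsOpen {x : Fin n → ℝ | s ≠ 0 ∧ eudist x y < |s|} := by
    by_cases hs : s = 0
    · simp [hs]
    · simp only [ne_eq, hs, not_false_eq_true, true_and]
      exact isOpen_lt (continuous_eudist.comp (continuous_id.prodMk continuous_const))
        continuous_const
  convert ho.lowerSemicontinuous_indicator
    (zero_le (a := (avgE F (eball y s (|s| / 2))) ^ (1/2 : ℝ))) using 2 with x
  by_cases hx : s ≠ 0 ∧ eudist x y < |s|
  · rw [iSup_pos hx, Set.indicator_of_mem (by exact hx)]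
  · rw [iSup_neg hx, Set.indicator_of_notMem (by exact hx)]; rfl

lemma volume_ball_pi (y : Fin n → ℝ) {r : ℝ} (hr : 0 < r) :
    volume (Metric.ball y r) = ENNReal.ofReal (2 * r) ^ n := by
  rw [Real.volume_pi_ball y hr, Fintype.card_fin, ENNReal.ofReal_pow (by positivity)]

lemma volume_ball_prod (q : Pt n) {r : ℝ} (hr : 0 < r) :
    volume (Metric.ball q r) = ENNReal.ofReal (2 * r) ^ (n + 1) := by
  rw [← Prod.mk.eta (p := q), ← ball_prod_same, Measure.volume_eq_prod, Measure.prod_prod,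
    volume_ball_pi _ hr, Real.volume_ball, pow_succ]

lemma lusin_sq (F : Pt n → ℝ≥0∞) (x : Fin n → ℝ) : lusin F x ^ 2 =
    ∫⁻ p in {p : Pt n | 0 < p.2 ∧ eudist x p.1 < p.2},
      F p * ENNReal.ofReal (p.2 ^ ((1 : ℝ) - n)) := by
  rw [lusin, ← ENNReal.rpow_natCast, ← ENNReal.rpow_mul]; norm_num

lemma ofReal_rpow_mul_pow {t : ℝ} (ht : 0 < t) :
    ENNReal.ofReal (t ^ ((1 : ℝ) - n)) * ENNReal.ofReal t ^ n = ENNReal.ofReal t := by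
  rw [← ENNReal.ofReal_pow ht.le, ← ENNReal.ofReal_mul (by positivity), ← Real.rpow_natCast,
    ← Real.rpow_add ht]
  norm_num

lemma measurableSet_cone : MeasurableSet
    {q : (Fin n → ℝ) × Pt n | 0 < q.2.2 ∧ eudist q.1 q.2.1 < q.2.2} :=
  (measurableSet_lt measurable_const measurable_snd.snd).inter
    (measurableSet_lt (measurable_eudist measurable_fst measurable_snd.fst) measurable_snd.snd)

/-- The weighted integral over the upper half space is controlled by the area integral. -/
lemma lintegral_mul_le_lusin {F : Pt n → ℝ≥0∞} (hF : Measurable F) :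
    ENNReal.ofReal (2 / (n + 1)) ^ n * ∫⁻ p in {p : Pt n | 0 < p.2}, F p * ENNReal.ofReal p.2 ≤
      ∫⁻ x, lusin F x ^ 2 := by
  have hT : Measurable fun q : (Fin n → ℝ) × Pt n =>
      {q : (Fin n → ℝ) × Pt n | 0 < q.2.2 ∧ eudist q.1 q.2.1 < q.2.2}.indicator
        (fun q => F q.2 * ENNReal.ofReal (q.2.2 ^ ((1 : ℝ) - n))) q :=
    Measurable.indicator (by fun_prop) measurableSet_cone
  have h1 : ∀ x, lusin F x ^ 2 = ∫⁻ p : Pt n,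
      {q : (Fin n → ℝ) × Pt n | 0 < q.2.2 ∧ eudist q.1 q.2.1 < q.2.2}.indicator
        (fun q => F q.2 * ENNReal.ofReal (q.2.2 ^ ((1 : ℝ) - n))) (x, p) := fun x => by
    rw [lusin_sq]
    exact (lintegral_indicator (measurable_prodMk_left (x := x) measurableSet_cone) _).symm
  simp only [h1]
  rw [lintegral_lintegral_swap hT.aemeasurable, ← lintegral_const_mul' _ _ (by simp),
    ← lintegral_indicator (measurableSet_lt measurable_const measurable_snd)]
  refine lintegral_mono fun p => ?_
  refine Set.indicator_apply_le' (fun hp => ?_) fun _ => zero_le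
  replace hp : 0 < p.2 := hp
  have hr : 0 < p.2 / (n + 1) := by positivity
  calc ENNReal.ofReal (2 / (n + 1)) ^ n * (F p * ENNReal.ofReal p.2)
      = ∫⁻ x in Metric.ball p.1 (p.2 / (n + 1)),
          F p * ENNReal.ofReal (p.2 ^ ((1 : ℝ) - n)) := by
        rw [lintegral_const, Measure.restrict_apply_univ, volume_ball_pi _ hr,
          show 2 * (p.2 / (n + 1)) = 2 / (n + 1) * p.2 by ring,
          ENNReal.ofReal_mul (by positivity), mul_pow]
        conv_lhs => rw [← ofReal_rpow_mul_pow (n := n) hp]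
        ring
    _ ≤ _ := by
        rw [← lintegral_indicator measurableSet_ball]
        refine lintegral_mono fun x => Set.indicator_apply_le' (fun hx => ?_) fun _ => zero_le
        rw [Set.indicator_of_mem]
        refine ⟨hp, (eudist_le _ _).trans_lt ?_⟩
        rw [Metric.mem_ball, lt_div_iff₀ (by positivity)] at hx
        linarith

lemma avgE_le_ntMaxStar_sq (F : Pt n → ℝ≥0∞) (x : Fin n → ℝ) {s : ℝ} (hs : s ≠ 0) :
    avgE F (eball x s (|s| / 2)) ≤ ntMaxStar F x ^ 2 := by
  have h : (avgE F (eball x s (|s| / 2))) ^ (1 / 2 : ℝ) ≤ ntMaxStar F x :=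
    le_iSup_of_le x <| le_iSup_of_le s <| le_iSup_of_le
      ⟨hs, by simpa [eudist] using hs⟩ le_rfl
  calc avgE F (eball x s (|s| / 2)) = ((avgE F (eball x s (|s| / 2))) ^ (1 / 2 : ℝ)) ^ 2 := by
        rw [← ENNReal.rpow_natCast, ← ENNReal.rpow_mul]; norm_num
    _ ≤ _ := by gcongr

lemma eball_subset_ball (x : Fin n → ℝ) (s : ℝ) {r : ℝ} (hr : 0 < r) :
    eball x s r ⊆ Metric.ball (x, s) r := by
  intro p hp
  have hp : eudist p.1 x ^ 2 + (p.2 - s) ^ 2 < r ^ 2 := hp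
  have h1 : eudist p.1 x < r := by
    refine lt_of_pow_lt_pow_left₀ 2 hr.le ?_
    nlinarith [sq_nonneg (p.2 - s)]
  have h2 : |p.2 - s| < r := by
    refine lt_of_pow_lt_pow_left₀ 2 hr.le ?_
    rw [sq_abs]
    nlinarith [sq_nonneg (eudist p.1 x)]
  rw [Metric.mem_ball, Prod.dist_eq, max_lt_iff, Real.dist_eq]
  exact ⟨(dist_le_eudist _ _).trans_lt h1, h2⟩

lemma ball_subset_eball (x : Fin n → ℝ) (s : ℝ) {p : Pt n} {r : ℝ}
    (h : (n + 2) * dist p (x, s) < r) : p ∈ eball x s r := by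
  have h1 : eudist p.1 x ≤ (n + 1) * dist p (x, s) :=
    (eudist_le _ _).trans (by gcongr; exact le_max_left _ _)
  have h2 : |p.2 - s| ≤ dist p (x, s) := by rw [← Real.dist_eq]; exact le_max_right _ _
  have h3 : 0 ≤ eudist p.1 x := Real.sqrt_nonneg _
  change eudist p.1 x ^ 2 + (p.2 - s) ^ 2 < r ^ 2
  rw [← sq_abs (p.2 - s)]
  have := abs_nonneg (p.2 - s)
  have h4 : eudist p.1 x + |p.2 - s| < r := by nlinarith
  nlinarith

lemma lintegral_eball_le (F : Pt n → ℝ≥0∞) (x : Fin n → ℝ) {s : ℝ} (hs : s ≠ 0) :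
    ∫⁻ p in eball x s (|s| / 2), F p ≤ ENNReal.ofReal |s| ^ (n + 1) * ntMaxStar F x ^ 2 := by
  have hs' : 0 < |s| := abs_pos.2 hs
  have hv : volume (eball x s (|s| / 2)) ≤ ENNReal.ofReal |s| ^ (n + 1) := by
    refine (measure_mono (eball_subset_ball x s (by positivity))).trans_eq ?_
    rw [volume_ball_prod _ (by positivity), mul_div_cancel₀ _ two_ne_zero]
  have h0 : volume (eball x s (|s| / 2)) ≠ 0 := by
    have hr : 0 < |s| / (4 * (n + 2)) := by positivity
    refine (lt_of_lt_of_le (Metric.measure_ball_pos volume ((x, s) : Pt n) hr)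
      (measure_mono fun p hp => ball_subset_eball x s ?_)).ne'
    rw [Metric.mem_ball, lt_div_iff₀ (by positivity)] at hp
    linarith
  have h := (ENNReal.div_le_iff' h0 (hv.trans_lt (by finiteness)).ne).1
    (avgE_le_ntMaxStar_sq F x hs)
  exact h.trans (by gcongr)

lemma volume_setOf_snd_eq_zero : volume {p : Pt n | p.2 = 0} = 0 := by
  have : {p : Pt n | p.2 = 0} = univ ×ˢ {0} := by ext; simp
  rw [this, Measure.volume_eq_prod, Measure.prod_prod]
  simp

/-- The integral over a ball centred on the boundary is controlled by the nontangential maximal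
function. -/
lemma lintegral_ball_le_ntMaxStar {F : Pt n → ℝ≥0∞} (hF : Measurable F) (c : Fin n → ℝ)
    (r : ℝ) :
    ENNReal.ofReal (1 / (4 * (n + 2))) ^ (n + 1) * ∫⁻ p in Metric.ball (c, 0) r, F p ≤
      ENNReal.ofReal (4 * r) * ∫⁻ x in Metric.ball c (2 * r), ntMaxStar F x ^ 2 := by
  set κ : ℝ := 1 / (4 * (n + 2)) with hκ
  have hκ0 : 0 < κ := by positivity
  have hκn : (n + 2) * κ = 1 / 4 := by rw [hκ]; field_simp
  have hκ4 : κ ≤ 1 / 4 := by nlinarith [(Nat.cast_nonneg n : (0 : ℝ) ≤ n)]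
  let T : Set (Pt n × Pt n) := {w | w.1 ∈ eball w.2.1 w.2.2 (|w.2.2| / 2) ∧
    dist w.2.1 c < 2 * r ∧ |w.2.2| < 2 * r}
  have hT : MeasurableSet T := by
    refine MeasurableSet.inter ?_ (MeasurableSet.inter ?_ ?_)
    · exact measurableSet_lt (((measurable_eudist (by fun_prop) (by fun_prop)).pow_const 2).add
        (by fun_prop)) (by fun_prop)
    · exact measurableSet_lt (f := fun w : Pt n × Pt n => dist w.2.1 c) (by fun_prop)
        measurable_const
    · exact measurableSet_lt (f := fun w : Pt n × Pt n => |w.2.2|) (by fun_prop)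
        measurable_const
  let K : Pt n × Pt n → ℝ≥0∞ :=
    T.indicator fun w => F w.1 * (ENNReal.ofReal |w.2.2| ^ (n + 1))⁻¹
  have hK : Measurable K := Measurable.indicator (by fun_prop) hT
  calc ENNReal.ofReal κ ^ (n + 1) * ∫⁻ p in Metric.ball (c, 0) r, F p
      ≤ ∫⁻ p, ∫⁻ q, K (p, q) := by
        rw [← lintegral_const_mul _ hF, ← lintegral_indicator measurableSet_ball]
        have hz : ∀ᵐ p : Pt n, p.2 ≠ 0 := by
          rw [ae_iff]; simpa using volume_setOf_snd_eq_zero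
        refine lintegral_mono_ae (hz.mono fun p hp0 => ?_)
        refine Set.indicator_apply_le' (fun hp => ?_) fun _ => zero_le
        have hp0' : 0 < |p.2| := abs_pos.2 hp0
        rw [Metric.mem_ball, Prod.dist_eq, max_lt_iff, Real.dist_eq, sub_zero] at hp
        obtain ⟨hpc, hpr⟩ := hp
        calc ENNReal.ofReal κ ^ (n + 1) * F p
            = ∫⁻ q in Metric.ball p (κ * |p.2|),
                F p * (ENNReal.ofReal (2 * |p.2|) ^ (n + 1))⁻¹ := by
              rw [lintegral_const, Measure.restrict_apply_univ, volume_ball_prod _ (by positivity),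
                show 2 * (κ * |p.2|) = κ * (2 * |p.2|) by ring, ENNReal.ofReal_mul hκ0.le,
                mul_pow, mul_left_comm, mul_assoc (F p), ENNReal.inv_mul_cancel, mul_one]
              · simp [hp0]
              · finiteness
          _ ≤ ∫⁻ q, K (p, q) := by
              rw [← lintegral_indicator measurableSet_ball]
              refine lintegral_mono fun q => Set.indicator_apply_le' (fun hq => ?_)
                fun _ => zero_le
              rw [Metric.mem_ball] at hq
              have hq1 : dist q.1 p.1 < κ * |p.2| := (le_max_left _ _).trans_lt hq
              have hq2 : |q.2 - p.2| < κ * |p.2| := by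
                rw [← Real.dist_eq]; exact (le_max_right _ _).trans_lt hq
              have hq3 : |p.2| - |q.2| ≤ |q.2 - p.2| := by
                rw [abs_sub_comm]; exact abs_sub_abs_le_abs_sub _ _
              have hq4 : |q.2| - |p.2| ≤ |q.2 - p.2| := abs_sub_abs_le_abs_sub _ _
              have hκp : κ * |p.2| ≤ |p.2| / 4 := by nlinarith
              have hmem : (p, q) ∈ T := by
                refine ⟨ball_subset_eball _ _ ?_, ?_, ?_⟩
                · change (n + 2) * dist p q < _
                  rw [dist_comm]
                  have : (n + 2 : ℝ) * dist q p < (n + 2) * (κ * |p.2|) := by gcongr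
                  rw [← mul_assoc, hκn] at this
                  change _ < |q.2| / 2
                  linarith
                · change dist q.1 c < _
                  linarith [dist_triangle q.1 p.1 c]
                · change |q.2| < _
                  linarith
              simp only [K]
              rw [Set.indicator_of_mem hmem]
              gcongr
              change |q.2| ≤ _
              linarith
    _ = ∫⁻ q, ∫⁻ p, K (p, q) := lintegral_lintegral_swap hK.aemeasurable
    _ = ∫⁻ x, ∫⁻ s, ∫⁻ p, K (p, (x, s)) := by
        rw [Measure.volume_eq_prod,
          lintegral_prod _ (hK.lintegral_prod_left').aemeasurable]
    _ ≤ ∫⁻ x in Metric.ball c (2 * r), ENNReal.ofReal (4 * r) * ntMaxStar F x ^ 2 := by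
        rw [← lintegral_indicator measurableSet_ball]
        refine lintegral_mono fun x => ?_
        by_cases hx : x ∈ Metric.ball c (2 * r)
        · rw [Set.indicator_of_mem hx]
          calc ∫⁻ s, ∫⁻ p, K (p, (x, s))
              ≤ ∫⁻ s in Ioo (-(2 * r)) (2 * r), ntMaxStar F x ^ 2 := by
                rw [← lintegral_indicator measurableSet_Ioo]
                refine lintegral_mono fun s => ?_
                by_cases hs : s ≠ 0 ∧ |s| < 2 * r
                · rw [Set.indicator_of_mem (Set.mem_Ioo.2 (abs_lt.1 hs.2))]
                  have hs0 : 0 < |s| := abs_pos.2 hs.1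
                  calc ∫⁻ p, K (p, (x, s))
                      ≤ ∫⁻ p in eball x s (|s| / 2), F p * (ENNReal.ofReal |s| ^ (n + 1))⁻¹ := by
                        rw [← lintegral_indicator (measurableSet_euclidean_ball _ _ _)]
                        refine lintegral_mono fun p => Set.indicator_apply_le' (fun hp => ?_)
                          fun _ => zero_le
                        rw [Set.indicator_of_mem hp.1]
                    _ = (∫⁻ p in eball x s (|s| / 2), F p) *
                          (ENNReal.ofReal |s| ^ (n + 1))⁻¹ := lintegral_mul_const _ hF
                    _ ≤ ENNReal.ofReal |s| ^ (n + 1) * ntMaxStar F x ^ 2 *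
                          (ENNReal.ofReal |s| ^ (n + 1))⁻¹ := by
                        gcongr; exact lintegral_eball_le F x hs.1
                    _ = ntMaxStar F x ^ 2 := by
                        rw [mul_right_comm, ENNReal.mul_inv_cancel, one_mul]
                        · simp [hs.1]
                        · finiteness
                · have : ∀ p, K (p, (x, s)) = 0 := fun p => by
                    refine Set.indicator_of_notMem (fun hp => hs ⟨?_, hp.2.2⟩) _
                    rintro rfl
                    have h := hp.1
                    simp only [eball, Set.mem_ofPred_eq, abs_zero, zero_div] at h
                    nlinarith [sq_nonneg (eudist p.1 x), sq_nonneg (p.2 - 0)]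
                  simp [this]
            _ = ENNReal.ofReal (4 * r) * ntMaxStar F x ^ 2 := by
                rw [lintegral_const, Measure.restrict_apply_univ, Real.volume_Ioo, mul_comm]
                congr 2; ring
        · have : ∀ p s, K (p, (x, s)) = 0 := fun p s =>
            Set.indicator_of_notMem (fun hp => hx hp.2.1) _
          simp [this]
    _ = _ := lintegral_const_mul' _ _ ENNReal.ofReal_ne_top

end NontangentialEstimates

section CarlesonEstimate

variable {n : ℕ}

lemma cube_eq_ball (c : Fin n → ℝ) {ℓ : ℝ} (hℓ : 0 < ℓ) : cube c ℓ = Metric.ball c (ℓ / 2) := by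
  ext x
  rw [Metric.mem_ball, dist_pi_lt_iff (by positivity)]
  rfl

lemma gradSq_le_sub_add (k : ℕ) (du dv : (Fin (n + 1) → ℕ) → Pt n → ℂ) (p : Pt n) :
    gradSq k du p ≤ 2 * gradSq k (fun γ p => du γ p - dv γ p) p + 2 * gradSq k dv p := by
  simp only [gradSq, Finset.mul_sum, ← Finset.sum_add_distrib]
  refine Finset.sum_le_sum fun γ _ => ?_
  have := enorm_add_sq_le (du γ p - dv γ p) (dv γ p)
  rwa [sub_add_cancel] at this

lemma gradSq_sub_le (k : ℕ) (du dv : (Fin (n + 1) → ℕ) → Pt n → ℂ) (p : Pt n) :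
    gradSq k (fun γ p => du γ p - dv γ p) p ≤ 2 * gradSq k du p + 2 * gradSq k dv p := by
  simp only [gradSq, Finset.mul_sum, ← Finset.sum_add_distrib]
  refine Finset.sum_le_sum fun γ _ => ?_
  have := enorm_add_sq_le (du γ p) (-dv γ p)
  rwa [← sub_eq_add_neg, enorm_neg] at this

lemma measurable_gradSq {k m : ℕ} (hk : k ≤ m) {du : (Fin (n + 1) → ℕ) → Pt n → ℂ}
    (h : ∀ γ : Fin (n + 1) → ℕ, ∑ i, γ i ≤ m → Measurable (du γ)) : Measurable (gradSq k du) :=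
  Finset.measurable_fun_sum _ fun γ hγ =>
    ((h γ ((mem_MI.1 hγ).trans_le hk)).enorm.pow_const 2)

/-- The Carleson measure estimate for `t |∇^m u|²`. -/
lemma exists_carleson (n m : ℕ) (hm : 1 ≤ m) (lam Λ : ℝ) (hlam : 0 < lam) :
    ∃ C : ℝ≥0∞, C ≠ ⊤ ∧ ∀ A : Coef n, CoefMeasurable A → CoefBounded m A Λ → Garding m A lam →
      ∀ (u : Pt n → ℂ) (du : (Fin (n + 1) → ℕ) → Pt n → ℂ),
        HasWDerivs {p : Pt n | p.2 ≠ 0} m u du →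
      ∀ ψ : (Fin n → ℝ) → ℝ≥0∞, Measurable ψ → ∀ (c : Fin n → ℝ) (r : ℝ), 0 < r →
      (∃ (uQ : Pt n → ℂ) (duQ : (Fin (n + 1) → ℕ) → Pt n → ℂ),
        HasWDerivs {p : Pt n | p.2 ≠ 0} m uQ duQ ∧
        (∀ γ : Fin (n + 1) → ℕ, (∑ i, γ i) ≤ m →
          (∫⁻ p in (cube c (3 * (4 * r))) ×ˢ Ioo (-(4 * r)) (4 * r),
              (‖du γ p - duQ γ p‖₊ : ℝ≥0∞) ^ 2) < ⊤ ∧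
          IsWeakDeriv ((cube c (3 * (4 * r))) ×ˢ Ioo (-(4 * r)) (4 * r)) γ
            (fun p => u p - uQ p) (fun p => du γ p - duQ γ p)) ∧
        WeakSolution m A ((cube c (3 * (4 * r))) ×ˢ Ioo (-(4 * r)) (4 * r))
          (fun β p => du β p - duQ β p) ∧
        (∫⁻ x, (lusin (gradSq m duQ) x) ^ 2) +
            (∫⁻ x, (ntMaxStar (gradSq (m - 1) duQ) x) ^ 2) ≤
          ∫⁻ x in cube c (4 * (4 * r)), ψ x ^ 2) →
      ∫⁻ p in Metric.ball c r ×ˢ Ioo 0 r, gradSq m du p * ENNReal.ofReal p.2 ≤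
        C * ∫⁻ x in Metric.ball c (8 * r),
          (ntMaxStar (gradSq (m - 1) du) x ^ 2 + ψ x ^ 2) := by
  obtain ⟨C, hC, hcac⟩ := exists_caccioppoli n m hm lam Λ hlam
  set K : ℝ≥0∞ := ENNReal.ofReal (1 / (4 * (n + 2))) ^ (n + 1) with hK
  set K' : ℝ≥0∞ := ENNReal.ofReal (2 / (n + 1)) ^ n with hK'
  have hK0 : K ≠ 0 := by rw [hK]; exact pow_ne_zero _ (ENNReal.ofReal_pos.2 (by positivity)).ne'
  have hK'0 : K' ≠ 0 := by rw [hK']; exact pow_ne_zero _ (ENNReal.ofReal_pos.2 (by positivity)).ne'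
  have hKt : K ≠ ⊤ := by rw [hK]; finiteness
  have hK't : K' ≠ ⊤ := by rw [hK']; finiteness
  refine ⟨2 * (C * K⁻¹) + 2 * K'⁻¹, by finiteness, ?_⟩
  rintro A hAm hAb hAg u du hu ψ hψ c r hr ⟨uQ, duQ, huQ, hfin, hsol, hbound⟩
  set N := ntMaxStar (gradSq (m - 1) du)
  set dw : (Fin (n + 1) → ℕ) → Pt n → ℂ := fun γ p => du γ p - duQ γ p with hdw
  set Ω : Set (Pt n) := (cube c (3 * (4 * r))) ×ˢ Ioo (-(4 * r)) (4 * r) with hΩ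
  have hΩm : MeasurableSet Ω := by
    rw [hΩ, cube_eq_ball c (by positivity)]
    exact measurableSet_ball.prod measurableSet_Ioo
  have hsub : Metric.ball ((c, 0) : Pt n) (4 * r) ⊆ Ω := by
    rw [hΩ, cube_eq_ball c (by positivity), ← ball_prod_same, Real.ball_eq_Ioo]
    refine Set.prod_mono (Metric.ball_subset_ball (by linarith)) ?_
    rw [zero_sub, zero_add]
  have hdwm : ∀ γ : Fin (n + 1) → ℕ, ∑ i, γ i ≤ m → Measurable (dw γ) := fun γ hγ =>
    (hu.2 γ hγ).1.sub (huQ.2 γ hγ).1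
  have hmu := fun γ hγ => (hu.2 γ hγ).1
  have hmuQ := fun γ hγ => (huQ.2 γ hγ).1
  have hψN : ∫⁻ x, ntMaxStar (gradSq (m - 1) duQ) x ^ 2 ≤
      ∫⁻ x in Metric.ball c (8 * r), ψ x ^ 2 := by
    refine (le_add_self.trans hbound).trans_eq ?_
    rw [cube_eq_ball c (by positivity)]; congr 3; ring
  have hψS : ∫⁻ x, lusin (gradSq m duQ) x ^ 2 ≤
      ∫⁻ x in Metric.ball c (8 * r), ψ x ^ 2 := by
    refine (le_self_add.trans hbound).trans_eq ?_
    rw [cube_eq_ball c (by positivity)]; congr 3; ring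
  set b : ℝ≥0∞ := ∫⁻ x in Metric.ball c (8 * r), (N x ^ 2 + ψ x ^ 2) with hb
  have hbadd : b = (∫⁻ x in Metric.ball c (8 * r), N x ^ 2) +
      ∫⁻ x in Metric.ball c (8 * r), ψ x ^ 2 := lintegral_add_right _ (by fun_prop)
  have hlow : ∫⁻ p in Metric.ball ((c, 0) : Pt n) (2 * r), gradSq (m - 1) dw p ≤
      2 * (K⁻¹ * (ENNReal.ofReal (8 * r) * b)) := by
    have haux : ∀ dv : (Fin (n + 1) → ℕ) → Pt n → ℂ,
        (∀ γ : Fin (n + 1) → ℕ, ∑ i, γ i ≤ m → Measurable (dv γ)) →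
        ∫⁻ p in Metric.ball ((c, 0) : Pt n) (2 * r), gradSq (m - 1) dv p ≤
          K⁻¹ * (ENNReal.ofReal (8 * r) *
            ∫⁻ x in Metric.ball c (8 * r), ntMaxStar (gradSq (m - 1) dv) x ^ 2) := by
      intro dv hdv
      rw [← ENNReal.mul_le_iff_le_inv hK0 hKt]
      refine (lintegral_ball_le_ntMaxStar (measurable_gradSq (Nat.sub_le m 1) hdv) c
        (2 * r)).trans ?_
      rw [show 4 * (2 * r) = 8 * r by ring]
      gcongr _ * ?_
      exact lintegral_mono_set (Metric.ball_subset_ball (by linarith))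
    calc ∫⁻ p in Metric.ball ((c, 0) : Pt n) (2 * r), gradSq (m - 1) dw p
        ≤ ∫⁻ p in Metric.ball ((c, 0) : Pt n) (2 * r),
            (2 * gradSq (m - 1) du p + 2 * gradSq (m - 1) duQ p) :=
          lintegral_mono fun p => gradSq_sub_le _ _ _ _
      _ = 2 * (∫⁻ p in Metric.ball ((c, 0) : Pt n) (2 * r), gradSq (m - 1) du p) +
            2 * ∫⁻ p in Metric.ball ((c, 0) : Pt n) (2 * r), gradSq (m - 1) duQ p := by
          rw [lintegral_add_left ((measurable_gradSq (Nat.sub_le m 1) hmu).const_mul 2),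
            lintegral_const_mul _ (measurable_gradSq (Nat.sub_le m 1) hmu),
            lintegral_const_mul _ (measurable_gradSq (Nat.sub_le m 1) hmuQ)]
      _ ≤ 2 * (K⁻¹ * (ENNReal.ofReal (8 * r) * ∫⁻ x in Metric.ball c (8 * r), N x ^ 2)) +
            2 * (K⁻¹ * (ENNReal.ofReal (8 * r) * ∫⁻ x in Metric.ball c (8 * r), ψ x ^ 2)) := by
          gcongr
          · exact haux du hmu
          · refine (haux duQ hmuQ).trans ?_
            gcongr _ * (_ * ?_)
            exact (setLIntegral_le_lintegral _ _).trans hψN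
      _ = _ := by rw [hbadd]; ring
  have hbox : Metric.ball c r ×ˢ Ioo 0 r ⊆ Metric.ball ((c, 0) : Pt n) (4 * r / 4) := by
    rw [← ball_prod_same, Real.ball_eq_Ioo, mul_div_cancel_left₀ r four_ne_zero]
    exact Set.prod_mono le_rfl (Ioo_subset_Ioo (by linarith) (by linarith))
  have hboxm : MeasurableSet (Metric.ball c r ×ˢ Ioo (0 : ℝ) r) :=
    measurableSet_ball.prod measurableSet_Ioo
  have hw : ∫⁻ p in Metric.ball c r ×ˢ Ioo 0 r, gradSq m dw p * ENNReal.ofReal p.2 ≤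
      C * K⁻¹ * b := by
    calc ∫⁻ p in Metric.ball c r ×ˢ Ioo 0 r, gradSq m dw p * ENNReal.ofReal p.2
        ≤ ∫⁻ p in Metric.ball c r ×ˢ Ioo 0 r, gradSq m dw p * ENNReal.ofReal r :=
          setLIntegral_mono' hboxm fun p hp => by gcongr; exact hp.2.2.le
      _ = (∫⁻ p in Metric.ball c r ×ˢ Ioo 0 r, gradSq m dw p) * ENNReal.ofReal r :=
          lintegral_mul_const' _ _ ENNReal.ofReal_ne_top
      _ ≤ (∫⁻ p in Metric.ball ((c, 0) : Pt n) (4 * r / 4), gradSq m dw p) *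
            ENNReal.ofReal r := by gcongr
      _ ≤ (C * ENNReal.ofReal ((4 * r)⁻¹ ^ 2) *
            ∫⁻ p in Metric.ball ((c, 0) : Pt n) (4 * r / 2), gradSq (m - 1) dw p) *
              ENNReal.ofReal r := by
          gcongr
          refine hcac A hAm hAb hAg Ω hΩm (c, 0) (4 * r) (by positivity) hsub
            (fun p => u p - uQ p) dw ?_ hdwm (fun γ hγ => ?_) (fun γ hγ => (hfin γ hγ).2) hsol
          · funext p
            change du (fun _ => 0) p - duQ (fun _ => 0) p = _
            rw [hu.1, huQ.1]
          · exact (lintegral_mono_set hsub).trans_lt (hfin γ hγ).1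
      _ ≤ (C * ENNReal.ofReal ((4 * r)⁻¹ ^ 2) *
            (2 * (K⁻¹ * (ENNReal.ofReal (8 * r) * b)))) * ENNReal.ofReal r := by
          rw [show 4 * r / 2 = 2 * r by ring]; gcongr
      _ = C * K⁻¹ * b * (2 * ENNReal.ofReal ((4 * r)⁻¹ ^ 2) * ENNReal.ofReal (8 * r) *
            ENNReal.ofReal r) := by ring
      _ = C * K⁻¹ * b := by
          rw [← ENNReal.ofReal_ofNat 2, ← ENNReal.ofReal_mul (by positivity),
            ← ENNReal.ofReal_mul (by positivity), ← ENNReal.ofReal_mul (by positivity)]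
          have : 2 * (4 * r)⁻¹ ^ 2 * (8 * r) * r = 1 := by field_simp; norm_num
          rw [this, ENNReal.ofReal_one, mul_one]
  have hq : ∫⁻ p in Metric.ball c r ×ˢ Ioo 0 r, gradSq m duQ p * ENNReal.ofReal p.2 ≤
      K'⁻¹ * b := by
    rw [← ENNReal.mul_le_iff_le_inv hK'0 hK't]
    refine le_trans ?_ ((lintegral_mul_le_lusin (measurable_gradSq le_rfl hmuQ)).trans
      (hψS.trans ?_))
    · gcongr
      exact fun p hp => hp.2.1
    · rw [hbadd]; exact le_add_self
  calc ∫⁻ p in Metric.ball c r ×ˢ Ioo 0 r, gradSq m du p * ENNReal.ofReal p.2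
      ≤ ∫⁻ p in Metric.ball c r ×ˢ Ioo 0 r, (2 * (gradSq m dw p * ENNReal.ofReal p.2) +
          2 * (gradSq m duQ p * ENNReal.ofReal p.2)) := by
        refine lintegral_mono fun p => ?_
        calc gradSq m du p * ENNReal.ofReal p.2
            ≤ (2 * gradSq m dw p + 2 * gradSq m duQ p) * ENNReal.ofReal p.2 := by
              gcongr; exact gradSq_le_sub_add _ _ _ _
          _ = _ := by ring
    _ = 2 * (∫⁻ p in Metric.ball c r ×ˢ Ioo 0 r, gradSq m dw p * ENNReal.ofReal p.2) +
          2 * ∫⁻ p in Metric.ball c r ×ˢ Ioo 0 r, gradSq m duQ p * ENNReal.ofReal p.2 := by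
        have h1 := measurable_gradSq le_rfl hdwm
        have h2 := measurable_gradSq le_rfl hmuQ
        rw [lintegral_add_left (by fun_prop), lintegral_const_mul _ (by fun_prop),
          lintegral_const_mul _ (by fun_prop)]
    _ ≤ 2 * (C * K⁻¹ * b) + 2 * (K'⁻¹ * b) := by gcongr
    _ = _ := by ring

end CarlesonEstimate

section MaximalFunction

variable {n : ℕ}

lemma measure_iUnion_le_of_vitali_of_le {α : Type*} [MeasurableSpace α] {μ : Measure α}
    {T : Set (Pt n)} (hT : ∀ q ∈ T, 0 < q.2) {R : ℝ} (hR : ∀ q ∈ T, q.2 ≤ R)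
    {E D : Pt n → Set α} {f : (Fin n → ℝ) → ℝ≥0∞}
    (hE : ∀ q ∈ T, ∀ q' ∈ T, dist q.1 q'.1 < q.2 + q'.2 → q.2 ≤ 2 * q'.2 → E q ⊆ D q')
    (hD : ∀ q ∈ T, μ (D q) ≤ ∫⁻ x in Metric.ball q.1 q.2, f x) :
    μ (⋃ q ∈ T, E q) ≤ ∫⁻ x in ⋃ q ∈ T, Metric.ball q.1 q.2, f x := by
  obtain ⟨s, hsT, hdisj, hcov⟩ := Vitali.exists_disjoint_subfamily_covering_enlargement
    (fun q : Pt n => Metric.ball q.1 q.2) T (fun q => q.2) 2 one_lt_two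
    (fun q hq => (hT q hq).le) R hR (fun q hq => Metric.nonempty_ball.2 (hT q hq))
  have hs : s.Countable := hdisj.countable_of_isOpen (fun _ _ => Metric.isOpen_ball)
    fun q hq => Metric.nonempty_ball.2 (hT q (hsT hq))
  have hsub : ⋃ q ∈ T, E q ⊆ ⋃ q ∈ s, D q := by
    refine iUnion₂_subset fun q hq => ?_
    obtain ⟨q', hq', ⟨x, hx, hx'⟩, hle⟩ := hcov q hq
    refine (hE q hq q' (hsT hq') ?_ hle).trans (subset_biUnion_of_mem (u := D) hq')
    rw [Metric.mem_ball, dist_comm] at hx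
    rw [Metric.mem_ball] at hx'
    linarith [dist_triangle q.1 x q'.1]
  calc μ (⋃ q ∈ T, E q) ≤ μ (⋃ q ∈ s, D q) := measure_mono hsub
    _ ≤ ∑' q : s, μ (D q) := measure_biUnion_le μ hs D
    _ ≤ ∑' q : s, ∫⁻ x in Metric.ball q.1.1 q.1.2, f x :=
        ENNReal.tsum_le_tsum fun q => hD q (hsT q.2)
    _ = ∫⁻ x in ⋃ q ∈ s, Metric.ball q.1 q.2, f x :=
        (lintegral_biUnion hs (fun _ _ => measurableSet_ball) hdisj f).symm
    _ ≤ _ := lintegral_mono_set (biUnion_subset_biUnion_left hsT)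

/-- A covering principle: local bounds for `μ` on enlarged sets add up along a Vitali subfamily. -/
lemma measure_iUnion_le_of_vitali {α : Type*} [MeasurableSpace α] {μ : Measure α}
    {T : Set (Pt n)} (hT : ∀ q ∈ T, 0 < q.2)
    {E D : Pt n → Set α} {f : (Fin n → ℝ) → ℝ≥0∞}
    (hE : ∀ q ∈ T, ∀ q' ∈ T, dist q.1 q'.1 < q.2 + q'.2 → q.2 ≤ 2 * q'.2 → E q ⊆ D q')
    (hD : ∀ q ∈ T, μ (D q) ≤ ∫⁻ x in Metric.ball q.1 q.2, f x) :
    μ (⋃ q ∈ T, E q) ≤ ∫⁻ x in ⋃ q ∈ T, Metric.ball q.1 q.2, f x := by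
  let T' : ℕ → Set (Pt n) := fun k => {q ∈ T | q.2 ≤ k}
  have hT' : ∀ k, T' k ⊆ T := fun k q hq => hq.1
  have hU : ⋃ q ∈ T, E q = ⋃ k, ⋃ q ∈ T' k, E q := by
    refine subset_antisymm (iUnion₂_subset fun q hq => ?_)
      (iUnion_subset fun k => biUnion_subset_biUnion_left (hT' k))
    obtain ⟨k, hk⟩ := exists_nat_ge q.2
    exact (subset_biUnion_of_mem (u := E) (show q ∈ T' k from ⟨hq, hk⟩)).trans
      (subset_iUnion (fun k => ⋃ q ∈ T' k, E q) k)
  have hmono : Monotone fun k => ⋃ q ∈ T' k, E q := fun k l hkl =>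
    biUnion_subset_biUnion_left fun q hq => ⟨hq.1, hq.2.trans (by exact_mod_cast hkl)⟩
  rw [hU, hmono.measure_iUnion]
  refine iSup_le fun k => ?_
  refine (measure_iUnion_le_of_vitali_of_le (T := T' k) (fun q hq => hT q hq.1) (fun q hq => hq.2)
    (fun q hq q' hq' => hE q hq.1 q' hq'.1) fun q hq => hD q hq.1).trans ?_
  exact lintegral_mono_set (biUnion_subset_biUnion_left (hT' k))

/-- The uncentred Hardy-Littlewood maximal function. -/
def maxFn (f : (Fin n → ℝ) → ℝ≥0∞) (x : Fin n → ℝ) : ℝ≥0∞ :=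
  ⨆ (q : Pt n) (_ : dist x q.1 < q.2),
    (∫⁻ y in Metric.ball q.1 q.2, f y) / volume (Metric.ball q.1 q.2)

lemma le_maxFn (f : (Fin n → ℝ) → ℝ≥0∞) {x : Fin n → ℝ} {q : Pt n} (h : dist x q.1 < q.2) :
    (∫⁻ y in Metric.ball q.1 q.2, f y) / volume (Metric.ball q.1 q.2) ≤ maxFn f x :=
  le_iSup₂_of_le q h le_rfl

lemma measurable_maxFn (f : (Fin n → ℝ) → ℝ≥0∞) : Measurable (maxFn f) := by
  refine LowerSemicontinuous.measurable (lowerSemicontinuous_iSup fun q => ?_)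
  have h := (Metric.isOpen_ball (x := q.1) (ε := q.2)).lowerSemicontinuous_indicator
    (zero_le (a := (∫⁻ y in Metric.ball q.1 q.2, f y) / volume (Metric.ball q.1 q.2)))
  suffices he : (fun x => ⨆ (_ : dist x q.1 < q.2),
      (∫⁻ y in Metric.ball q.1 q.2, f y) / volume (Metric.ball q.1 q.2)) =
      (Metric.ball q.1 q.2).indicator fun _ =>
        (∫⁻ y in Metric.ball q.1 q.2, f y) / volume (Metric.ball q.1 q.2) by rwa [he]
  funext x
  by_cases hx : dist x q.1 < q.2
  · rw [iSup_pos hx, Set.indicator_of_mem (by exact hx)]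
  · rw [iSup_neg hx, Set.indicator_of_notMem (by exact hx), bot_eq_zero]

lemma setOf_lt_maxFn (f : (Fin n → ℝ) → ℝ≥0∞) (a : ℝ≥0∞) :
    {x | a < maxFn f x} = ⋃ q ∈ {q : Pt n | 0 < q.2 ∧
      a < (∫⁻ y in Metric.ball q.1 q.2, f y) / volume (Metric.ball q.1 q.2)},
      Metric.ball q.1 q.2 := by
  ext x
  simp only [maxFn, lt_iSup_iff, Set.mem_ofPred_eq, mem_iUnion, Metric.mem_ball, exists_prop]
  refine exists_congr fun q => ⟨fun h => ⟨⟨dist_nonneg.trans_lt h.1, h.2⟩, h.1⟩, fun h =>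
    ⟨h.2, h.1.2⟩⟩

lemma volume_ball_mul (y : Fin n → ℝ) {r a : ℝ} (hr : 0 < r) (ha : 0 < a) :
    volume (Metric.ball y (a * r)) = ENNReal.ofReal a ^ n * volume (Metric.ball y r) := by
  rw [volume_ball_pi y (by positivity), volume_ball_pi y hr, show 2 * (a * r) = a * (2 * r) by ring,
    ENNReal.ofReal_mul ha.le, mul_pow]

/-- The weak type inequality for the maximal function. -/
lemma measure_lt_maxFn_le (f : (Fin n → ℝ) → ℝ≥0∞) {a : ℝ≥0∞} (ha : a ≠ 0) (ha' : a ≠ ⊤) :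
    volume {x | a < maxFn f x} ≤ ENNReal.ofReal 5 ^ n * a⁻¹ * ∫⁻ x, f x := by
  rw [setOf_lt_maxFn]
  refine (measure_iUnion_le_of_vitali (fun q hq => hq.1)
    (D := fun q => Metric.ball q.1 (5 * q.2))
    (f := fun x => ENNReal.ofReal 5 ^ n * a⁻¹ * f x) (fun q hq q' hq' hd hle => ?_)
    fun q hq => ?_).trans ?_
  · exact Metric.ball_subset_ball' (by linarith)
  · rw [volume_ball_mul _ hq.1 (by norm_num), lintegral_const_mul' _ _ (by finiteness), mul_assoc]
    gcongr
    rw [← ENNReal.mul_le_iff_le_inv ha ha']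
    exact ENNReal.mul_le_of_le_div hq.2.le
  · rw [lintegral_const_mul' _ _ (by finiteness)]
    gcongr _ * ?_
    exact setLIntegral_le_lintegral _ _

lemma lintegral_ball_le_lintegral_maxFn (f : (Fin n → ℝ) → ℝ≥0∞) (y : Fin n → ℝ) {r a : ℝ}
    (hr : 0 < r) (ha : 1 ≤ a) :
    ∫⁻ x in Metric.ball y (a * r), f x ≤
      ENNReal.ofReal a ^ n * ∫⁻ x in Metric.ball y r, maxFn f x := by
  have h0 : volume (Metric.ball y r) ≠ 0 := (Metric.measure_ball_pos _ _ hr).ne'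
  have ht : volume (Metric.ball y r) ≠ ⊤ := measure_ball_lt_top.ne
  have hb0 : volume (Metric.ball y (a * r)) ≠ 0 :=
    (Metric.measure_ball_pos _ _ (by positivity)).ne'
  have hbt : volume (Metric.ball y (a * r)) ≠ ⊤ := measure_ball_lt_top.ne
  set b := (∫⁻ x in Metric.ball y (a * r), f x) / volume (Metric.ball y (a * r)) with hb
  calc ∫⁻ x in Metric.ball y (a * r), f x = b * volume (Metric.ball y (a * r)) :=
        (ENNReal.div_mul_cancel hb0 hbt).symm
    _ = ENNReal.ofReal a ^ n * ∫⁻ x in Metric.ball y r, b := by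
        rw [volume_ball_mul y hr (by linarith), lintegral_const, Measure.restrict_apply_univ]; ring
    _ ≤ _ := by
        gcongr _ * ?_
        refine setLIntegral_mono' measurableSet_ball fun x hx => ?_
        refine le_maxFn f (q := (y, a * r)) ?_
        rw [Metric.mem_ball] at hx
        exact hx.trans_le (by nlinarith)

/-- A Carleson type bound for the measure of a set in the half space by the maximal function. -/
lemma measure_le_lintegral_maxFn {μ : Measure (Pt n)} {b : (Fin n → ℝ) → ℝ≥0∞} {C : ℝ≥0∞}
    (hC : C ≠ ⊤) (hμ : ∀ (c : Fin n → ℝ) (r : ℝ), 0 < r →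
      μ (Metric.ball c r ×ˢ Ioo 0 r) ≤ C * ∫⁻ x in Metric.ball c (8 * r), b x)
    {T : Set (Pt n)} (hT : ∀ q ∈ T, 0 < q.2) :
    μ T ≤ C * ENNReal.ofReal 32 ^ n * ∫⁻ x in ⋃ q ∈ T, Metric.ball q.1 q.2, maxFn b x := by
  rw [← lintegral_const_mul' _ _ (by finiteness)]
  conv_lhs => rw [← biUnion_of_singleton T]
  refine measure_iUnion_le_of_vitali hT
    (D := fun q => Metric.ball q.1 (4 * q.2) ×ˢ Ioo 0 (4 * q.2))
    (fun q hq q' hq' hd hle => ?_) fun q hq => ?_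
  · have := hT q hq
    have := hT q' hq'
    rw [Set.singleton_subset_iff]
    exact ⟨by rw [Metric.mem_ball]; linarith, by assumption, by linarith⟩
  · have := hT q hq
    refine (hμ _ _ (by positivity)).trans ?_
    rw [lintegral_const_mul' _ _ (by finiteness), mul_assoc,
      show 8 * (4 * q.2) = 32 * q.2 by ring]
    gcongr
    exact lintegral_ball_le_lintegral_maxFn b q.1 this (by norm_num)

end MaximalFunction

section MaximalTheorem

variable {n : ℕ}

lemma setLIntegral_Ioo_rpow {a : ℝ} (ha : 0 < a) {y : ℝ} (hy : 0 ≤ y) :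
    ∫⁻ s in Ioo 0 y, ENNReal.ofReal (a * s ^ (a - 1)) = ENNReal.ofReal y ^ a := by
  have hInt : IntervalIntegrable (fun s : ℝ => a * s ^ (a - 1)) volume 0 y :=
    (intervalIntegral.intervalIntegrable_rpow' (by linarith)).const_mul a
  rw [restrict_Ioo_eq_restrict_Ioc, ← ofReal_integral_eq_lintegral_ofReal
    ((intervalIntegrable_iff_integrableOn_Ioc_of_le hy).1 hInt)
    ((ae_restrict_mem measurableSet_Ioc).mono fun s hs => by
      have := hs.1; simp only [Pi.zero_apply]; positivity),
    ← intervalIntegral.integral_of_le hy, intervalIntegral.integral_const_mul,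
    integral_rpow (Or.inl (by linarith)), ENNReal.ofReal_rpow_of_nonneg hy ha.le]
  rw [sub_add_cancel, Real.zero_rpow ha.ne']
  congr 1
  field_simp
  ring

lemma setLIntegral_Ioi_indicator_rpow {a : ℝ} (ha : 0 < a) (y : ℝ≥0∞) :
    ∫⁻ s in Ioi (0 : ℝ), {s : ℝ | ENNReal.ofReal s < y}.indicator
      (fun s => ENNReal.ofReal (a * s ^ (a - 1))) s = y ^ a := by
  have hm : ∀ y : ℝ≥0∞, MeasurableSet {s : ℝ | ENNReal.ofReal s < y} := fun y =>
    measurableSet_lt ENNReal.measurable_ofReal measurable_const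
  have hfin : ∀ y : ℝ, 0 ≤ y → ∫⁻ s in Ioi (0 : ℝ), {s : ℝ | ENNReal.ofReal s <
      ENNReal.ofReal y}.indicator (fun s => ENNReal.ofReal (a * s ^ (a - 1))) s =
        ENNReal.ofReal y ^ a := by
    intro y hy
    rw [← setLIntegral_Ioo_rpow ha hy, lintegral_indicator (hm _),
      Measure.restrict_restrict (hm _)]
    congr 2
    ext s
    simp only [Set.mem_inter_iff, Set.mem_ofPred_eq, Set.mem_Ioi, Set.mem_Ioo]
    constructor
    · rintro ⟨h1, h2⟩
      exact ⟨h2, (ENNReal.ofReal_lt_ofReal_iff_of_nonneg h2.le).1 h1⟩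
    · rintro ⟨h1, h2⟩
      exact ⟨(ENNReal.ofReal_lt_ofReal_iff_of_nonneg h1.le).2 h2, h1⟩
  rcases eq_or_ne y ⊤ with rfl | hy
  · rw [ENNReal.top_rpow_of_pos ha, eq_top_iff]
    refine le_of_forall_lt fun z hz => ?_
    lift z to NNReal using hz.ne
    have h : (z : ℝ≥0∞) < ENNReal.ofReal (((z : ℝ) + 1) ^ a⁻¹) ^ a := by
      rw [ENNReal.ofReal_rpow_of_nonneg (by positivity) ha.le, ← Real.rpow_mul (by positivity),
        inv_mul_cancel₀ ha.ne', Real.rpow_one, ENNReal.lt_ofReal_iff_toReal_lt (by simp)]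
      simp
    refine h.trans_le ?_
    rw [← hfin _ (by positivity)]
    refine lintegral_mono fun s => Set.indicator_le_indicator_of_subset (fun s _ => ?_)
      (fun _ => zero_le) s
    exact ENNReal.ofReal_lt_top
  · rw [← ENNReal.ofReal_toReal hy]
    exact hfin _ ENNReal.toReal_nonneg

/-- The layer cake formula for functions with values in `ℝ≥0∞`. -/
lemma lintegral_rpow_eq_lintegral_measure {α : Type*} [MeasurableSpace α] (μ : Measure α)
    [SFinite μ] {g : α → ℝ≥0∞} (hg : Measurable g) {a : ℝ} (ha : 0 < a) :
    ∫⁻ x, g x ^ a ∂μ =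
      ∫⁻ s in Ioi (0 : ℝ), ENNReal.ofReal (a * s ^ (a - 1)) * μ {x | ENNReal.ofReal s < g x} := by
  have hT : MeasurableSet {w : α × ℝ | ENNReal.ofReal w.2 < g w.1} :=
    measurableSet_lt (by fun_prop) (by fun_prop)
  have hK : Measurable fun w : α × ℝ => {w : α × ℝ | ENNReal.ofReal w.2 < g w.1}.indicator
      (fun w => ENNReal.ofReal (a * w.2 ^ (a - 1))) w := Measurable.indicator (by fun_prop) hT
  calc ∫⁻ x, g x ^ a ∂μ
      = ∫⁻ x, (∫⁻ s in Ioi (0 : ℝ), {w : α × ℝ | ENNReal.ofReal w.2 < g w.1}.indicator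
          (fun w => ENNReal.ofReal (a * w.2 ^ (a - 1))) (x, s)) ∂μ :=
        lintegral_congr fun x => (setLIntegral_Ioi_indicator_rpow ha (g x)).symm
    _ = ∫⁻ s in Ioi (0 : ℝ), (∫⁻ x, {w : α × ℝ | ENNReal.ofReal w.2 < g w.1}.indicator
          (fun w => ENNReal.ofReal (a * w.2 ^ (a - 1))) (x, s) ∂μ) :=
        lintegral_lintegral_swap hK.aemeasurable
    _ = _ := lintegral_congr fun s => by
        have hm : MeasurableSet {x | ENNReal.ofReal s < g x} :=
          measurableSet_lt measurable_const hg
        exact lintegral_indicator_const hm (ENNReal.ofReal (a * s ^ (a - 1)))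

lemma maxFn_le_add {f g : (Fin n → ℝ) → ℝ≥0∞} {a : ℝ≥0∞} (hfg : ∀ x, f x ≤ g x + a)
    (x : Fin n → ℝ) : maxFn f x ≤ maxFn g x + a := by
  refine iSup₂_le fun q hq => ?_
  have hr : 0 < q.2 := dist_nonneg.trans_lt hq
  have h0 : volume (Metric.ball q.1 q.2) ≠ 0 := (Metric.measure_ball_pos _ _ hr).ne'
  have ht : volume (Metric.ball q.1 q.2) ≠ ⊤ := measure_ball_lt_top.ne
  calc (∫⁻ y in Metric.ball q.1 q.2, f y) / volume (Metric.ball q.1 q.2)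
      ≤ (∫⁻ y in Metric.ball q.1 q.2, (g y + a)) / volume (Metric.ball q.1 q.2) := by
        gcongr with y; exact hfg y
    _ = (∫⁻ y in Metric.ball q.1 q.2, g y) / volume (Metric.ball q.1 q.2) + a := by
        rw [lintegral_add_right _ measurable_const, lintegral_const, Measure.restrict_apply_univ,
          ENNReal.add_div, ENNReal.mul_div_cancel_right h0 ht]
    _ ≤ _ := by gcongr; exact le_maxFn g hq

/-- The strong type inequality for the maximal function. -/
lemma lintegral_maxFn_rpow_le {f : (Fin n → ℝ) → ℝ≥0∞} (hf : Measurable f) {q : ℝ} (hq : 1 < q) :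
    ∫⁻ x, maxFn f x ^ q ≤
      ENNReal.ofReal (2 * 5 ^ n * (q / (q - 1)) * 2 ^ (q - 1)) * ∫⁻ x, f x ^ q := by
  have hq1 : 0 < q - 1 := by linarith
  set ν : Measure (Fin n → ℝ) := volume.withDensity f with hν
  have hlevel : ∀ s : ℝ, 0 < s → volume {x | ENNReal.ofReal s < maxFn f x} ≤
      ENNReal.ofReal (5 ^ n * 2 / s) * ν {x | ENNReal.ofReal s < 2 * f x} := by
    intro s hs
    have hm : MeasurableSet {x | ENNReal.ofReal s < 2 * f x} :=
      measurableSet_lt measurable_const (hf.const_mul 2)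
    set g := {x | ENNReal.ofReal s < 2 * f x}.indicator f with hg
    have hle : ∀ x, f x ≤ g x + ENNReal.ofReal (s / 2) := fun x => by
      by_cases hx : x ∈ {x | ENNReal.ofReal s < 2 * f x}
      · rw [hg, Set.indicator_of_mem hx]; exact le_self_add
      · rw [hg, Set.indicator_of_notMem hx, zero_add]
        have hx' : 2 * f x ≤ ENNReal.ofReal s := not_lt.1 hx
        rw [ENNReal.ofReal_div_of_pos two_pos, ENNReal.ofReal_ofNat]
        rw [ENNReal.le_div_iff_mul_le (by simp) (by simp), mul_comm]
        exact hx'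
    calc volume {x | ENNReal.ofReal s < maxFn f x}
        ≤ volume {x | ENNReal.ofReal (s / 2) < maxFn g x} := by
          refine measure_mono fun x hx => ?_
          have hx : ENNReal.ofReal s < maxFn f x := hx
          have := hx.trans_le (maxFn_le_add hle x)
          rw [← add_halves s, ENNReal.ofReal_add (by positivity) (by positivity), add_halves] at this
          exact (ENNReal.add_lt_add_iff_right ENNReal.ofReal_ne_top).1 this
      _ ≤ ENNReal.ofReal 5 ^ n * (ENNReal.ofReal (s / 2))⁻¹ * ∫⁻ x, g x :=
          measure_lt_maxFn_le g (ENNReal.ofReal_pos.2 (by positivity)).ne' ENNReal.ofReal_ne_top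
      _ = _ := by
          rw [hg, lintegral_indicator hm, hν, withDensity_apply _ hm,
            ← ENNReal.ofReal_inv_of_pos (by positivity), ← ENNReal.ofReal_pow (by norm_num),
            ← ENNReal.ofReal_mul (by positivity)]
          congr 2
          field_simp
  calc ∫⁻ x, maxFn f x ^ q
      = ∫⁻ s in Ioi (0 : ℝ), ENNReal.ofReal (q * s ^ (q - 1)) *
          volume {x | ENNReal.ofReal s < maxFn f x} :=
        lintegral_rpow_eq_lintegral_measure _ (measurable_maxFn f) (by linarith)
    _ ≤ ∫⁻ s in Ioi (0 : ℝ), ENNReal.ofReal (2 * 5 ^ n * (q / (q - 1))) *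
          (ENNReal.ofReal ((q - 1) * s ^ (q - 1 - 1)) * ν {x | ENNReal.ofReal s < 2 * f x}) := by
        refine setLIntegral_mono' measurableSet_Ioi fun s hs => ?_
        have hs : 0 < s := hs
        calc ENNReal.ofReal (q * s ^ (q - 1)) * volume {x | ENNReal.ofReal s < maxFn f x}
            ≤ ENNReal.ofReal (q * s ^ (q - 1)) *
                (ENNReal.ofReal (5 ^ n * 2 / s) * ν {x | ENNReal.ofReal s < 2 * f x}) := by
              gcongr; exact hlevel s hs
          _ = _ := by
              rw [← mul_assoc, ← mul_assoc, ← ENNReal.ofReal_mul (by positivity),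
                ← ENNReal.ofReal_mul (by positivity)]
              congr 2
              rw [Real.rpow_sub_one hs.ne' (q - 1)]
              field_simp
    _ = ENNReal.ofReal (2 * 5 ^ n * (q / (q - 1))) * ∫⁻ x, (2 * f x) ^ (q - 1) ∂ν := by
        rw [lintegral_const_mul' _ _ ENNReal.ofReal_ne_top,
          lintegral_rpow_eq_lintegral_measure ν (hf.const_mul 2) hq1]
    _ = _ := by
        rw [hν, lintegral_withDensity_eq_lintegral_mul _ hf (by fun_prop)]
        rw [ENNReal.ofReal_mul (p := 2 * 5 ^ n * (q / (q - 1))) (by positivity),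
          mul_assoc (ENNReal.ofReal (2 * 5 ^ n * (q / (q - 1)))),
          ← lintegral_const_mul' (ENNReal.ofReal (2 ^ (q - 1))) _ ENNReal.ofReal_ne_top]
        congr 1
        refine lintegral_congr fun x => ?_
        rw [Pi.mul_apply, ENNReal.mul_rpow_of_nonneg _ _ hq1.le,
          ← ENNReal.ofReal_rpow_of_pos two_pos, ENNReal.ofReal_ofNat, mul_left_comm]
        congr 1
        conv_lhs => rw [← ENNReal.rpow_one (f x), ← ENNReal.rpow_mul]
        rw [one_mul, ← ENNReal.rpow_add_of_nonneg _ _ zero_le_one hq1.le]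
        congr 1; ring

end MaximalTheorem

section AreaIntegral

variable {n : ℕ}

/-- The average of `h` over the shadow of a point of the upper half space. -/
def shadowAvg (h : (Fin n → ℝ) → ℝ≥0∞) (p : Pt n) : ℝ≥0∞ :=
  ∫⁻ x, {w : (Fin n → ℝ) × Pt n | dist w.1 w.2.1 < w.2.2}.indicator
    (fun w => h w.1 * (ENNReal.ofReal (2 * w.2.2) ^ n)⁻¹) (x, p)

/-- The conical area integral of a measure on the upper half space. -/
def areaFn (μ : Measure (Pt n)) (x : Fin n → ℝ) : ℝ≥0∞ :=
  ∫⁻ p in {p : Pt n | dist x p.1 < p.2}, (ENNReal.ofReal (2 * p.2) ^ n)⁻¹ ∂μ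

lemma measurableSet_dist_lt :
    MeasurableSet {w : (Fin n → ℝ) × Pt n | dist w.1 w.2.1 < w.2.2} :=
  measurableSet_lt (by fun_prop) (by fun_prop)

lemma measurable_shadow {h : (Fin n → ℝ) → ℝ≥0∞} (hh : Measurable h) :
    Measurable ({w : (Fin n → ℝ) × Pt n | dist w.1 w.2.1 < w.2.2}.indicator
      (fun w => h w.1 * (ENNReal.ofReal (2 * w.2.2) ^ n)⁻¹)) :=
  Measurable.indicator (by fun_prop) measurableSet_dist_lt

lemma measurable_shadowAvg {h : (Fin n → ℝ) → ℝ≥0∞} (hh : Measurable h) :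
    Measurable (shadowAvg h) :=
  (measurable_shadow hh).lintegral_prod_left'

lemma shadowAvg_eq (h : (Fin n → ℝ) → ℝ≥0∞) {p : Pt n} (hp : 0 < p.2) :
    shadowAvg h p = (∫⁻ x in Metric.ball p.1 p.2, h x) / volume (Metric.ball p.1 p.2) := by
  have hne : (ENNReal.ofReal (2 * p.2) ^ n)⁻¹ ≠ ⊤ :=
    ENNReal.inv_ne_top.2 (pow_ne_zero _ (ENNReal.ofReal_pos.2 (by positivity)).ne')
  rw [volume_ball_pi _ hp, ENNReal.div_eq_inv_mul, mul_comm, ← lintegral_mul_const' _ _ hne,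
    ← lintegral_indicator measurableSet_ball]
  rfl

lemma lintegral_mul_areaFn (μ : Measure (Pt n)) [SFinite μ] {h : (Fin n → ℝ) → ℝ≥0∞}
    (hh : Measurable h) : ∫⁻ x, h x * areaFn μ x = ∫⁻ p, shadowAvg h p ∂μ := by
  unfold shadowAvg
  rw [← lintegral_lintegral_swap (μ := (volume : Measure (Fin n → ℝ))) (ν := μ)
    (f := fun x p => {w : (Fin n → ℝ) × Pt n | dist w.1 w.2.1 < w.2.2}.indicator
      (fun w => h w.1 * (ENNReal.ofReal (2 * w.2.2) ^ n)⁻¹) (x, p))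
    (measurable_shadow hh).aemeasurable]
  refine lintegral_congr fun x => ?_
  rw [areaFn, ← lintegral_const_mul _ (by fun_prop)]
  exact (lintegral_indicator (measurable_prodMk_left (x := x) measurableSet_dist_lt) _).symm

/-- Carleson embedding: pairing an area integral with a function is controlled by maximal
functions. -/
lemma lintegral_mul_areaFn_le {μ : Measure (Pt n)} [SFinite μ] (hμ0 : μ {p | p.2 ≤ 0} = 0)
    {b : (Fin n → ℝ) → ℝ≥0∞} {C : ℝ≥0∞} (hC : C ≠ ⊤)
    (hμ : ∀ (c : Fin n → ℝ) (r : ℝ), 0 < r →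
      μ (Metric.ball c r ×ˢ Ioo 0 r) ≤ C * ∫⁻ x in Metric.ball c (8 * r), b x)
    {h : (Fin n → ℝ) → ℝ≥0∞} (hh : Measurable h) :
    ∫⁻ x, h x * areaFn μ x ≤
      C * ENNReal.ofReal 32 ^ n * ∫⁻ x, maxFn h x * maxFn b x := by
  set ν : Measure (Fin n → ℝ) := volume.withDensity (maxFn b) with hν
  have hlevel : ∀ s : ℝ, μ {p | ENNReal.ofReal s < shadowAvg h p} ≤
      C * ENNReal.ofReal 32 ^ n * ν {x | ENNReal.ofReal s < maxFn h x} := by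
    intro s
    set T : Set (Pt n) := {p | 0 < p.2 ∧ ENNReal.ofReal s < shadowAvg h p} with hT
    calc μ {p | ENNReal.ofReal s < shadowAvg h p} ≤ μ (T ∪ {p | p.2 ≤ 0}) := by
          refine measure_mono fun p hp => ?_
          rcases lt_or_ge 0 p.2 with h0 | h0
          · exact Or.inl ⟨h0, hp⟩
          · exact Or.inr h0
      _ ≤ μ T := by
          refine (measure_union_le _ _).trans ?_
          rw [hμ0, add_zero]
      _ ≤ C * ENNReal.ofReal 32 ^ n * ∫⁻ x in ⋃ q ∈ T, Metric.ball q.1 q.2, maxFn b x :=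
          measure_le_lintegral_maxFn hC hμ fun q hq => hq.1
      _ ≤ C * ENNReal.ofReal 32 ^ n * ν {x | ENNReal.ofReal s < maxFn h x} := by
          rw [hν, withDensity_apply _ (measurableSet_lt measurable_const (measurable_maxFn h))]
          gcongr _ * ?_
          refine lintegral_mono_set (iUnion₂_subset fun q hq x hx => ?_)
          exact hq.2.trans_le ((shadowAvg_eq h hq.1).trans_le (le_maxFn h hx))
  calc ∫⁻ x, h x * areaFn μ x = ∫⁻ p, shadowAvg h p ^ (1 : ℝ) ∂μ := by
        simp only [ENNReal.rpow_one]
        exact lintegral_mul_areaFn μ hh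
    _ = ∫⁻ s in Ioi (0 : ℝ), ENNReal.ofReal (1 * s ^ ((1 : ℝ) - 1)) *
          μ {p | ENNReal.ofReal s < shadowAvg h p} :=
        lintegral_rpow_eq_lintegral_measure μ (measurable_shadowAvg hh) one_pos
    _ ≤ ∫⁻ s in Ioi (0 : ℝ), C * ENNReal.ofReal 32 ^ n *
          (ENNReal.ofReal (1 * s ^ ((1 : ℝ) - 1)) * ν {x | ENNReal.ofReal s < maxFn h x}) := by
        refine lintegral_mono fun s => ?_
        rw [mul_left_comm]
        gcongr
        exact hlevel s
    _ = C * ENNReal.ofReal 32 ^ n * ∫⁻ x, maxFn h x ^ (1 : ℝ) ∂ν := by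
        rw [lintegral_const_mul' _ _ (by finiteness),
          lintegral_rpow_eq_lintegral_measure ν (measurable_maxFn h) one_pos]
    _ = _ := by
        simp only [ENNReal.rpow_one]
        rw [hν, lintegral_withDensity_eq_lintegral_mul _ (measurable_maxFn b) (measurable_maxFn h)]
        simp only [Pi.mul_apply, mul_comm]

lemma lintegral_areaFn_le {μ : Measure (Pt n)} [SFinite μ] (hμ0 : μ {p | p.2 ≤ 0} = 0)
    {b : (Fin n → ℝ) → ℝ≥0∞} {C : ℝ≥0∞}
    (hμ : ∀ (c : Fin n → ℝ) (r : ℝ), 0 < r →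
      μ (Metric.ball c r ×ˢ Ioo 0 r) ≤ C * ∫⁻ x in Metric.ball c (8 * r), b x) :
    ∫⁻ x, areaFn μ x ≤ C * ∫⁻ x, b x := by
  have h1 := lintegral_mul_areaFn μ (h := fun _ => 1) measurable_const
  simp only [one_mul] at h1
  let U : ℕ → Set (Pt n) := fun k => Metric.ball 0 (k + 1) ×ˢ Ioo 0 (k + 1 : ℝ)
  have hU : Monotone U := fun k l hkl => by
    have : (k : ℝ) ≤ l := by exact_mod_cast hkl
    exact Set.prod_mono (Metric.ball_subset_ball (by linarith)) (Ioo_subset_Ioo le_rfl (by linarith))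
  have hpos : ∀ᵐ p ∂μ, 0 < p.2 := by
    rw [ae_iff]; simpa only [not_lt] using hμ0
  calc ∫⁻ x, areaFn μ x = ∫⁻ p, shadowAvg (fun _ => 1) p ∂μ := h1
    _ ≤ ∫⁻ p, 1 ∂μ := lintegral_mono_ae (hpos.mono fun p hp => by
        rw [shadowAvg_eq _ hp, lintegral_one, Measure.restrict_apply_univ]
        exact ENNReal.div_self_le_one)
    _ = μ univ := lintegral_one
    _ ≤ μ ((⋃ k, U k) ∪ {p | p.2 ≤ 0}) := by
        refine measure_mono fun p _ => ?_
        rcases lt_or_ge 0 p.2 with h0 | h0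
        · left
          obtain ⟨k, hk⟩ := exists_nat_ge (max (dist p.1 0) p.2)
          refine mem_iUnion.2 ⟨k, ?_, h0, ?_⟩
          · rw [Metric.mem_ball]; linarith [le_max_left (dist p.1 0) p.2]
          · linarith [le_max_right (dist p.1 0) p.2]
        · exact Or.inr h0
    _ ≤ μ (⋃ k, U k) := by
        refine (measure_union_le _ _).trans ?_
        rw [hμ0, add_zero]
    _ ≤ C * ∫⁻ x, b x := by
        rw [hU.measure_iUnion]
        refine iSup_le fun k => (hμ 0 (k + 1) (by positivity)).trans ?_
        gcongr _ * ?_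
        exact setLIntegral_le_lintegral _ _

/-- An `L^q` bound for functions dominated by the area integral of a Carleson type measure. -/
lemma exists_lintegral_rpow_le (n : ℕ) {q : ℝ} (hq : 1 ≤ q) {C K : ℝ≥0∞} (hC : C ≠ ⊤)
    (hK : K ≠ ⊤) : ∃ D : ℝ≥0∞, D ≠ ⊤ ∧ ∀ (μ : Measure (Pt n)) [SFinite μ], μ {p | p.2 ≤ 0} = 0 →
      ∀ b : (Fin n → ℝ) → ℝ≥0∞, Measurable b → (∀ (c : Fin n → ℝ) (r : ℝ), 0 < r →
        μ (Metric.ball c r ×ˢ Ioo 0 r) ≤ C * ∫⁻ x in Metric.ball c (8 * r), b x) →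
      ∀ g : (Fin n → ℝ) → ℝ≥0∞, Measurable g → (∀ x, g x ≤ K * areaFn μ x) →
        ∫⁻ x, g x < ⊤ → ∫⁻ x, g x ^ q ≤ D * ∫⁻ x, b x ^ q := by
  rcases hq.eq_or_lt with rfl | hq
  · refine ⟨K * C, by finiteness, fun μ _ hμ0 b _ hμ g _ hg _ => ?_⟩
    simp only [ENNReal.rpow_one]
    calc ∫⁻ x, g x ≤ ∫⁻ x, K * areaFn μ x := lintegral_mono hg
      _ = K * ∫⁻ x, areaFn μ x := lintegral_const_mul' _ _ hK
      _ ≤ K * (C * ∫⁻ x, b x) := by gcongr; exact lintegral_areaFn_le hμ0 hμ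
      _ = _ := by ring
  have hq0 : 0 < q := by linarith
  have hconj := Real.HolderConjugate.conjExponent hq
  set q' := q.conjExponent with hq'
  have hq'1 : 1 < q' := hconj.symm.lt
  have hq'0 : 0 < q' := by linarith
  set c := ENNReal.ofReal (2 * 5 ^ n * (q / (q - 1)) * 2 ^ (q - 1)) with hc
  set c' := ENNReal.ofReal (2 * 5 ^ n * (q' / (q' - 1)) * 2 ^ (q' - 1)) with hc'
  have hct : c ≠ ⊤ := ENNReal.ofReal_ne_top
  have hc't : c' ≠ ⊤ := ENNReal.ofReal_ne_top
  set D := K * (C * ENNReal.ofReal 32 ^ n) * (c' ^ (1 / q') * c ^ (1 / q)) with hD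
  have hDt : D ≠ ⊤ := by
    have h1 : c' ^ (1 / q') ≠ ⊤ := ENNReal.rpow_ne_top_of_nonneg (by positivity) hc't
    have h2 : c ^ (1 / q) ≠ ⊤ := ENNReal.rpow_ne_top_of_nonneg (by positivity) hct
    finiteness
  refine ⟨D ^ q, ENNReal.rpow_ne_top_of_nonneg hq0.le hDt,
    fun μ _ hμ0 b hb hμ g hg hgK hgfin => ?_⟩
  set B := ∫⁻ x, b x ^ q
  have htrunc : ∀ k : ℕ, ∫⁻ x, min (g x) k ^ q ≤ D ^ q * B := by
    intro k
    set I := ∫⁻ x, min (g x) (k : ℝ≥0∞) ^ q with hI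
    have hmm : Measurable fun x => min (g x) (k : ℝ≥0∞) := hg.min measurable_const
    have hIfin : I ≠ ⊤ := by
      have : I ≤ (k : ℝ≥0∞) ^ (q - 1) * ∫⁻ x, g x := by
        rw [← lintegral_const_mul _ hg]
        refine lintegral_mono fun x => ?_
        calc min (g x) (k : ℝ≥0∞) ^ q = min (g x) (k : ℝ≥0∞) ^ (q - 1) * min (g x) k := by
              conv_lhs => rw [← sub_add_cancel q 1,
                ENNReal.rpow_add_of_nonneg _ _ (by linarith) zero_le_one, ENNReal.rpow_one]
          _ ≤ _ := by
              gcongr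
              · exact min_le_right _ _
              · exact min_le_left _ _
      refine (this.trans_lt (ENNReal.mul_lt_top ?_ hgfin)).ne
      exact ENNReal.rpow_lt_top_of_nonneg (by linarith) (ENNReal.natCast_ne_top k)
    set h : (Fin n → ℝ) → ℝ≥0∞ := fun x => min (g x) (k : ℝ≥0∞) ^ (q - 1) with hh
    have hhm : Measurable h := hmm.pow_const _
    have hhI : ∫⁻ x, h x ^ q' = I := by
      refine lintegral_congr fun x => ?_
      rw [hh, ← ENNReal.rpow_mul]
      congr 1
      rw [hq', Real.conjExponent]
      have : q - 1 ≠ 0 := by linarith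
      field_simp
    have key : I ≤ D * B ^ (1 / q) * I ^ (1 / q') := by
      calc I ≤ ∫⁻ x, K * (h x * areaFn μ x) := by
            refine lintegral_mono fun x => ?_
            calc min (g x) (k : ℝ≥0∞) ^ q = h x * min (g x) k := by
                  conv_lhs => rw [← sub_add_cancel q 1,
                    ENNReal.rpow_add_of_nonneg _ _ (by linarith) zero_le_one, ENNReal.rpow_one]
              _ ≤ h x * (K * areaFn μ x) := by
                  gcongr; exact (min_le_left _ _).trans (hgK x)
              _ = _ := by ring
        _ = K * ∫⁻ x, h x * areaFn μ x := lintegral_const_mul' _ _ hK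
        _ ≤ K * (C * ENNReal.ofReal 32 ^ n * ∫⁻ x, maxFn h x * maxFn b x) := by
            gcongr; exact lintegral_mul_areaFn_le hμ0 hC hμ hhm
        _ ≤ K * (C * ENNReal.ofReal 32 ^ n *
              ((∫⁻ x, maxFn h x ^ q') ^ (1 / q') * (∫⁻ x, maxFn b x ^ q) ^ (1 / q))) := by
            gcongr
            exact ENNReal.lintegral_mul_le_Lp_mul_Lq volume hconj.symm
              (measurable_maxFn h).aemeasurable (measurable_maxFn b).aemeasurable
        _ ≤ K * (C * ENNReal.ofReal 32 ^ n * ((c' * I) ^ (1 / q') * (c * B) ^ (1 / q))) := by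
            gcongr
            · exact (lintegral_maxFn_rpow_le hhm hq'1).trans_eq (by rw [hhI])
            · exact lintegral_maxFn_rpow_le hb hq
        _ = _ := by
            rw [ENNReal.mul_rpow_of_nonneg _ _ (by positivity),
              ENNReal.mul_rpow_of_nonneg _ _ (by positivity), hD]
            ring
    rcases eq_or_ne I 0 with hI0 | hI0
    · rw [hI0]; exact zero_le
    have hs : I = I ^ (1 / q) * I ^ (1 / q') := by
      rw [← ENNReal.rpow_add _ _ hI0 hIfin, one_div, one_div, hconj.inv_add_inv_eq_one,
        ENNReal.rpow_one]
    have h3 : I ^ (1 / q) ≤ D * B ^ (1 / q) := by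
      rw [hs] at key
      have hne0 : I ^ (1 / q') ≠ 0 := by
        rw [Ne, ENNReal.rpow_eq_zero_iff]; simp [hI0, hIfin]
      have hnet : I ^ (1 / q') ≠ ⊤ := ENNReal.rpow_ne_top_of_nonneg (by positivity) hIfin
      rw [← hs] at key
      conv_lhs at key => rw [hs]
      exact (ENNReal.mul_le_mul_iff_left hne0 hnet).1 key
    calc I = (I ^ (1 / q)) ^ q := by
          rw [← ENNReal.rpow_mul, one_div, inv_mul_cancel₀ hq0.ne', ENNReal.rpow_one]
      _ ≤ (D * B ^ (1 / q)) ^ q := by gcongr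
      _ = D ^ q * B := by
          rw [ENNReal.mul_rpow_of_nonneg _ _ hq0.le, ← ENNReal.rpow_mul, one_div,
            inv_mul_cancel₀ hq0.ne', ENNReal.rpow_one]
  have hsup : ∀ x, g x ^ q = ⨆ k : ℕ, min (g x) (k : ℝ≥0∞) ^ q := fun x => by
    have h1 : g x = ⨆ k : ℕ, min (g x) (k : ℝ≥0∞) := by
      rw [← inf_iSup_eq, ENNReal.iSup_natCast, inf_top_eq]
    conv_lhs => rw [h1]
    exact (ENNReal.orderIsoRpow q hq0).map_iSup _
  simp only [hsup]
  rw [lintegral_iSup (fun k => (hg.min measurable_const).pow_const q)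
    fun k l hkl x => by dsimp only; gcongr]
  exact iSup_le htrunc

end AreaIntegral

section LusinArea

variable {n : ℕ}

lemma measurable_lusin_sq {F : Pt n → ℝ≥0∞} (hF : Measurable F) :
    Measurable fun x => lusin F x ^ 2 := by
  have hT : Measurable fun q : (Fin n → ℝ) × Pt n =>
      {q : (Fin n → ℝ) × Pt n | 0 < q.2.2 ∧ eudist q.1 q.2.1 < q.2.2}.indicator
        (fun q => F q.2 * ENNReal.ofReal (q.2.2 ^ ((1 : ℝ) - n))) q :=
    Measurable.indicator (by fun_prop) measurableSet_cone
  convert hT.lintegral_prod_right' (ν := (volume : Measure (Pt n))) using 2 with x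
  rw [lusin_sq]
  exact (lintegral_indicator (measurable_prodMk_left (x := x) measurableSet_cone) _).symm

lemma lusin_sq_le_areaFn {F : Pt n → ℝ≥0∞} (hF : Measurable F) (x : Fin n → ℝ) :
    lusin F x ^ 2 ≤ ENNReal.ofReal 2 ^ n *
      areaFn (volume.withDensity fun p : Pt n => F p * ENNReal.ofReal p.2) x := by
  have hcone : MeasurableSet {p : Pt n | dist x p.1 < p.2} :=
    measurableSet_lt (by fun_prop) (by fun_prop)
  rw [lusin_sq, areaFn, setLIntegral_withDensity_eq_setLIntegral_mul _ (by fun_prop)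
    (by fun_prop) hcone, ← lintegral_const_mul' _ _ (by finiteness)]
  refine (setLIntegral_mono' (measurable_prodMk_left (x := x) measurableSet_cone)
    fun p hp => ?_).trans (lintegral_mono_set fun p hp => (dist_le_eudist _ _).trans_lt hp.2)
  replace hp : 0 < p.2 := hp.1
  have h0 : ENNReal.ofReal p.2 ^ n ≠ 0 := pow_ne_zero _ (ENNReal.ofReal_pos.2 hp).ne'
  have h2 : (ENNReal.ofReal 2 ^ n) ≠ 0 := pow_ne_zero _ (by simp)
  have h : ENNReal.ofReal (p.2 ^ ((1 : ℝ) - n)) =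
      ENNReal.ofReal p.2 * (ENNReal.ofReal p.2 ^ n)⁻¹ := by
    conv_rhs => enter [1]; rw [← ofReal_rpow_mul_pow (n := n) hp]
    rw [mul_assoc, ENNReal.mul_inv_cancel h0 (by finiteness), mul_one]
  rw [h, Pi.mul_apply, ENNReal.ofReal_mul zero_le_two, mul_pow,
    ENNReal.mul_inv (Or.inl h2) (Or.inl (by finiteness))]
  calc _ = (ENNReal.ofReal 2 ^ n * (ENNReal.ofReal 2 ^ n)⁻¹) *
        (F p * (ENNReal.ofReal p.2 * (ENNReal.ofReal p.2 ^ n)⁻¹)) := by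
        rw [ENNReal.mul_inv_cancel h2 (by finiteness), one_mul]
    _ ≤ _ := le_of_eq (by ring)

end LusinArea

/-- (Lemma `lem:lusin:+`, solution version.)  For bounded measurable
`t`-independent coefficients of order `m` satisfying the Gårding inequality, there is
`ε > 0` (depending only on `n, m, λ, Λ`) such that for `2 ≤ p < 2 + ε` there is a constant
`C_p` with: if `u` has weak derivatives up to order `m` in `L²_loc(ℝ^{n+1}_+ ∪ ℝ^{n+1}_−)`
with `A₂⁺(t∇^m u) ∈ L²`, `Ñ⋆(∇^{m−1}u) ∈ L²_loc`, and for every cube `Q` there is `u_Q`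
with `u − u_Q ∈ W²_m(3Q × (−ℓ(Q),ℓ(Q)))`, `L(u − u_Q) = 0` there, and
`‖A₂⁺(t∇^m u_Q)‖²_{L²} + ‖Ñ⋆(∇^{m−1}u_Q)‖²_{L²} ≤ ‖ψ‖²_{L²(4Q)}`, then
`‖A₂⁺(t∇^m u)‖_{L^p} ≤ C_p ‖ψ‖_{L^p} + C_p ‖Ñ⋆(∇^{m−1}u)‖_{L^p}`. -/
theorem statement4 (n m : ℕ) (hm : 1 ≤ m) (lam Λ : ℝ) (hlam : 0 < lam) :
    ∃ ε : ℝ, 0 < ε ∧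
      ∀ p : ℝ, 2 ≤ p → p < 2 + ε →
        ∃ C : ℝ≥0∞, 0 < C ∧ C < ⊤ ∧
          ∀ A : Coef n, CoefMeasurable A → CoefBounded m A Λ → TIndep A →
            Garding m A lam →
          ∀ (u : (Fin n → ℝ) × ℝ → ℂ)
            (du : (Fin (n + 1) → ℕ) → (Fin n → ℝ) × ℝ → ℂ),
            HasWDerivs {p : (Fin n → ℝ) × ℝ | p.2 ≠ 0} m u du →
            (∀ γ : Fin (n + 1) → ℕ, (∑ i, γ i) ≤ m →
              L2loc {p : (Fin n → ℝ) × ℝ | p.2 ≠ 0}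
                (fun p => (‖du γ p‖₊ : ℝ≥0∞) ^ 2)) →
            (∫⁻ x, (lusin (gradSq m du) x) ^ 2) < ⊤ →
            (∀ K : Set (Fin n → ℝ), IsCompact K →
              (∫⁻ x in K, (ntMaxStar (gradSq (m - 1) du) x) ^ 2) < ⊤) →
          ∀ ψ : (Fin n → ℝ) → ℝ, Measurable ψ → (∀ x, 0 ≤ ψ x) →
            (∀ K : Set (Fin n → ℝ), IsCompact K →
              (∫⁻ x in K, ENNReal.ofReal (ψ x) ^ 2) < ⊤) →
            (∀ (c : Fin n → ℝ) (ℓ : ℝ), 0 < ℓ →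
              ∃ (uQ : (Fin n → ℝ) × ℝ → ℂ)
                (duQ : (Fin (n + 1) → ℕ) → (Fin n → ℝ) × ℝ → ℂ),
                HasWDerivs {p : (Fin n → ℝ) × ℝ | p.2 ≠ 0} m uQ duQ ∧
                (∀ γ : Fin (n + 1) → ℕ, (∑ i, γ i) ≤ m →
                  L2loc {p : (Fin n → ℝ) × ℝ | p.2 ≠ 0}
                    (fun p => (‖duQ γ p‖₊ : ℝ≥0∞) ^ 2)) ∧
                (∀ γ : Fin (n + 1) → ℕ, (∑ i, γ i) ≤ m →
                  (∫⁻ p in (cube c (3 * ℓ)) ×ˢ Ioo (-ℓ) ℓ,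
                      (‖du γ p - duQ γ p‖₊ : ℝ≥0∞) ^ 2) < ⊤ ∧
                  IsWeakDeriv ((cube c (3 * ℓ)) ×ˢ Ioo (-ℓ) ℓ) γ
                    (fun p => u p - uQ p) (fun p => du γ p - duQ γ p)) ∧
                WeakSolution m A ((cube c (3 * ℓ)) ×ˢ Ioo (-ℓ) ℓ)
                  (fun β p => du β p - duQ β p) ∧
                (∫⁻ x, (lusin (gradSq m duQ) x) ^ 2) +
                    (∫⁻ x, (ntMaxStar (gradSq (m - 1) duQ) x) ^ 2) ≤
                  ∫⁻ x in cube c (4 * ℓ), ENNReal.ofReal (ψ x) ^ 2) →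
            (∫⁻ x, ENNReal.ofReal (ψ x) ^ p) < ⊤ →
            (∫⁻ x, (ntMaxStar (gradSq (m - 1) du) x) ^ p) < ⊤ →
            (∫⁻ x, (lusin (gradSq m du) x) ^ p) ^ (1 / p) ≤
              C * ((∫⁻ x, ENNReal.ofReal (ψ x) ^ p) ^ (1 / p) +
                   (∫⁻ x, (ntMaxStar (gradSq (m - 1) du) x) ^ p) ^ (1 / p)) := by
  refine ⟨1, one_pos, fun p hp _ => ?_⟩
  obtain ⟨C, hC, hcarl⟩ := exists_carleson n m hm lam Λ hlam
  have hq : 1 ≤ p / 2 := by linarith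
  obtain ⟨D, hD, hmain⟩ := exists_lintegral_rpow_le n hq hC
    (K := ENNReal.ofReal 2 ^ n) (by finiteness)
  have hp0 : (0 : ℝ) ≤ 1 / p := by positivity
  have h2 : (2 : ℝ≥0∞) ^ (p / 2 - 1) ≠ ⊤ := ENNReal.rpow_ne_top_of_nonneg (by linarith) (by simp)
  refine ⟨(D * 2 ^ (p / 2 - 1)) ^ (1 / p) + 1, by positivity,
    ENNReal.add_lt_top.2 ⟨ENNReal.rpow_lt_top_of_nonneg hp0 (ENNReal.mul_ne_top hD h2),
      ENNReal.one_lt_top⟩, ?_⟩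
  intro A hAm hAb _ hAg u du hu _ hlus _ ψ hψ _ _ hQ _ _
  have hG : Measurable (gradSq m du) := measurable_gradSq le_rfl fun γ hγ => (hu.2 γ hγ).1
  have hN : Measurable (ntMaxStar (gradSq (m - 1) du)) := measurable_ntMaxStar _
  have hψ' : Measurable fun x => ENNReal.ofReal (ψ x) := by fun_prop
  have hsq : ∀ a : ℝ≥0∞, (a ^ 2) ^ (p / 2) = a ^ p := fun a => by
    rw [← ENNReal.rpow_natCast, ← ENNReal.rpow_mul]
    congr 1
    push_cast
    ring
  have hμ0 : (volume.withDensity fun w : Pt n => gradSq m du w * ENNReal.ofReal w.2)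
      {w | w.2 ≤ 0} = 0 := by
    have hS : MeasurableSet {w : Pt n | w.2 ≤ 0} := measurableSet_le (by fun_prop) (by fun_prop)
    rw [withDensity_apply _ hS]
    refine (setLIntegral_congr_fun hS fun w hw => ?_).trans lintegral_zero
    rw [ENNReal.ofReal_of_nonpos hw, mul_zero]
  have key := hmain (volume.withDensity fun w : Pt n => gradSq m du w * ENNReal.ofReal w.2) hμ0
    (fun x => ntMaxStar (gradSq (m - 1) du) x ^ 2 + ENNReal.ofReal (ψ x) ^ 2) (by fun_prop)
    (fun c r hr => by
      rw [withDensity_apply _ (measurableSet_ball.prod measurableSet_Ioo)]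
      obtain ⟨uQ, duQ, h1, -, h2⟩ := hQ c (4 * r) (by positivity)
      exact hcarl A hAm hAb hAg u du hu _ hψ' c r hr ⟨uQ, duQ, h1, h2⟩)
    _ (measurable_lusin_sq hG) (lusin_sq_le_areaFn hG) hlus
  simp only [hsq] at key
  have hb : ∫⁻ x, (ntMaxStar (gradSq (m - 1) du) x ^ 2 + ENNReal.ofReal (ψ x) ^ 2) ^ (p / 2) ≤
      2 ^ (p / 2 - 1) * ((∫⁻ x, ENNReal.ofReal (ψ x) ^ p) +
        ∫⁻ x, ntMaxStar (gradSq (m - 1) du) x ^ p) := by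
    rw [← lintegral_add_left (by fun_prop), ← lintegral_const_mul' _ _ h2]
    refine lintegral_mono fun x => (ENNReal.rpow_add_le_mul_rpow_add_rpow _ _ hq).trans_eq ?_
    rw [hsq, hsq, add_comm]
  calc _ ≤ (D * 2 ^ (p / 2 - 1) * ((∫⁻ x, ENNReal.ofReal (ψ x) ^ p) +
        ∫⁻ x, ntMaxStar (gradSq (m - 1) du) x ^ p)) ^ (1 / p) := by
        refine ENNReal.rpow_le_rpow (key.trans ?_) hp0
        rw [mul_assoc]
        gcongr
    _ ≤ (D * 2 ^ (p / 2 - 1)) ^ (1 / p) * ((∫⁻ x, ENNReal.ofReal (ψ x) ^ p) ^ (1 / p) +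
        (∫⁻ x, ntMaxStar (gradSq (m - 1) du) x ^ p) ^ (1 / p)) := by
        rw [ENNReal.mul_rpow_of_nonneg _ _ hp0]
        gcongr
        exact ENNReal.rpow_add_le_add_rpow _ _ hp0 (by rw [div_le_one] <;> linarith)
    _ ≤ _ := by gcongr; exact le_self_add

end
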